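/- arXiv:1509.04167 — 3 statements merged into one kernel-verified Lean document; each statement's English description precedes it below -/
import Mathlib

section
/- Let X be a countable commutative additive monoid, d, k ≥ 1 integers, p_{j,r} ∈ ℝ for j ∈ {1,…,k}, r ∈ {1,…,d}, λ_r ∈ (0,∞), U_r probability mass functions in ℓ¹(X), W_r = U_r − δ₀, R_j = Σ_{r=1}^d p_{j,r} W_r, G = exp(Σ_{r=1}^d λ_r W_r), and p_j = Σ_{r=1}^d |p_{j,r}|. Then ‖ (∏_{j=1}^k R_j^{*2}) * G ‖ ≤ D_k · k! · ∏_{j=1}^k ( Σ_{r=1}^d |p_{j,r}| · min{ |p_{j,r}|/λ_r, p_j } ), where D_1 = 4.342, D_2 = 10.784, D_3 = 21.721, D_4 = 40.687, D_5 = 74.672, D_6 = 125.448, D_7 = 186.872, D_8 = 253.020, D_9 = 305.314, and D_k = √((2k)!)/k! for k ≥ 10. -/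
open scoped Classical BigOperators

noncomputable section

namespace PaperL1

variable {X : Type*} [AddCommMonoid X]

/-- Convolution of two summable functions on an additive commutative monoid:
`(f ⋆ g) x = Σ_{(y,z) : y + z = x} f y * g z`. -/
def conv (f g : X → ℝ) : X → ℝ :=
  fun x => ∑' p : {p : X × X // p.1 + p.2 = x}, f p.1.1 * g p.1.2

/-- The Dirac delta at a point: the unit of the convolution algebra is `delta 0`. -/
def delta (x₀ : X) : X → ℝ := fun x => if x = x₀ then 1 else 0

/-- Convolution powers, with `f^{*0} = δ₀`. -/
def convPow (f : X → ℝ) : ℕ → (X → ℝ)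
  | 0 => delta 0
  | n + 1 => conv f (convPow f n)

/-- The exponential in the convolution algebra: `exp f = Σ_m f^{*m}/m!`. -/
def convExp (f : X → ℝ) : X → ℝ :=
  fun x => ∑' m : ℕ, ((m.factorial : ℝ))⁻¹ * convPow f m x

/-- Convolution product over a finite (linearly ordered) index set; the empty
product is `δ₀`. -/
def convProd {ι : Type*} [LinearOrder ι] (s : Finset ι) (f : ι → X → ℝ) : X → ℝ :=
  (s.sort (· ≤ ·)).foldr (fun i acc => conv (f i) acc) (delta 0)

/-- The ℓ¹ norm: `‖f‖ = Σ_x |f x|`. -/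
def l1norm (f : X → ℝ) : ℝ := ∑' x, |f x|

/-- A probability mass function: nonnegative values summing to `1`. -/
def IsPmf (f : X → ℝ) : Prop := (∀ x, 0 ≤ f x) ∧ HasSum f 1

/-- The function `g(x) = 2 Σ_{m=2}^∞ (m-1) x^{m-2} / m!`. -/
def gfun (x : ℝ) : ℝ := ∑' m : ℕ, 2 * (m + 1) * x ^ m / ((m + 2).factorial : ℝ)

end PaperL1

open PaperL1

namespace PaperL1

/-- The constants `D_k` of Corollary 4.4 of Roos. -/
noncomputable def Dconst (k : ℕ) : ℝ :=
  if k = 1 then 4.342 else if k = 2 then 10.784 else if k = 3 then 21.721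
  else if k = 4 then 40.687 else if k = 5 then 74.672 else if k = 6 then 125.448
  else if k = 7 then 186.872 else if k = 8 then 253.020 else if k = 9 then 305.314
  else Real.sqrt ((2 * k).factorial : ℝ) / (k.factorial : ℝ)

end PaperL1

namespace SmoothAux

section core

/-- Product series over `Fin d → ℕ`. -/
theorem hasSum_pi_prod {A : Type*} [NormedCommRing A] [CompleteSpace A] :
    ∀ (d : ℕ) (f : Fin d → ℕ → A) (a : Fin d → A)
      (_ : ∀ r, Summable fun n => ‖f r n‖) (_ : ∀ r, HasSum (f r) (a r)),
      (Summable fun x : Fin d → ℕ => ‖∏ r, f r (x r)‖) ∧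
      HasSum (fun x : Fin d → ℕ => ∏ r, f r (x r)) (∏ r, a r) := by
  intro d
  induction d with
  | zero =>
    intro f a _ _
    constructor
    · exact Summable.of_finite
    · simp
  | succ d ih =>
    intro f a hs ha
    obtain ⟨h1, h2⟩ := ih (fun r => f r.succ) (fun r => a r.succ) (fun r => hs _) (fun r => ha _)
    have hn : Summable fun x : ℕ × (Fin d → ℕ) => ‖f 0 x.1 * ∏ r, f (Fin.succ r) (x.2 r)‖ :=
      Summable.mul_norm (f := f 0) (g := fun x : Fin d → ℕ => ∏ r, f (Fin.succ r) (x r)) (hs 0) h1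
    constructor
    · rw [← (Fin.consEquiv (fun _ : Fin (d+1) => ℕ)).summable_iff]
      refine hn.congr ?_
      intro x
      simp [Fin.consEquiv, Fin.prod_univ_succ]
    · rw [← (Fin.consEquiv (fun _ : Fin (d+1) => ℕ)).hasSum_iff, Fin.prod_univ_succ]
      have h3 := (ha 0).mul h2 hn.of_norm
      refine h3.congr_fun ?_
      intro x
      simp [Fin.consEquiv, Fin.prod_univ_succ]

variable {d : ℕ} (lam : Fin d → ℝ)

/-- product Poisson weights -/
def wt (x : Fin d → ℕ) : ℝ := ∏ r, (Real.exp (-lam r) * (lam r ^ (x r) / (x r).factorial))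

/-- exponential growth -/
def Grow (q : (Fin d → ℕ) → ℝ) : Prop :=
  ∃ C B : ℝ, 0 ≤ C ∧ 1 ≤ B ∧ ∀ x, |q x| ≤ C * B ^ (∑ r, x r)

theorem Grow.one : Grow (fun _ : Fin d → ℕ => (1:ℝ)) := ⟨1, 1, by norm_num, le_rfl, by simp⟩

theorem Grow.mul {f g : (Fin d → ℕ) → ℝ} (hf : Grow f) (hg : Grow g) :
    Grow (fun x => f x * g x) := by
  obtain ⟨C, B, hC, hB, h⟩ := hf
  obtain ⟨C', B', hC', hB', h'⟩ := hg
  refine ⟨C * C', B * B', by positivity, one_le_mul_of_one_le_of_one_le hB hB', fun x => ?_⟩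
  rw [abs_mul, mul_pow]
  calc _ ≤ (C * B ^ (∑ r, x r)) * (C' * B' ^ (∑ r, x r)) :=
        mul_le_mul (h x) (h' x) (abs_nonneg _) (by positivity)
    _ = _ := by ring

theorem Grow.const (c : ℝ) : Grow (fun _ : Fin d → ℕ => c) :=
  ⟨|c|, 1, abs_nonneg _, le_rfl, by simp⟩

theorem Grow.add {f g : (Fin d → ℕ) → ℝ} (hf : Grow f) (hg : Grow g) :
    Grow (fun x => f x + g x) := by
  obtain ⟨C, B, hC, hB, h⟩ := hf
  obtain ⟨C', B', hC', hB', h'⟩ := hg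
  refine ⟨C + C', max B B', by positivity, le_max_of_le_left hB, fun x => ?_⟩
  calc _ ≤ |f x| + |g x| := abs_add_le _ _
    _ ≤ (C * B ^ (∑ r, x r)) + (C' * B' ^ (∑ r, x r)) := add_le_add (h x) (h' x)
    _ ≤ C * (max B B') ^ (∑ r, x r) + C' * (max B B') ^ (∑ r, x r) := by
        gcongr
        · exact le_max_left _ _
        · exact le_max_right _ _
    _ = _ := by ring

theorem Grow.sub {f g : (Fin d → ℕ) → ℝ} (hf : Grow f) (hg : Grow g) :
    Grow (fun x => f x - g x) := by
  have := hf.add ((Grow.const (d := d) (-1)).mul hg)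
  simpa [sub_eq_add_neg] using this

theorem Grow.abs {f : (Fin d → ℕ) → ℝ} (hf : Grow f) : Grow (fun x => |f x|) := by
  obtain ⟨C, B, hC, hB, h⟩ := hf
  exact ⟨C, B, hC, hB, by simpa using h⟩

theorem Grow.sum {ι : Type*} (s : Finset ι) {f : ι → (Fin d → ℕ) → ℝ} (hf : ∀ i, Grow (f i)) :
    Grow (fun x => ∑ i ∈ s, f i x) := by
  induction s using Finset.induction_on with
  | empty => simpa using Grow.const (d := d) 0
  | insert a s ha ih => simpa [Finset.sum_insert ha] using (hf a).add ih

theorem Grow.coord (r : Fin d) : Grow (fun x : Fin d → ℕ => (x r : ℝ)) := by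
  refine ⟨1, 2, by norm_num, by norm_num, fun x => ?_⟩
  have h1 : x r ≤ ∑ r, x r := Finset.single_le_sum (f := x) (fun _ _ => Nat.zero_le _) (Finset.mem_univ r)
  have h2 : (∑ r, x r) < 2 ^ (∑ r, x r) := Nat.lt_two_pow_self
  rw [abs_of_nonneg (by positivity), one_mul]
  have h3 := h1.trans h2.le
  show (x r : ℝ) ≤ _
  exact_mod_cast h3

theorem Grow.down {f : (Fin d → ℕ) → ℝ} (hf : Grow f) (r : Fin d) :
    Grow (fun x => f (x - Pi.single r 1)) := by
  obtain ⟨C, B, hC, hB, h⟩ := hf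
  refine ⟨C, B, hC, hB, fun x => (h _).trans ?_⟩
  refine mul_le_mul_of_nonneg_left (pow_le_pow_right₀ hB ?_) hC
  refine Finset.sum_le_sum fun s _ => ?_
  simp

theorem Grow.up {f : (Fin d → ℕ) → ℝ} (hf : Grow f) (r : Fin d) :
    Grow (fun x => f (x + Pi.single r 1)) := by
  obtain ⟨C, B, hC, hB, h⟩ := hf
  refine ⟨C * B, B, by positivity, hB, fun x => (h _).trans ?_⟩
  simp [Finset.sum_add_distrib, pow_succ, mul_assoc, mul_comm B]

theorem wt_nonneg (hlam : ∀ r, 0 < lam r) (x : Fin d → ℕ) : 0 ≤ wt lam x :=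
  Finset.prod_nonneg fun r _ => by have := hlam r; positivity

theorem summable_one (c l : ℝ) : Summable fun n : ℕ => ‖c * (l ^ n / (n.factorial:ℝ))‖ :=
  ((Real.summable_pow_div_factorial l).norm.mul_left |c|).congr (by intro n; simp)

theorem Grow.summable {f : (Fin d → ℕ) → ℝ} (hf : Grow f) (hlam : ∀ r, 0 < lam r) :
    Summable fun x => wt lam x * f x := by
  obtain ⟨C, B, hC, hB, h⟩ := hf
  have := (hasSum_pi_prod d (fun r n => Real.exp (-lam r) * ((lam r * B) ^ n / (n.factorial:ℝ)))
    _ (fun r => summable_one _ _) (fun r => (summable_one _ _).of_norm.hasSum)).1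
  refine Summable.of_norm_bounded (this.mul_left C) fun x => ?_
  rw [norm_mul, Real.norm_eq_abs, Real.norm_eq_abs, abs_of_nonneg (wt_nonneg lam hlam x)]
  have e : (∏ r, (Real.exp (-lam r) * ((lam r * B) ^ x r / ((x r).factorial:ℝ))))
      = wt lam x * B ^ (∑ r, x r) := by
    rw [wt, ← Finset.prod_pow_eq_pow_sum, ← Finset.prod_mul_distrib]
    refine Finset.prod_congr rfl fun r _ => ?_
    rw [mul_pow]; ring
  rw [e, Real.norm_eq_abs, abs_of_nonneg (mul_nonneg (wt_nonneg lam hlam x) (by positivity))]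
  calc _ ≤ wt lam x * (C * B ^ (∑ r, x r)) := mul_le_mul_of_nonneg_left (h x) (wt_nonneg lam hlam x)
    _ = _ := by ring

theorem wt_up (hlam : ∀ r, 0 < lam r) (x : Fin d → ℕ) (r : Fin d) :
    wt lam (x + Pi.single r 1) * (((x + Pi.single r 1 : Fin d → ℕ) r : ℝ) / lam r) = wt lam x := by
  have hr := (hlam r).ne'
  have key : ∀ y : Fin d → ℕ, wt lam y =
      (Real.exp (-lam r) * (lam r ^ (y r) / (y r).factorial)) *
      ∏ s ∈ Finset.univ.erase r, (Real.exp (-lam s) * (lam s ^ (y s) / (y s).factorial)) := fun y =>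
    (Finset.mul_prod_erase Finset.univ _ (Finset.mem_univ r)).symm
  rw [key, key x]
  have : ∏ s ∈ Finset.univ.erase r, (Real.exp (-lam s) *
      (lam s ^ ((x + Pi.single r 1 : Fin d → ℕ) s) / ((x + Pi.single r 1 : Fin d → ℕ) s).factorial)) =
      ∏ s ∈ Finset.univ.erase r, (Real.exp (-lam s) * (lam s ^ (x s) / (x s).factorial)) := by
    refine Finset.prod_congr rfl fun s hs => ?_
    simp [Pi.single_eq_of_ne (Finset.ne_of_mem_erase hs)]
  rw [this]
  simp only [Pi.add_apply, Pi.single_eq_same, Nat.factorial_succ, pow_succ]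
  push_cast
  have h1 : ((x r : ℝ) + 1) ≠ 0 := by positivity
  have h2 : ((x r).factorial : ℝ) ≠ 0 := by positivity
  field_simp

/-- creation operator -/
def cr (v : Fin d → ℝ) (q : (Fin d → ℕ) → ℝ) : (Fin d → ℕ) → ℝ :=
  fun x => ∑ r, v r * ((x r : ℝ) / lam r * q (x - Pi.single r 1) - q x)

theorem Grow.cr1 {q : (Fin d → ℕ) → ℝ} (hq : Grow q) (r : Fin d) :
    Grow (fun x => (x r : ℝ) / lam r * q (x - Pi.single r 1) - q x) := by
  have := (((Grow.coord r).mul (Grow.const (lam r)⁻¹)).mul (hq.down r)).sub hq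
  simpa [div_eq_mul_inv] using this

theorem Grow.cr {q : (Fin d → ℕ) → ℝ} (hq : Grow q) (v : Fin d → ℝ) : Grow (cr lam v q) :=
  Grow.sum _ fun r => (Grow.const (v r)).mul (hq.cr1 lam r)

/-- shift reindexing -/
theorem hasSum_shift {A : Type*} [AddCommMonoid A] [TopologicalSpace A] (r : Fin d)
    (F : (Fin d → ℕ) → A) (hF : ∀ x, x r = 0 → F x = 0) (a : A) :
    HasSum (fun x : Fin d → ℕ => F (x + Pi.single r 1)) a ↔ HasSum F a := by
  have hinj : Function.Injective (fun x : Fin d → ℕ => x + Pi.single r 1) :=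
    fun x y h => add_right_cancel h
  refine hinj.hasSum_iff (f := F) ?_
  intro x hx
  apply hF
  by_contra h
  apply hx
  refine ⟨x - Pi.single r 1, ?_⟩
  refine tsub_add_cancel_of_le ?_
  intro s
  by_cases hs : s = r
  · subst hs; simp; omega
  · simp [hs]

/-- adjointness -/
theorem adj (hlam : ∀ r, 0 < lam r) {f g : (Fin d → ℕ) → ℝ} (hf : Grow f) (hg : Grow g)
    (v : Fin d → ℝ) :
    ∑' x, wt lam x * (cr lam v f x * g x) =
      ∑' x, wt lam x * (f x * ∑ r, v r * (g (x + Pi.single r 1) - g x)) := by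
  have h1 : ∀ r, HasSum (fun x => wt lam x * ((x r : ℝ) / lam r * f (x - Pi.single r 1) * g x))
      (∑' x, wt lam x * (f x * g (x + Pi.single r 1))) := by
    intro r
    rw [← hasSum_shift r _ (by intro x hx; simp [hx])]
    have := ((hf.mul (hg.up r)).summable lam hlam).hasSum
    refine this.congr_fun ?_
    intro x
    rw [show (x + Pi.single r 1 - Pi.single r 1 : Fin d → ℕ) = x from add_tsub_cancel_right _ _]
    rw [mul_assoc (_ / _), ← mul_assoc, wt_up lam hlam]
  have h0 := ((hf.mul hg).summable lam hlam).hasSum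
  have h2 : ∀ r, HasSum (fun x => wt lam x * (f x * g (x + Pi.single r 1)))
      (∑' x, wt lam x * (f x * g (x + Pi.single r 1))) := fun r =>
    ((hf.mul (hg.up r)).summable lam hlam).hasSum
  have L := hasSum_sum (s := Finset.univ) fun r _ => ((h1 r).sub h0).mul_left (v r)
  have R := hasSum_sum (s := Finset.univ) fun r _ => ((h2 r).sub h0).mul_left (v r)
  have e1 : ∀ x, wt lam x * (cr lam v f x * g x) = ∑ r, v r *
      (wt lam x * ((x r : ℝ) / lam r * f (x - Pi.single r 1) * g x) - wt lam x * (f x * g x)) := by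
    intro x
    rw [cr, Finset.sum_mul, Finset.mul_sum]
    exact Finset.sum_congr rfl fun r _ => by ring
  have e2 : ∀ x, wt lam x * (f x * ∑ r, v r * (g (x + Pi.single r 1) - g x)) = ∑ r, v r *
      (wt lam x * (f x * g (x + Pi.single r 1)) - wt lam x * (f x * g x)) := by
    intro x
    rw [Finset.mul_sum, Finset.mul_sum]
    exact Finset.sum_congr rfl fun r _ => by ring
  rw [tsum_congr e1, tsum_congr e2, L.tsum_eq, R.tsum_eq]

/-- iterated creation operators on the vacuum -/
def qq : List (Fin d → ℝ) → (Fin d → ℕ) → ℝ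
  | [] => fun _ => 1
  | v :: l => cr lam v (qq l)

theorem qq_grow (l : List (Fin d → ℝ)) : Grow (qq lam l) := by
  induction l with
  | nil => exact Grow.one
  | cons v l ih => exact ih.cr lam v

theorem cr_sum (v : Fin d → ℝ) (s : Finset ℕ) (c : ℕ → ℝ) (f : ℕ → (Fin d → ℕ) → ℝ) (x) :
    cr lam v (fun y => ∑ i ∈ s, c i * f i y) x = ∑ i ∈ s, c i * cr lam v (f i) x := by
  simp only [cr, Finset.mul_sum]
  rw [Finset.sum_comm]
  refine Finset.sum_congr rfl fun r _ => ?_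
  rw [← Finset.sum_sub_distrib, Finset.mul_sum]
  exact Finset.sum_congr rfl fun i _ => by ring

theorem cr_comm (hlam : ∀ r, 0 < lam r) (v : Fin d → ℝ) (q : (Fin d → ℕ) → ℝ) (s : Fin d) (x) :
    cr lam v q (x + Pi.single s 1) - cr lam v q x =
      v s / lam s * q x + cr lam v (fun y => q (y + Pi.single s 1) - q y) x := by
  have h0 : v s / lam s * q x = ∑ r, if r = s then v s / lam s * q x else 0 := by simp
  rw [h0]
  simp only [cr]
  rw [← Finset.sum_sub_distrib, ← Finset.sum_add_distrib]
  refine Finset.sum_congr rfl fun r _ => ?_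
  by_cases h : r = s
  · subst h
    rw [show (x + Pi.single r 1 - Pi.single r 1 : Fin d → ℕ) = x from add_tsub_cancel_right _ _]
    have e : (x r : ℝ) * q (x - Pi.single r 1 + Pi.single r 1) = x r * q x := by
      by_cases hx : x r = 0
      · simp [hx]
      · congr 2
        refine tsub_add_cancel_of_le ?_
        intro s
        by_cases hs : s = r
        · subst hs; simp; omega
        · simp [hs]
    have hr := (hlam r).ne'
    simp only [Pi.add_apply, Pi.single_eq_same, if_true]
    push_cast
    have e2 : (x r : ℝ) / lam r * q (x - Pi.single r 1 + Pi.single r 1) = x r / lam r * q x := by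
      rw [div_mul_eq_mul_div, e, ← div_mul_eq_mul_div]
    rw [mul_sub ((x r : ℝ) / lam r), e2]
    ring
  · have e : (x + Pi.single s 1 - Pi.single r 1 : Fin d → ℕ) = x - Pi.single r 1 + Pi.single s 1 := by
      ext t
      by_cases ht : t = r
      · subst ht; simp [h]
      · simp [ht]
    rw [e]
    simp [h]
    ring

theorem qq_der (hlam : ∀ r, 0 < lam r) (s : Fin d) (l : List (Fin d → ℝ)) (x) :
    qq lam l (x + Pi.single s 1) - qq lam l x =
      ∑ i ∈ Finset.range l.length, (l.getD i 0 s / lam s) * qq lam (l.eraseIdx i) x := by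
  induction l generalizing x with
  | nil => simp [qq]
  | cons v l ih =>
    rw [qq, cr_comm lam hlam, List.length_cons, Finset.sum_range_succ', add_comm]
    congr 1
    · rw [funext ih, cr_sum]
      simp [qq]

/-- ρ² -/
def rho (v : Fin d → ℝ) : ℝ := Real.sqrt (∑ r, v r ^ 2 / lam r)

theorem rho_nonneg (v : Fin d → ℝ) : 0 ≤ rho lam v := Real.sqrt_nonneg _

theorem rho_cs (hlam : ∀ r, 0 < lam r) (v w : Fin d → ℝ) :
    |∑ r, v r * (w r / lam r)| ≤ rho lam v * rho lam w := by
  rw [rho, rho, ← Real.sqrt_mul (Finset.sum_nonneg fun r _ => div_nonneg (sq_nonneg _) (hlam r).le)]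
  refine Real.abs_le_sqrt ?_
  have := Finset.sum_mul_sq_le_sq_mul_sq Finset.univ (fun r => v r / Real.sqrt (lam r))
    (fun r => w r / Real.sqrt (lam r))
  refine le_trans (le_of_eq ?_) (this.trans (le_of_eq ?_))
  · congr 1
    refine Finset.sum_congr rfl fun r _ => ?_
    rw [div_mul_div_comm, Real.mul_self_sqrt (hlam r).le, mul_div_assoc]
  · congr 1 <;>
    · refine Finset.sum_congr rfl fun r _ => ?_
      rw [div_pow, Real.sq_sqrt (hlam r).le]

theorem prod_eraseIdx {α : Type*} (f : α → ℝ) (a : α) (l : List α) (i : ℕ) (hi : i < l.length) :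
    f (l.getD i a) * ((l.eraseIdx i).map f).prod = (l.map f).prod := by
  induction l generalizing i with
  | nil => simp at hi
  | cons v l ih =>
    cases i with
    | zero => simp
    | succ i =>
      have := ih i (by simpa using hi)
      simp only [List.getD_cons_succ, List.eraseIdx_cons_succ, List.map_cons, List.prod_cons]
      rw [← this]; ring

theorem qq_inner (hlam : ∀ r, 0 < lam r) (l m : List (Fin d → ℝ)) (h : l.length = m.length) :
    |∑' x, wt lam x * (qq lam l x * qq lam m x)| ≤
      (l.length.factorial : ℝ) * ((l.map (rho lam)).prod * (m.map (rho lam)).prod) *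
        ∑' x, wt lam x := by
  have hW : 0 ≤ ∑' x, wt lam x := tsum_nonneg (wt_nonneg lam hlam)
  have hpr : ∀ l : List (Fin d → ℝ), 0 ≤ (l.map (rho lam)).prod := fun l =>
    List.prod_nonneg (by simp only [List.mem_map]; rintro a ⟨v, _, rfl⟩; exact rho_nonneg lam v)
  induction l generalizing m with
  | nil =>
    have : m = [] := List.length_eq_zero_iff.1 h.symm
    subst this
    simp [qq, abs_of_nonneg hW]
  | cons v l ih =>
    rw [qq, adj lam hlam (qq_grow lam l) (qq_grow lam m)]
    have e : ∀ x, wt lam x * (qq lam l x * ∑ r, v r * (qq lam m (x + Pi.single r 1) - qq lam m x)) =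
        ∑ i ∈ Finset.range m.length, (∑ r, v r * (m.getD i 0 r / lam r)) *
          (wt lam x * (qq lam l x * qq lam (m.eraseIdx i) x)) := by
      intro x
      simp only [qq_der lam hlam, Finset.mul_sum, Finset.sum_mul]
      rw [Finset.sum_comm]
      exact Finset.sum_congr rfl fun i _ => Finset.sum_congr rfl fun r _ => by ring
    rw [tsum_congr e, Summable.tsum_finsetSum]
    swap
    · intro i _
      exact (((qq_grow lam l).mul (qq_grow lam _)).summable lam hlam).mul_left _
    refine (Finset.abs_sum_le_sum_abs _ _).trans ?_
    have hb : ∀ i ∈ Finset.range m.length, |∑' x, (∑ r, v r * (m.getD i 0 r / lam r)) *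
          (wt lam x * (qq lam l x * qq lam (m.eraseIdx i) x))| ≤
        (l.length.factorial : ℝ) * (((v :: l).map (rho lam)).prod * (m.map (rho lam)).prod) *
        ∑' x, wt lam x := by
      intro i hi
      rw [Finset.mem_range] at hi
      rw [tsum_mul_left, abs_mul, ← prod_eraseIdx (rho lam) 0 m i hi]
      have h1 := ih (m.eraseIdx i) (by rw [List.length_eraseIdx_of_lt hi, ← h]; simp)
      have h2 := rho_cs lam hlam v (m.getD i 0)
      refine (mul_le_mul h2 h1 (abs_nonneg _) (mul_nonneg (rho_nonneg _ _) (rho_nonneg _ _))).trans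
        (le_of_eq ?_)
      simp only [List.map_cons, List.prod_cons]
      ring
    refine (Finset.sum_le_sum hb).trans (le_of_eq ?_)
    rw [Finset.sum_const, Finset.card_range, ← h, nsmul_eq_mul, List.length_cons,
      Nat.factorial_succ]
    push_cast; ring

theorem wt_hasSum : HasSum (wt lam) 1 := by
  have := (hasSum_pi_prod d (fun r n => Real.exp (-lam r) * (lam r ^ n / (n.factorial:ℝ)))
    (fun _ => 1) (fun r => summable_one _ _) (fun r => by
      have := (NormedSpace.expSeries_div_hasSum_exp (lam r)).mul_left (Real.exp (-lam r))
      rwa [← Real.exp_eq_exp_ℝ, ← Real.exp_add, neg_add_cancel, Real.exp_zero] at this)).2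
  rw [Finset.prod_const_one] at this
  exact this

theorem qq_l1 (hlam : ∀ r, 0 < lam r) (l : List (Fin d → ℝ)) :
    ∑' x, wt lam x * |qq lam l x| ≤ Real.sqrt (l.length.factorial) * (l.map (rho lam)).prod := by
  have hpr : 0 ≤ (l.map (rho lam)).prod :=
    List.prod_nonneg (by simp only [List.mem_map]; rintro a ⟨v, _, rfl⟩; exact rho_nonneg lam v)
  have hg := qq_grow lam l
  set c := ∑' x, wt lam x * |qq lam l x| with hc
  have h2 := qq_inner lam hlam l l rfl
  rw [(wt_hasSum lam).tsum_eq, mul_one] at h2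
  have s1 := (hg.abs.summable lam hlam).hasSum
  have s2 := ((hg.mul hg).summable lam hlam).hasSum
  have s3 := (s2.sub (s1.mul_left (2 * c))).add ((wt_hasSum lam).mul_left (c ^ 2))
  have h3 := s3.nonneg (fun x => by
    have : wt lam x * (qq lam l x * qq lam l x) - 2 * c * (wt lam x * |qq lam l x|) + c ^ 2 * wt lam x
      = wt lam x * (|qq lam l x| - c) ^ 2 := by
      rw [sub_sq, sq_abs]; ring
    rw [this]
    exact mul_nonneg (wt_nonneg lam hlam x) (sq_nonneg _))
  have h4 : c ^ 2 ≤ (l.length.factorial : ℝ) * ((l.map (rho lam)).prod * (l.map (rho lam)).prod) := by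
    have := le_abs_self (∑' x, wt lam x * (qq lam l x * qq lam l x))
    rw [← hc] at h3
    nlinarith
  rw [← Real.sqrt_mul_self hpr, ← Real.sqrt_mul (by positivity)]
  exact Real.le_sqrt_of_sq_le h4

variable {A : Type*} [NormedCommRing A] [NormedAlgebra ℝ A] [CompleteSpace A] [NormOneClass A]

/-- monomials -/
def mono (u : Fin d → A) (x : Fin d → ℕ) : A := ∏ r, u r ^ x r

theorem mono_norm (u : Fin d → A) (hu : ∀ r, ‖u r‖ ≤ 1) (x : Fin d → ℕ) : ‖mono u x‖ ≤ 1 := by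
  refine (Finset.norm_prod_le _ _).trans ?_
  refine Finset.prod_le_one (fun _ _ => norm_nonneg _) fun r _ => ?_
  exact (norm_pow_le _ _).trans (pow_le_one₀ (norm_nonneg _) (hu r))

theorem mono_up (u : Fin d → A) (x : Fin d → ℕ) (r : Fin d) :
    mono u (x + Pi.single r 1) = u r * mono u x := by
  have : ∀ s, u s ^ ((x + Pi.single r 1 : Fin d → ℕ) s) = (if s = r then u r else 1) * u s ^ x s := by
    intro s
    by_cases h : s = r
    · subst h; simp [pow_succ, mul_comm]
    · simp [h]
  simp only [mono, this, Finset.prod_mul_distrib]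
  simp

theorem exp_hasSum (u : Fin d → A) :
    HasSum (fun x => wt lam x • mono u x) (NormedSpace.exp (∑ r, lam r • (u r - 1))) := by
  letI : NormedAlgebra ℚ A := NormedAlgebra.restrictScalars ℚ ℝ A
  have hs : ∀ r, HasSum (fun n : ℕ => (Real.exp (-lam r) * (lam r ^ n / (n.factorial:ℝ))) • u r ^ n)
      (NormedSpace.exp (lam r • (u r - 1))) := by
    intro r
    have h1 := (NormedSpace.exp_series_hasSum_exp' (𝕂 := ℝ) (lam r • u r)).const_smul
      (Real.exp (-lam r))
    have h2 : NormedSpace.exp (lam r • (u r - 1)) =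
        Real.exp (-lam r) • NormedSpace.exp (lam r • u r) := by
      have : lam r • (u r - 1) = algebraMap ℝ A (-lam r) + lam r • u r := by
        rw [smul_sub, Algebra.algebraMap_eq_smul_one, neg_smul]; abel
      rw [this, NormedSpace.exp_add, ← NormedSpace.algebraMap_exp_comm, Real.exp_eq_exp_ℝ]
      exact (Algebra.smul_def _ _).symm
    rw [h2]
    refine h1.congr_fun fun n => ?_
    rw [smul_pow, smul_smul, smul_smul]
    congr 1; ring
  rw [NormedSpace.exp_sum]
  have := (hasSum_pi_prod d _ _ (fun r => ?_) hs).2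
  · refine this.congr_fun fun x => ?_
    rw [wt, mono, Finset.prod_smul]
  · refine (((NormedSpace.norm_expSeries_summable' (𝕂 := ℝ) (lam r • u r)).mul_left
      (Real.exp (-lam r)))).congr fun n => ?_
    rw [smul_pow, smul_smul, ← Real.norm_of_nonneg (Real.exp_pos (-lam r)).le, ← norm_smul,
      smul_smul, Real.norm_of_nonneg (Real.exp_pos (-lam r)).le]
    congr 2; ring

/-- the linear form -/
def lin (u : Fin d → A) (v : Fin d → ℝ) : A := ∑ r, v r • (u r - 1)

theorem qq_hasSum (hlam : ∀ r, 0 < lam r) (u : Fin d → A) (l : List (Fin d → ℝ)) :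
    HasSum (fun x => (wt lam x * qq lam l x) • mono u x)
      ((l.map (lin u)).prod * NormedSpace.exp (∑ r, lam r • (u r - 1))) := by
  induction l with
  | nil => simpa [qq] using exp_hasSum lam u
  | cons v l ih =>
    set Y := (l.map (lin u)).prod * NormedSpace.exp (∑ r, lam r • (u r - 1)) with hY
    have h1 : ∀ r, HasSum (fun x => (wt lam x * ((x r : ℝ) / lam r * qq lam l (x - Pi.single r 1))) •
        mono u x) (u r * Y) := by
      intro r
      rw [← hasSum_shift r _ (by intro x hx; simp [hx])]
      refine (ih.mul_left (u r)).congr_fun fun x => ?_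
      rw [show (x + Pi.single r 1 - Pi.single r 1 : Fin d → ℕ) = x from add_tsub_cancel_right _ _,
        ← mul_assoc, wt_up lam hlam, mono_up, mul_smul_comm]
    have L := hasSum_sum (s := Finset.univ) fun r _ => ((h1 r).sub ih).const_smul (v r)
    have e : ((v :: l).map (lin u)).prod * NormedSpace.exp (∑ r, lam r • (u r - 1)) =
        ∑ r, v r • (u r * Y - Y) := by
      rw [List.map_cons, List.prod_cons, mul_assoc, ← hY, lin, Finset.sum_mul]
      refine Finset.sum_congr rfl fun r _ => ?_
      rw [smul_mul_assoc, sub_mul, one_mul]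
    rw [e]
    refine L.congr_fun fun x => ?_
    rw [qq, cr, Finset.mul_sum, Finset.sum_smul]
    refine Finset.sum_congr rfl fun r _ => ?_
    rw [← sub_smul, smul_smul]
    congr 1; ring

theorem core (hlam : ∀ r, 0 < lam r) (u : Fin d → A) (hu : ∀ r, ‖u r‖ ≤ 1)
    (l : List (Fin d → ℝ)) :
    ‖(l.map (lin u)).prod * NormedSpace.exp (∑ r, lam r • (u r - 1))‖ ≤
      Real.sqrt (l.length.factorial) * (l.map (rho lam)).prod := by
  refine le_trans ?_ (qq_l1 lam hlam l)
  rw [← (qq_hasSum lam hlam u l).tsum_eq]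
  refine tsum_of_norm_bounded ((qq_grow lam l).abs.summable lam hlam).hasSum fun x => ?_
  rw [norm_smul, norm_mul, Real.norm_of_nonneg (wt_nonneg lam hlam x), Real.norm_eq_abs]
  exact mul_le_of_le_one_right (mul_nonneg (wt_nonneg lam hlam x) (abs_nonneg _)) (mono_norm u hu x)

end core

end SmoothAux
namespace SmoothAux

section combo

/-- coefficients of the expanded bound -/
def FF : List (ℝ × ℝ × ℝ) → ℕ → ℝ
  | [] => fun n => Real.sqrt (n.factorial)
  | c :: l => fun n => c.1 * FF l n + c.2.1 * FF l (n + 1) + c.2.2 * FF l (n + 2)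

def Pos3 (c : ℝ × ℝ × ℝ) : Prop := 0 ≤ c.1 ∧ 0 ≤ c.2.1 ∧ 0 ≤ c.2.2

theorem FF_nonneg (l : List (ℝ × ℝ × ℝ)) (h : ∀ c ∈ l, Pos3 c) (n : ℕ) : 0 ≤ FF l n := by
  induction l generalizing n with
  | nil => exact Real.sqrt_nonneg _
  | cons c l ih =>
    have hc := h c (by simp)
    have ih' := ih (fun c hc => h c (by simp [hc]))
    have h1 := mul_nonneg hc.1 (ih' n)
    have h2 := mul_nonneg hc.2.1 (ih' (n+1))
    have h3 := mul_nonneg hc.2.2 (ih' (n+2))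
    simp only [FF]; linarith

theorem FF_log (l : List (ℝ × ℝ × ℝ)) (h : ∀ c ∈ l, Pos3 c) (θ : ℝ) (hθ : 0 < θ) (n : ℕ) :
    FF l (n + 1) ≤ θ / 2 * FF l n + 1 / (2 * θ) * FF l (n + 2) := by
  induction l generalizing n with
  | nil =>
    simp only [FF]
    set a := Real.sqrt (n.factorial : ℝ) with ha
    have ha0 : 0 ≤ a := Real.sqrt_nonneg _
    have e1 : Real.sqrt ((n+1).factorial : ℝ) = Real.sqrt (n+1) * a := by
      rw [Nat.factorial_succ]; push_cast; rw [Real.sqrt_mul (by positivity)]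
    have e2 : Real.sqrt ((n+2).factorial : ℝ) = Real.sqrt (n+2) * (Real.sqrt (n+1) * a) := by
      rw [Nat.factorial_succ, Nat.cast_mul, Real.sqrt_mul (by positivity), e1]; push_cast
      congr 2; ring
    rw [e1, e2]
    set x := Real.sqrt ((n:ℝ)+1)
    set y := Real.sqrt ((n:ℝ)+2)
    have hxy : x ≤ y := Real.sqrt_le_sqrt (by linarith)
    have hx : 0 ≤ x := Real.sqrt_nonneg _
    have : θ / 2 * a + 1 / (2 * θ) * (y * (x * a)) - x * a =
        a / (2 * θ) * ((θ - x) ^ 2 + x * (y - x)) := by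
      field_simp; ring
    have h2 : 0 ≤ a / (2 * θ) * ((θ - x) ^ 2 + x * (y - x)) := by
      have := mul_nonneg hx (sub_nonneg.2 hxy)
      positivity
    linarith
  | cons c l ih =>
    have hc := h c (by simp)
    have ih' := ih (fun c hc => h c (by simp [hc]))
    have h1 := mul_le_mul_of_nonneg_left (ih' n) hc.1
    have h2 := mul_le_mul_of_nonneg_left (ih' (n+1)) hc.2.1
    have h3 := mul_le_mul_of_nonneg_left (ih' (n+2)) hc.2.2
    simp only [FF]
    simp only [add_assoc, Nat.reduceAdd] at *
    nlinarith

variable {ι : Type*}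

/-- vertex coefficients -/
def EE (M : ℕ → ℝ) (V : ι → ℝ × ℝ) : List ι → ℕ → ℝ
  | [] => M
  | i :: l => fun n => (V i).1 * EE M V l n + (V i).2 * EE M V l (n + 2)

/-- `sqrt n!` -/
def sq (n : ℕ) : ℝ := Real.sqrt (n.factorial)

def sh (a b : ℝ) : (ℕ → ℝ) →ₗ[ℝ] (ℕ → ℝ) where
  toFun f := fun n => a * f n + b * f (n + 2)
  map_add' f g := by ext n; simp; ring
  map_smul' c f := by ext n; simp; ring

def Hull [Fintype ι] (V : ι → ℝ × ℝ) (c : ℝ × ℝ × ℝ) (T : ℝ) : Prop :=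
  Pos3 c ∧ ∃ θ : ℝ, 0 < θ ∧ ∃ w : ι → ℝ, (∀ i, 0 ≤ w i) ∧ ∑ i, w i = T ∧
    c.1 + θ / 2 * c.2.1 ≤ ∑ i, w i * (V i).1 ∧ c.2.2 + 1 / (2 * θ) * c.2.1 ≤ ∑ i, w i * (V i).2

theorem hull_bound [Fintype ι] (V : ι → ℝ × ℝ) (hV : ∀ i, 0 ≤ (V i).1 ∧ 0 ≤ (V i).2) (C : ℝ)
    (cs : List (ℝ × ℝ × ℝ)) (Ts : List ℝ) (h : List.Forall₂ (Hull V) cs Ts) :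
    ∀ (K : (ℕ → ℝ) →ₗ[ℝ] ℝ) (_ : ∀ f g, f ≤ g → K f ≤ K g)
    (_ : ∀ l : List ι, l.length = cs.length → K (EE sq V l) ≤ C), K (FF cs) ≤ C * Ts.prod := by
  induction h with
  | nil =>
    intro K hK hl
    simp only [List.prod_nil, mul_one]
    exact hl [] rfl
  | @cons c T cs Ts hc hcs ih =>
    intro K hK hl
    obtain ⟨hp, θ, hθ, w, hw, hT, h1, h2⟩ := hc
    have hpos : ∀ c ∈ cs, Pos3 c := by
      intro c hc
      obtain ⟨i, hi, rfl⟩ := List.getElem_of_mem hc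
      rw [List.forall₂_iff_get] at hcs
      exact (hcs.2 i hi (hcs.1 ▸ hi)).1
    have step : FF (c :: cs) ≤ ∑ i, w i • sh (V i).1 (V i).2 (FF cs) := by
      intro n
      have e : (∑ i, w i • sh (V i).1 (V i).2 (FF cs)) n =
          (∑ i, w i * (V i).1) * FF cs n + (∑ i, w i * (V i).2) * FF cs (n + 2) := by
        simp only [Finset.sum_apply, Pi.smul_apply, smul_eq_mul, sh, LinearMap.coe_mk, AddHom.coe_mk,
          Finset.sum_mul, ← Finset.sum_add_distrib]
        exact Finset.sum_congr rfl fun i _ => by ring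
      rw [e]
      have a1 := mul_le_mul_of_nonneg_right h1 (FF_nonneg cs hpos n)
      have a2 := mul_le_mul_of_nonneg_right h2 (FF_nonneg cs hpos (n+2))
      have a3 := mul_le_mul_of_nonneg_left (FF_log cs hpos θ hθ n) hp.2.1
      simp only [FF]
      nlinarith
    refine (hK _ _ step).trans ?_
    rw [map_sum, List.prod_cons, ← hT]
    have : C * ((∑ i, w i) * Ts.prod) = ∑ i, w i * (C * Ts.prod) := by
      rw [← Finset.sum_mul]; ring
    rw [this]
    refine Finset.sum_le_sum fun i _ => ?_
    rw [map_smul, smul_eq_mul]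
    refine mul_le_mul_of_nonneg_left ?_ (hw i)
    refine ih (K.comp (sh (V i).1 (V i).2)) ?_ ?_
    · intro f g hfg
      apply hK
      intro n
      have b1 := mul_le_mul_of_nonneg_left (hfg n) (hV i).1
      have b2 := mul_le_mul_of_nonneg_left (hfg (n+2)) (hV i).2
      simp only [sh, LinearMap.coe_mk, AddHom.coe_mk]
      linarith
    · intro l hlen
      exact hl (i :: l) (by simp [hlen])

theorem hull_bound0 [Fintype ι] (V : ι → ℝ × ℝ) (hV : ∀ i, 0 ≤ (V i).1 ∧ 0 ≤ (V i).2) (C : ℝ)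
    (cs : List (ℝ × ℝ × ℝ)) (Ts : List ℝ) (h : List.Forall₂ (Hull V) cs Ts)
    (hl : ∀ l : List ι, l.length = cs.length → EE sq V l 0 ≤ C) : FF cs 0 ≤ C * Ts.prod :=
  hull_bound V hV C cs Ts h (LinearMap.proj 0) (fun _ _ h => h 0) hl

theorem EE_perm (M : ℕ → ℝ) (V : ι → ℝ × ℝ) {l l' : List ι} (h : l.Perm l') :
    EE M V l = EE M V l' := by
  induction h with
  | nil => rfl
  | cons x _ ih => simp only [EE, ih]
  | swap x y l => funext n; simp only [EE]; ring
  | trans _ _ h1 h2 => exact h1.trans h2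

theorem EE_bool (M : ℕ → ℝ) (V : Bool → ℝ × ℝ) (l : List Bool) :
    ∃ a, a ≤ l.length ∧ EE M V l = EE M V (List.replicate a true ++ List.replicate (l.length - a) false) := by
  refine ⟨l.count true, List.count_le_length, EE_perm M V ?_⟩
  rw [List.perm_replicate_append_replicate (by decide)]
  refine ⟨rfl, ?_, ?_⟩
  · have := List.count_false_add_count_true l
    omega
  · intro b _; cases b <;> simp

/-- rational version -/
def EQ (M : ℕ → ℚ) (V : ι → ℚ × ℚ) : List ι → ℕ → ℚ
  | [] => M
  | i :: l => fun n => (V i).1 * EQ M V l n + (V i).2 * EQ M V l (n + 2)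

def castV (V : ι → ℚ × ℚ) : ι → ℝ × ℝ := fun i => (((V i).1 : ℝ), ((V i).2 : ℝ))

theorem EE_le_EQ (M : ℕ → ℝ) (M' : ℕ → ℚ) (hM : ∀ n, M n ≤ M' n) (V : ι → ℚ × ℚ)
    (hV : ∀ i, 0 ≤ (V i).1 ∧ 0 ≤ (V i).2) (l : List ι) (n : ℕ) :
    EE M (castV V) l n ≤ (EQ M' V l n : ℝ) := by
  induction l generalizing n with
  | nil => exact hM n
  | cons i l ih =>
    have h1 : (0:ℝ) ≤ (V i).1 := by exact_mod_cast (hV i).1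
    have h2 : (0:ℝ) ≤ (V i).2 := by exact_mod_cast (hV i).2
    have b1 := mul_le_mul_of_nonneg_left (ih n) h1
    have b2 := mul_le_mul_of_nonneg_left (ih (n+2)) h2
    simp only [EE, EQ, castV]
    push_cast
    linarith

/-- rational upper bounds for `sqrt n!` -/
def MQ : ℕ → ℚ
  | 2 => 14143/10000
  | 4 => 48990/10000
  | 6 => 268329/10000
  | 8 => 2007985/10000
  | 10 => 1904942/1000
  | 12 => 21886106/1000
  | 14 => 295259702/1000
  | 16 => 4574144/1
  | 18 => 80014835/1
  | n => n.factorial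

theorem sq_le_MQ (n : ℕ) : sq n ≤ MQ n := by
  unfold MQ
  split <;> unfold sq
  iterate 9 exact Real.sqrt_le_iff.2 ⟨by norm_num, by norm_num [Nat.factorial]⟩
  refine Real.sqrt_le_iff.2 ⟨by positivity, ?_⟩
  push_cast
  have : (1:ℝ) ≤ (n.factorial : ℝ) := by exact_mod_cast Nat.one_le_iff_ne_zero.2 (Nat.factorial_ne_zero n)
  nlinarith

/-- middle range vertices -/
def VB (P0 P1 Q0 : ℚ) : Bool → ℚ × ℚ
  | true => (P0, P1)
  | false => (Q0, 1)

def VT (O0 P0 P1 Q0 : ℚ) : Fin 3 → ℚ × ℚ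
  | 0 => (O0, 0)
  | 1 => (P0, P1)
  | 2 => (Q0, 1)

theorem mid_num (b s P T t L q0 P0 P1 Q0 : ℝ) (hb : 0 ≤ b) (hs : 0 ≤ s) (hP : 0 ≤ P)
    (hT : T = b * P + s ^ 2) (ht : 0 < t) (hTt : T ≤ t * P ^ 2) (hL : 1 ≤ L)
    (hP0 : 4 * t * (1 + (L - 1) * q0 ^ 2) ≤ P0) (hP1 : 1 / L ≤ P1)
    (hQ0 : 4 * t * ((L - 1) * (1 - q0) ^ 2) ≤ Q0) (hbP : b ≤ P) :
    ∃ θ : ℝ, 0 < θ ∧ 4 * b ^ 2 + θ / 2 * (4 * b * s) ≤ b * P * P0 + s ^ 2 * Q0 ∧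
      s ^ 2 + 1 / (2 * θ) * (4 * b * s) ≤ b * P * P1 + s ^ 2 := by
  have hL0 : 0 < L := by linarith
  have hL1 : 0 ≤ L - 1 := by linarith
  have hP1' : 0 ≤ P1 := le_trans (by positivity) hP1
  have hP04 : 4 * t ≤ P0 := by
    have : 0 ≤ 4 * t * ((L - 1) * q0 ^ 2) := by positivity
    linarith
  have hQ00 : 0 ≤ Q0 := le_trans (by positivity) hQ0
  rcases hP.eq_or_lt with hP' | hP'
  · subst hP'
    have hb0 : b = 0 := le_antisymm hbP hb
    have hs0 : s = 0 := by
      have : s ^ 2 ≤ 0 := by rw [hT] at hTt; simpa [hb0] using hTt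
      exact pow_eq_zero_iff (two_ne_zero) |>.1 (le_antisymm this (sq_nonneg _))
    exact ⟨1, one_pos, by simp [hb0, hs0], by simp [hb0, hs0]⟩
  have hbt : b ≤ t * P := by
    have : b * P ≤ t * P * P := by nlinarith [sq_nonneg s]
    exact le_of_mul_le_mul_right this hP'
  rcases hs.eq_or_lt with hs' | hs'
  · subst hs'
    refine ⟨1, one_pos, ?_, ?_⟩
    · have : b * b ≤ b * (t * P) := mul_le_mul_of_nonneg_left hbt hb
      have h2 : b * P * (4 * t) ≤ b * P * P0 := mul_le_mul_of_nonneg_left hP04 (by positivity)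
      nlinarith
    · have : 0 ≤ b * P * P1 := by positivity
      simpa using this
  · refine ⟨2 * L * s / P, by positivity, ?_, ?_⟩
    · set B := b * P with hB
      set S := s ^ 2 with hS
      have hB0 : 0 ≤ B := by positivity
      have hS0 : 0 ≤ S := by positivity
      have e : 4 * b ^ 2 + 2 * L * s / P / 2 * (4 * b * s) = 4 * B * (B + L * S) / P ^ 2 := by
        rw [hB, hS]; field_simp
      rw [e, div_le_iff₀ (by positivity)]
      have k1 : t * (4 * B * (B + L * S)) ≤ (B + S) * (B * P0 + S * Q0) := by
        have i1 : B * (4 * t * (1 + (L - 1) * q0 ^ 2)) + S * (4 * t * ((L - 1) * (1 - q0) ^ 2)) ≤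
          B * P0 + S * Q0 := add_le_add (mul_le_mul_of_nonneg_left hP0 hB0)
            (mul_le_mul_of_nonneg_left hQ0 hS0)
        have i2 := mul_le_mul_of_nonneg_left i1 (add_nonneg hB0 hS0)
        have i3 : 0 ≤ 4 * t * (L - 1) * (q0 * B - (1 - q0) * S) ^ 2 := by positivity
        nlinarith
      have k2 : (B + S) * (B * P0 + S * Q0) ≤ t * P ^ 2 * (B * P0 + S * Q0) := by
        refine mul_le_mul_of_nonneg_right (by linarith) ?_
        have : 0 ≤ P0 := by linarith
        positivity
      have k3 : t * (4 * B * (B + L * S)) ≤ t * ((B * P0 + S * Q0) * P ^ 2) := by linarith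
      exact le_of_mul_le_mul_left k3 ht
    · have e : 1 / (2 * (2 * L * s / P)) * (4 * b * s) = b * P * (1 / L) := by
        field_simp
        ring
      rw [e]
      have := mul_le_mul_of_nonneg_left hP1 (mul_nonneg hb hP)
      linarith

end combo

end SmoothAux
namespace SmoothAux

section expand

variable {d : ℕ} (lam : Fin d → ℝ)
variable {A : Type*} [NormedCommRing A] [NormedAlgebra ℝ A] [CompleteSpace A] [NormOneClass A]

/-- a quadratic decomposition of `y` with coefficient bounds `c` -/
def Dec (u : Fin d → A) (y : A) (c : ℝ × ℝ × ℝ) : Prop :=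
  ∃ (Z0 Z1 : A) (v : Fin d → ℝ), y = Z0 + Z1 * lin u v + lin u v * lin u v ∧
    ‖Z0‖ ≤ c.1 ∧ ‖Z1‖ * rho lam v ≤ c.2.1 ∧ rho lam v ^ 2 ≤ c.2.2

theorem Dec.pos {u : Fin d → A} {y : A} {c : ℝ × ℝ × ℝ} (h : Dec lam u y c) : Pos3 c := by
  obtain ⟨Z0, Z1, v, -, h0, h1, h2⟩ := h
  exact ⟨(norm_nonneg _).trans h0, (mul_nonneg (norm_nonneg _) (rho_nonneg lam v)).trans h1,
    (sq_nonneg _).trans h2⟩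

theorem expand (hlam : ∀ r, 0 < lam r) (u : Fin d → A) (hu : ∀ r, ‖u r‖ ≤ 1)
    (ys : List A) (cs : List (ℝ × ℝ × ℝ)) (h : List.Forall₂ (Dec lam u) ys cs) :
    ∀ (Z : A) (l : List (Fin d → ℝ)),
      ‖Z * ys.prod * (l.map (lin u)).prod * NormedSpace.exp (∑ r, lam r • (u r - 1))‖ ≤
        ‖Z‖ * FF cs l.length * (l.map (rho lam)).prod := by
  set G := NormedSpace.exp (∑ r, lam r • (u r - 1)) with hG
  induction h with
  | nil =>
    intro Z l
    have := core lam hlam u hu l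
    simp only [List.prod_nil, mul_one, FF]
    rw [mul_assoc, mul_assoc]
    exact (norm_mul_le _ _).trans (mul_le_mul_of_nonneg_left this (norm_nonneg _))
  | @cons y c ys cs hc hcs ih =>
    intro Z l
    have hpos : ∀ c ∈ cs, Pos3 c := by
      intro c hc
      obtain ⟨i, hi, rfl⟩ := List.getElem_of_mem hc
      rw [List.forall₂_iff_get] at hcs
      exact (hcs.2 i (hcs.1 ▸ hi) hi).pos
    obtain ⟨Z0, Z1, v, hy, h0, h1, h2⟩ := hc
    have e : Z * (y :: ys).prod * (l.map (lin u)).prod * G =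
        (Z * Z0) * ys.prod * (l.map (lin u)).prod * G +
        (Z * Z1) * ys.prod * ((v :: l).map (lin u)).prod * G +
        Z * ys.prod * ((v :: v :: l).map (lin u)).prod * G := by
      simp only [List.prod_cons, List.map_cons, hy]; ring
    rw [e]
    have i0 := ih (Z * Z0) l
    have i1 := ih (Z * Z1) (v :: l)
    have i2 := ih Z (v :: v :: l)
    simp only [List.length_cons, List.map_cons, List.prod_cons] at i1 i2 ⊢
    refine (norm_add₃_le).trans ((add_le_add (add_le_add i0 i1) i2).trans ?_)
    set q := (l.map (rho lam)).prod with hq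
    have hq0 : 0 ≤ q := List.prod_nonneg (by
      intro x hx
      obtain ⟨w, -, rfl⟩ := List.mem_map.1 hx
      exact rho_nonneg lam w)
    have F0 := FF_nonneg cs hpos l.length
    have F1 := FF_nonneg cs hpos (l.length + 1)
    have F2 := FF_nonneg cs hpos (l.length + 2)
    have hr := rho_nonneg lam v
    have hZ := norm_nonneg Z
    have j0 : ‖Z * Z0‖ * FF cs l.length * q ≤ ‖Z‖ * c.1 * FF cs l.length * q := by
      have := (norm_mul_le Z Z0).trans (mul_le_mul_of_nonneg_left h0 hZ)
      gcongr
    have j1 : ‖Z * Z1‖ * FF cs (l.length + 1) * (rho lam v * q) ≤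
        ‖Z‖ * c.2.1 * FF cs (l.length + 1) * q := by
      have : ‖Z * Z1‖ * rho lam v ≤ ‖Z‖ * c.2.1 := by
        calc ‖Z * Z1‖ * rho lam v ≤ ‖Z‖ * ‖Z1‖ * rho lam v := by gcongr; exact norm_mul_le _ _
          _ = ‖Z‖ * (‖Z1‖ * rho lam v) := by ring
          _ ≤ _ := by gcongr
      calc _ = (‖Z * Z1‖ * rho lam v) * FF cs (l.length + 1) * q := by ring
        _ ≤ _ := by gcongr
    have j2 : ‖Z‖ * FF cs (l.length + 1 + 1) * (rho lam v * (rho lam v * q)) ≤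
        ‖Z‖ * c.2.2 * FF cs (l.length + 2) * q := by
      calc _ = ‖Z‖ * rho lam v ^ 2 * FF cs (l.length + 2) * q := by ring_nf
        _ ≤ _ := by gcongr
    refine (add_le_add (add_le_add j0 j1) j2).trans (le_of_eq ?_)
    simp only [FF]; ring

theorem lin_norm (u : Fin d → A) (hu : ∀ r, ‖u r‖ ≤ 1) (v : Fin d → ℝ) :
    ‖lin u v‖ ≤ 2 * ∑ r, |v r| := by
  unfold lin
  refine (norm_sum_le _ _).trans ?_
  rw [Finset.mul_sum]
  refine Finset.sum_le_sum fun r _ => ?_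
  rw [norm_smul, Real.norm_eq_abs, mul_comm]
  refine mul_le_mul_of_nonneg_right ?_ (abs_nonneg _)
  have := norm_sub_le (u r) 1
  rw [norm_one] at this
  linarith [hu r]

/-- the factor on the right hand side -/
def TT (p : Fin d → ℝ) : ℝ := ∑ r, |p r| * min (|p r| / lam r) (∑ r, |p r|)

theorem decs (hlam : ∀ r, 0 < lam r) (u : Fin d → A) (hu : ∀ r, ‖u r‖ ≤ 1) (p : Fin d → ℝ) :
    ∃ b s P : ℝ, 0 ≤ b ∧ 0 ≤ s ∧ b ≤ P ∧ TT lam p = b * P + s ^ 2 ∧ TT lam p ≤ P ^ 2 ∧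
      Dec lam u (lin u p * lin u p) (4 * b ^ 2, 4 * b * s, s ^ 2) ∧
      Dec lam u (lin u p * lin u p) (4 * P ^ 2, 0, 0) ∧
      Dec lam u (lin u p * lin u p) (8 * b * P, 0, s ^ 2) := by
  set P := ∑ r, |p r| with hP
  have hP0 : 0 ≤ P := Finset.sum_nonneg fun _ _ => abs_nonneg _
  set vS : Fin d → ℝ := fun r => if |p r| ≤ lam r * P then p r else 0 with hvS
  set vB : Fin d → ℝ := fun r => if |p r| ≤ lam r * P then 0 else p r with hvB
  have hab : ∑ r, |vS r| + ∑ r, |vB r| = P := by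
    rw [← Finset.sum_add_distrib]
    refine Finset.sum_congr rfl fun r _ => ?_
    simp only [hvS, hvB]; split_ifs <;> simp
  have hb : 0 ≤ ∑ r, |vB r| := Finset.sum_nonneg fun _ _ => abs_nonneg _
  have ha : 0 ≤ ∑ r, |vS r| := Finset.sum_nonneg fun _ _ => abs_nonneg _
  have hlin : lin u p = lin u vB + lin u vS := by
    unfold lin
    rw [← Finset.sum_add_distrib]
    refine Finset.sum_congr rfl fun r _ => ?_
    simp only [hvS, hvB]; split_ifs <;> simp
  have hs2 : rho lam vS ^ 2 = ∑ r, vS r ^ 2 / lam r :=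
    Real.sq_sqrt (Finset.sum_nonneg fun r _ => div_nonneg (sq_nonneg _) (hlam r).le)
  have nB := lin_norm u hu vB
  have nS := lin_norm u hu vS
  have nP := lin_norm u hu p
  have nB0 := norm_nonneg (lin u vB)
  have nP0 := norm_nonneg (lin u p)
  have l0 : lin u (0 : Fin d → ℝ) = 0 := by simp [lin]
  have r0 : rho lam (0 : Fin d → ℝ) = 0 := by simp [rho]
  refine ⟨∑ r, |vB r|, rho lam vS, P, hb, rho_nonneg _ _, by linarith, ?_, ?_, ?_, ?_, ?_⟩
  · rw [hs2, Finset.sum_mul, ← Finset.sum_add_distrib]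
    unfold TT
    refine Finset.sum_congr rfl fun r _ => ?_
    simp only [hvS, hvB]
    rw [← hP]
    have hl := hlam r
    split_ifs with h
    · rw [min_eq_left (by rw [div_le_iff₀ hl]; linarith)]
      simp only [abs_zero, zero_mul, zero_add]
      rw [← mul_div_assoc, ← pow_two, sq_abs]
    · rw [min_eq_right (by rw [le_div_iff₀ hl]; linarith)]
      simp
  · unfold TT
    rw [← hP, pow_two]
    nth_rewrite 2 [hP]
    rw [Finset.sum_mul]
    exact Finset.sum_le_sum fun r _ => mul_le_mul_of_nonneg_left (min_le_right _ _) (abs_nonneg _)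
  · refine ⟨lin u vB * lin u vB, lin u vB + lin u vB, vS, by rw [hlin]; ring, ?_, ?_, le_rfl⟩
    · refine (norm_mul_le _ _).trans ?_
      simp only
      nlinarith
    · refine mul_le_mul_of_nonneg_right ?_ (rho_nonneg _ _)
      refine (norm_add_le _ _).trans ?_
      linarith
  · refine ⟨lin u p * lin u p, 0, 0, by simp [l0], ?_, by simp, by simp [r0]⟩
    refine (norm_mul_le _ _).trans ?_
    simp only
    nlinarith
  · refine ⟨lin u vB * (lin u vS + lin u p), 0, vS, by rw [hlin]; ring, ?_, by simp, le_rfl⟩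
    refine (norm_mul_le _ _).trans ?_
    have : ‖lin u vS + lin u p‖ ≤ 4 * P := by
      refine (norm_add_le _ _).trans ?_
      linarith
    calc _ ≤ (2 * ∑ r, |vB r|) * (4 * P) := by gcongr
      _ = _ := by ring

theorem gen {ι : Type*} [Fintype ι] (V : ι → ℝ × ℝ) (hV : ∀ i, 0 ≤ (V i).1 ∧ 0 ≤ (V i).2) (C : ℝ)
    (hlam : ∀ r, 0 < lam r) (u : Fin d → A) (hu : ∀ r, ‖u r‖ ≤ 1) (l : List (Fin d → ℝ))
    (hvert : ∀ l' : List ι, l'.length = l.length → EE sq V l' 0 ≤ C)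
    (h : ∀ p : Fin d → ℝ, ∃ c, Dec lam u (lin u p * lin u p) c ∧ Hull V c (TT lam p)) :
    ‖(l.map fun p => lin u p * lin u p).prod * NormedSpace.exp (∑ r, lam r • (u r - 1))‖ ≤
      C * (l.map (TT lam)).prod := by
  choose c hc1 hc2 using h
  have h1 := expand lam hlam u hu (l.map fun p => lin u p * lin u p) (l.map c)
    (by rw [List.forall₂_map_left_iff, List.forall₂_map_right_iff, List.forall₂_same]
        exact fun p _ => hc1 p) 1 []
  have h2 := hull_bound0 V hV C (l.map c) (l.map (TT lam))
    (by rw [List.forall₂_map_left_iff, List.forall₂_map_right_iff, List.forall₂_same]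
        exact fun p _ => hc2 p) (by simpa using hvert)
  simp only [one_mul, List.map_nil, List.prod_nil, mul_one, norm_one, List.length_nil] at h1
  exact h1.trans h2

theorem mid_bound (L q0 P0 P1 Q0 C : ℚ) (k : ℕ) (hL : 1 ≤ L)
    (hP0 : 4 * (1 + (L - 1) * q0 ^ 2) ≤ P0) (hP1 : 1 / L ≤ P1)
    (hQ0 : 4 * ((L - 1) * (1 - q0) ^ 2) ≤ Q0) (p0 : 0 ≤ P0) (p1 : 0 ≤ P1) (qq0 : 0 ≤ Q0)
    (hnum : ∀ a : Fin (k + 1), EQ MQ (VB P0 P1 Q0)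
      (List.replicate a.1 true ++ List.replicate (k - a.1) false) 0 ≤ C)
    (hlam : ∀ r, 0 < lam r) (u : Fin d → A) (hu : ∀ r, ‖u r‖ ≤ 1) (l : List (Fin d → ℝ))
    (hl : l.length = k) :
    ‖(l.map fun p => lin u p * lin u p).prod * NormedSpace.exp (∑ r, lam r • (u r - 1))‖ ≤
      C * (l.map (TT lam)).prod := by
  have hV : ∀ i, 0 ≤ (VB P0 P1 Q0 i).1 ∧ 0 ≤ (VB P0 P1 Q0 i).2 := by
    intro i; cases i <;> simp [VB, p0, p1, qq0]
  refine gen lam (castV (VB P0 P1 Q0)) ?_ C hlam u hu l ?_ ?_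
  · intro i
    have := hV i
    simp only [castV]
    exact_mod_cast this
  · intro l' hl'
    obtain ⟨a, ha, he⟩ := EE_bool sq (castV (VB P0 P1 Q0)) l'
    rw [he]
    refine (EE_le_EQ sq MQ sq_le_MQ _ hV _ 0).trans ?_
    rw [hl', hl] at ha ⊢
    exact_mod_cast hnum ⟨a, by omega⟩
  · intro p
    obtain ⟨b, s, P, hb, hs, hbP, hT, hTP, hd, -, -⟩ := decs lam hlam u hu p
    refine ⟨_, hd, hd.pos, ?_⟩
    obtain ⟨θ, hθ, g1, g2⟩ := mid_num b s P (TT lam p) 1 L q0 P0 P1 Q0 hb hs (hb.trans hbP) hT one_pos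
      (by linarith) (by exact_mod_cast hL) (by rw [mul_one]; exact_mod_cast hP0) (by exact_mod_cast hP1)
      (by rw [mul_one]; exact_mod_cast hQ0) hbP
    refine ⟨θ, hθ, fun i => if i then b * P else s ^ 2, ?_, ?_, ?_, ?_⟩
    · intro i
      have := hb.trans hbP
      cases i
      · simp; positivity
      · simp; positivity
    · simp [hT]
    · simpa [castV, VB] using g1
    · simpa [castV, VB] using g2

end expand

end SmoothAux
namespace SmoothAux

section cases

variable {d : ℕ} (lam : Fin d → ℝ)
variable {A : Type*} [NormedCommRing A] [NormedAlgebra ℝ A] [CompleteSpace A] [NormOneClass A]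

theorem case_one (hlam : ∀ r, 0 < lam r) (u : Fin d → A) (hu : ∀ r, ‖u r‖ ≤ 1)
    (l : List (Fin d → ℝ)) (hl : l.length = 1) :
    ‖(l.map fun p => lin u p * lin u p).prod * NormedSpace.exp (∑ r, lam r • (u r - 1))‖ ≤
      4.342 * (l.map (TT lam)).prod := by
  obtain ⟨p, rfl⟩ := List.length_eq_one_iff.1 hl
  obtain ⟨b, s, P, hb, hs, hbP, hT, hTP, hd1, hd2, -⟩ := decs lam hlam u hu p
  have key : ∀ c, Dec lam u (lin u p * lin u p) c →
      ‖lin u p * lin u p * NormedSpace.exp (∑ r, lam r • (u r - 1))‖ ≤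
        c.1 + c.2.1 + Real.sqrt 2 * c.2.2 := by
    intro c hc
    have := expand lam hlam u hu [lin u p * lin u p] [c] (by simpa using hc) 1 []
    simp only [one_mul, List.map_nil, List.prod_nil, mul_one, norm_one, List.length_nil,
      List.prod_cons, FF] at this
    refine this.trans (le_of_eq ?_)
    norm_num [Nat.factorial]
    ring
  simp only [List.map_cons, List.map_nil, List.prod_cons, List.prod_nil, mul_one]
  have hP : 0 ≤ P := hb.trans hbP
  by_cases hc : 4 * P ^ 2 ≤ 4.342 * TT lam p
  · refine (key _ hd2).trans ?_
    simpa using hc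
  · push Not at hc
    refine (key _ hd1).trans ?_
    have h2 : Real.sqrt 2 ≤ 1.4143 := Real.sqrt_le_iff.2 ⟨by norm_num, by norm_num⟩
    have h3 : Real.sqrt 2 * s ^ 2 ≤ 1.4143 * s ^ 2 := mul_le_mul_of_nonneg_right h2 (sq_nonneg _)
    simp only
    have hTn : 0 ≤ TT lam p := by rw [hT]; positivity
    have hP' : 0 < P := by
      rcases hP.eq_or_lt with h | h
      · rw [← h] at hc; norm_num at hc; linarith
      · exact h
    suffices h : P ^ 2 * (4 * b ^ 2 + 4 * b * s + 1.4143 * s ^ 2) ≤ P ^ 2 * (4.342 * TT lam p) by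
      have := le_of_mul_le_mul_left h (by positivity)
      linarith
    rw [hT] at hc ⊢
    have e1 : P ^ 2 * (4 * b * s) ≤ b * P * (P ^ 2 / 2 + 8 * s ^ 2) := by
      have : 0 ≤ b * P * (8 * (s - P / 4) ^ 2) := by positivity
      nlinarith
    set B := b * P with hB
    set S := s ^ 2 with hS
    have hB0 : 0 ≤ B := by positivity
    have hS0 : 0 ≤ S := by positivity
    have e2 : P ^ 2 * (4 * b ^ 2) = 4 * B ^ 2 := by rw [hB]; ring
    have e3 : 1.0855 * (B + S) * (3.842 * B + 2.9277 * S) ≤ P ^ 2 * (3.842 * B + 2.9277 * S) :=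
      mul_le_mul_of_nonneg_right (by linarith) (by positivity)
    have e4 : 4 * B ^ 2 + 8 * B * S ≤ 1.0855 * (B + S) * (3.842 * B + 2.9277 * S) := by
      nlinarith [sq_nonneg (B - 2 * S), sq_nonneg B, sq_nonneg S, mul_nonneg hB0 hS0]
    nlinarith

theorem case_two (hlam : ∀ r, 0 < lam r) (u : Fin d → A) (hu : ∀ r, ‖u r‖ ≤ 1)
    (l : List (Fin d → ℝ)) (hl : l.length = 2) :
    ‖(l.map fun p => lin u p * lin u p).prod * NormedSpace.exp (∑ r, lam r • (u r - 1))‖ ≤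
      ((21568 / 1000 : ℚ) : ℝ) * (l.map (TT lam)).prod := by
  set V : Fin 3 → ℚ × ℚ := VT (4644/1000) (4360/1161) (1/2) (1960/1161) with hVV
  have hV : ∀ i, 0 ≤ (V i).1 ∧ 0 ≤ (V i).2 := by
    intro i; fin_cases i <;> norm_num [hVV, VT]
  refine gen lam (castV V) ?_ _ hlam u hu l ?_ ?_
  · intro i
    have := hV i
    simp only [castV]
    exact_mod_cast this
  · intro l' hl'
    rw [hl] at hl'
    obtain ⟨i, j, rfl⟩ := List.length_eq_two.1 hl'
    refine (EE_le_EQ sq MQ sq_le_MQ _ hV _ 0).trans ?_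
    have : ∀ i j : Fin 3, EQ MQ (VT (4644/1000) (4360/1161) (1/2) (1960/1161)) [i, j] 0 ≤
      21568 / 1000 := by decide +kernel
    exact_mod_cast this i j
  · intro p
    obtain ⟨b, s, P, hb, hs, hbP, hT, hTP, hd, hd2, -⟩ := decs lam hlam u hu p
    have hP := hb.trans hbP
    have hTn : 0 ≤ TT lam p := by rw [hT]; positivity
    by_cases hc : 4 * P ^ 2 ≤ 4.644 * TT lam p
    · refine ⟨_, hd2, hd2.pos, 1, one_pos, ![TT lam p, 0, 0], ?_, ?_, ?_, ?_⟩
      · intro i; fin_cases i <;> simp [hTn]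
      · simp [Fin.sum_univ_three]
      · simp [Fin.sum_univ_three, castV, hVV, VT]; linarith
      · simp [Fin.sum_univ_three, castV, hVV, VT]
    · push Not at hc
      refine ⟨_, hd, hd.pos, ?_⟩
      obtain ⟨θ, hθ, g1, g2⟩ := mid_num b s P (TT lam p) (1000/1161) 2 0.3 (4360/1161) (1/2) (1960/1161)
        hb hs hP hT (by norm_num) (by linarith) (by norm_num) (by norm_num) (by norm_num)
        (by norm_num) hbP
      refine ⟨θ, hθ, ![0, b * P, s ^ 2], ?_, ?_, ?_, ?_⟩
      · intro i; fin_cases i <;> simp <;> positivity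
      · simp [Fin.sum_univ_three, hT]
      · simpa [Fin.sum_univ_three, castV, hVV, VT] using g1
      · simpa [Fin.sum_univ_three, castV, hVV, VT] using g2

theorem fact_bound (k : ℕ) (hk : 10 ≤ k) : ∀ a ≤ k, 64 ^ a * (2 * (k - a)).factorial ≤ (2 * k).factorial := by
  induction k, hk using Nat.le_induction with
  | base => decide +kernel
  | succ k hk ih =>
    intro a ha
    rcases a with _ | a
    · simp
    · have h := ih a (by omega)
      rw [show k + 1 - (a + 1) = k - a by omega, show 2 * (k + 1) = 2 * k + 1 + 1 by ring,
        Nat.factorial_succ, Nat.factorial_succ]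
      have h2 : 64 ≤ (2 * k + 1 + 1) * (2 * k + 1) := by nlinarith
      calc 64 ^ (a + 1) * (2 * (k - a)).factorial = 64 * (64 ^ a * (2 * (k - a)).factorial) := by ring
        _ ≤ ((2 * k + 1 + 1) * (2 * k + 1)) * (2 * k).factorial := Nat.mul_le_mul h2 h
        _ = _ := by ring

/-- vertices for large `k` -/
def VL : Bool → ℝ × ℝ
  | true => (8, 0)
  | false => (0, 1)

theorem EE_VL_false (b n : ℕ) : EE sq VL (List.replicate b false) n = sq (n + 2 * b) := by
  induction b generalizing n with
  | zero => rfl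
  | succ b ih =>
    simp only [List.replicate_succ, EE, VL, ih]
    rw [show n + 2 + 2 * b = n + 2 * (b + 1) by ring]; ring

theorem EE_VL (a b : ℕ) : EE sq VL (List.replicate a true ++ List.replicate b false) 0 =
    8 ^ a * sq (2 * b) := by
  induction a with
  | zero => simp [EE_VL_false]
  | succ a ih =>
    simp only [List.replicate_succ, List.cons_append, EE, VL, ih]
    ring

theorem case_large (hlam : ∀ r, 0 < lam r) (u : Fin d → A) (hu : ∀ r, ‖u r‖ ≤ 1)
    (l : List (Fin d → ℝ)) (k : ℕ) (hk : 10 ≤ k) (hl : l.length = k) :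
    ‖(l.map fun p => lin u p * lin u p).prod * NormedSpace.exp (∑ r, lam r • (u r - 1))‖ ≤
      Real.sqrt ((2 * k).factorial : ℝ) * (l.map (TT lam)).prod := by
  refine gen lam VL ?_ _ hlam u hu l ?_ ?_
  · intro i; cases i <;> simp [VL]
  · intro l' hl'
    obtain ⟨a, ha, he⟩ := EE_bool sq VL l'
    rw [he, EE_VL]
    rw [hl', hl] at ha ⊢
    apply Real.le_sqrt_of_sq_le
    rw [mul_pow, sq, Real.sq_sqrt (by positivity)]
    have := fact_bound k hk a ha
    rw [← pow_mul, mul_comm a 2, pow_mul]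
    norm_num
    exact_mod_cast this
  · intro p
    obtain ⟨b, s, P, hb, hs, hbP, hT, hTP, -, -, hd⟩ := decs lam hlam u hu p
    have hP := hb.trans hbP
    refine ⟨_, hd, hd.pos, 1, one_pos, fun i => if i then b * P else s ^ 2, ?_, ?_, ?_, ?_⟩
    · intro i
      cases i
      · simp; positivity
      · simp; positivity
    · simp [hT]
    · simp [VL]; linarith
    · simp [VL]

theorem all_cases (hlam : ∀ r, 0 < lam r) (u : Fin d → A) (hu : ∀ r, ‖u r‖ ≤ 1)
    (l : List (Fin d → ℝ)) (k : ℕ) (hk : 1 ≤ k) (hl : l.length = k) :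
    ‖(l.map fun p => lin u p * lin u p).prod * NormedSpace.exp (∑ r, lam r • (u r - 1))‖ ≤
      PaperL1.Dconst k * (k.factorial : ℝ) * (l.map (TT lam)).prod := by
  have hge : ∀ C, C = PaperL1.Dconst k * (k.factorial : ℝ) →
     ‖(l.map fun p => lin u p * lin u p).prod * NormedSpace.exp (∑ r, lam r • (u r - 1))‖ ≤
      C * (l.map (TT lam)).prod → ‖(l.map fun p => lin u p * lin u p).prod * NormedSpace.exp (∑ r, lam r • (u r - 1))‖ ≤
      PaperL1.Dconst k * (k.factorial : ℝ) * (l.map (TT lam)).prod := by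
    rintro _ rfl h; exact h
  rcases le_or_gt 10 k with h10 | h10
  · refine hge _ ?_ (case_large lam hlam u hu l k h10 hl)
    unfold PaperL1.Dconst
    repeat rw [if_neg (by omega)]
    rw [div_mul_cancel₀ _ (by positivity)]
  interval_cases k
  · refine hge _ ?_ (case_one lam hlam u hu l hl)
    norm_num [PaperL1.Dconst]
  · refine hge _ ?_ (case_two lam hlam u hu l hl)
    norm_num [PaperL1.Dconst]
  · refine hge _ ?_ (mid_bound lam (19/10) (12/100) (4 * (1 + (19/10 - 1) * (12/100) ^ 2)) (1/(19/10))
      (4 * ((19/10 - 1) * (1 - 12/100) ^ 2)) (21721/1000*6) 3 (by norm_num) le_rfl le_rfl le_rfl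
      (by norm_num) (by norm_num) (by norm_num) (by decide +kernel) hlam u hu l hl)
    norm_num [PaperL1.Dconst, Nat.factorial]
  · refine hge _ ?_ (mid_bound lam (18/10) (14/100) (4 * (1 + (18/10 - 1) * (14/100) ^ 2)) (1/(18/10))
      (4 * ((18/10 - 1) * (1 - 14/100) ^ 2)) (40687/1000*24) 4 (by norm_num) le_rfl le_rfl le_rfl
      (by norm_num) (by norm_num) (by norm_num) (by decide +kernel) hlam u hu l hl)
    norm_num [PaperL1.Dconst, Nat.factorial]
  · refine hge _ ?_ (mid_bound lam (18/10) (26/100) (4 * (1 + (18/10 - 1) * (26/100) ^ 2)) (1/(18/10))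
      (4 * ((18/10 - 1) * (1 - 26/100) ^ 2)) (74672/1000*120) 5 (by norm_num) le_rfl le_rfl le_rfl
      (by norm_num) (by norm_num) (by norm_num) (by decide +kernel) hlam u hu l hl)
    norm_num [PaperL1.Dconst, Nat.factorial]
  · refine hge _ ?_ (mid_bound lam (18/10) (38/100) (4 * (1 + (18/10 - 1) * (38/100) ^ 2)) (1/(18/10))
      (4 * ((18/10 - 1) * (1 - 38/100) ^ 2)) (125448/1000*720) 6 (by norm_num) le_rfl le_rfl le_rfl
      (by norm_num) (by norm_num) (by norm_num) (by decide +kernel) hlam u hu l hl)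
    norm_num [PaperL1.Dconst, Nat.factorial]
  · refine hge _ ?_ (mid_bound lam (18/10) (50/100) (4 * (1 + (18/10 - 1) * (50/100) ^ 2)) (1/(18/10))
      (4 * ((18/10 - 1) * (1 - 50/100) ^ 2)) (186872/1000*5040) 7 (by norm_num) le_rfl le_rfl le_rfl
      (by norm_num) (by norm_num) (by norm_num) (by decide +kernel) hlam u hu l hl)
    norm_num [PaperL1.Dconst, Nat.factorial]
  · refine hge _ ?_ (mid_bound lam (17/10) (60/100) (4 * (1 + (17/10 - 1) * (60/100) ^ 2)) (1/(17/10))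
      (4 * ((17/10 - 1) * (1 - 60/100) ^ 2)) (253020/1000*40320) 8 (by norm_num) le_rfl le_rfl le_rfl
      (by norm_num) (by norm_num) (by norm_num) (by decide +kernel) hlam u hu l hl)
    norm_num [PaperL1.Dconst, Nat.factorial]
  · refine hge _ ?_ (mid_bound lam (16/10) (70/100) (4 * (1 + (16/10 - 1) * (70/100) ^ 2)) (1/(16/10))
      (4 * ((16/10 - 1) * (1 - 70/100) ^ 2)) (305314/1000*362880) 9 (by norm_num) le_rfl le_rfl le_rfl
      (by norm_num) (by norm_num) (by norm_num) (by decide +kernel) hlam u hu l hl)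
    norm_num [PaperL1.Dconst, Nat.factorial]

end cases

end SmoothAux
namespace SmoothAux

section ell

variable {X : Type*}

/-- the space `ℓ¹(X)` -/
def L1 (X : Type*) : Type _ := lp (fun _ : X => ℝ) 1

instance : NormedAddCommGroup (L1 X) := inferInstanceAs (NormedAddCommGroup (lp (fun _ : X => ℝ) 1))
instance : NormedSpace ℝ (L1 X) := inferInstanceAs (NormedSpace ℝ (lp (fun _ : X => ℝ) 1))
instance : CompleteSpace (L1 X) := inferInstanceAs (CompleteSpace (lp (fun _ : X => ℝ) 1))

/-- coordinate evaluation -/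
def ev (x : X) : L1 X →L[ℝ] ℝ := lp.evalCLM ℝ (fun _ : X => ℝ) 1 x

/-- underlying function -/
def fn (f : L1 X) : X → ℝ := fun x => ev x f

theorem fn_ext {f g : L1 X} (h : fn f = fn g) : f = g :=
  lp.ext (E := fun _ : X => ℝ) (p := 1) h

theorem fn_summable (f : L1 X) : Summable fun x => |fn f x| := by
  have := (lp.memℓp (E := fun _ : X => ℝ) (p := 1) f).summable (by simp)
  simp only [ENNReal.toReal_one, Real.rpow_one] at this
  exact this

theorem norm_fn (f : L1 X) : ‖f‖ = ∑' x, |fn f x| := by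
  have := lp.norm_eq_tsum_rpow (E := fun _ : X => ℝ) (p := 1) (by simp) f
  simp only [ENNReal.toReal_one, Real.rpow_one, div_one] at this
  exact this

/-- constructor -/
def ofFn (f : X → ℝ) (h : Summable fun x => |f x|) : L1 X :=
  (⟨f, memℓp_gen (by simpa using h)⟩ : lp (fun _ : X => ℝ) 1)

theorem fn_ofFn (f : X → ℝ) (h : Summable fun x => |f x|) : fn (ofFn f h) = f := rfl

/-- point masses -/
def pt (x : X) : L1 X := lp.single (E := fun _ : X => ℝ) 1 x (1 : ℝ)

theorem fn_pt (x y : X) : fn (pt x) y = if y = x then 1 else 0 := by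
  have := lp.single_apply (E := fun _ : X => ℝ) 1 x (1 : ℝ) y
  show (lp.single (E := fun _ : X => ℝ) 1 x (1 : ℝ)) y = _
  rw [this, Pi.single_apply]

theorem norm_pt (x : X) : ‖pt x‖ = 1 := by
  have := lp.norm_single (E := fun _ : X => ℝ) (p := 1) (by simp) x (1 : ℝ)
  exact this.trans (by simp)

theorem hasSum_pt (f : L1 X) : HasSum (fun x => fn f x • pt x) f := by
  have := lp.hasSum_single (E := fun _ : X => ℝ) (p := 1) (by simp) f
  have e : (fun x => fn f x • pt x) =
      fun x => (lp.single (E := fun _ : X => ℝ) 1 x (f.1 x) : L1 X) := by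
    funext x
    refine fn_ext (funext fun y => ?_)
    have h2 := lp.single_apply (E := fun _ : X => ℝ) 1 x (f.1 x) y
    refine Eq.trans ?_ h2.symm
    have h3 : fn (fn f x • pt x) y = fn f x * fn (pt x) y := by simp [fn]
    rw [h3, fn_pt, Pi.single_apply]
    split_ifs with h
    · rw [mul_one]; rfl
    · simp
  rw [e]
  exact this

variable {F : Type*} [NormedAddCommGroup F] [NormedSpace ℝ F]

theorem clm_ext {S T : L1 X →L[ℝ] F} (h : ∀ x, S (pt x) = T (pt x)) : S = T := by
  ext f
  have h1 := (hasSum_pt f).mapL S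
  have h2 := (hasSum_pt f).mapL T
  simp only [map_smul, h] at h1 h2
  exact h1.unique h2

variable [CompleteSpace F]

theorem Phi_summable (e : X → F) (he : ∀ x, ‖e x‖ ≤ 1) (f : L1 X) :
    Summable fun x => ‖fn f x • e x‖ := by
  refine Summable.of_nonneg_of_le (fun _ => norm_nonneg _) (fun x => ?_) (fn_summable f)
  rw [norm_smul, Real.norm_eq_abs]
  exact mul_le_of_le_one_right (abs_nonneg _) (he x)

/-- linear extension of a bounded family -/
def Phi (e : X → F) (he : ∀ x, ‖e x‖ ≤ 1) : L1 X →L[ℝ] F :=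
  LinearMap.mkContinuous
    { toFun := fun f => ∑' x, fn f x • e x
      map_add' := by
        intro f g
        rw [← (Phi_summable e he f).of_norm.tsum_add (Phi_summable e he g).of_norm]
        refine tsum_congr fun x => ?_
        rw [← add_smul]
        simp [fn]
      map_smul' := by
        intro c f
        rw [RingHom.id_apply, ← (Phi_summable e he f).of_norm.tsum_const_smul]
        refine tsum_congr fun x => ?_
        simp [fn, mul_smul] } 1 (by
      intro f
      rw [one_mul, norm_fn]
      refine (norm_tsum_le_tsum_norm (Phi_summable e he f)).trans ?_
      refine (Phi_summable e he f).tsum_le_tsum (fun x => ?_) (fn_summable f)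
      rw [norm_smul, Real.norm_eq_abs]
      exact mul_le_of_le_one_right (abs_nonneg _) (he x))

theorem Phi_apply (e : X → F) (he : ∀ x, ‖e x‖ ≤ 1) (f : L1 X) :
    Phi e he f = ∑' x, fn f x • e x := rfl

theorem Phi_norm (e : X → F) (he : ∀ x, ‖e x‖ ≤ 1) : ‖Phi e he‖ ≤ 1 :=
  LinearMap.mkContinuous_norm_le _ zero_le_one _

theorem Phi_pt (e : X → F) (he : ∀ x, ‖e x‖ ≤ 1) (x : X) : Phi e he (pt x) = e x := by
  rw [Phi_apply, tsum_eq_single x]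
  · simp [fn_pt]
  · intro y hy; simp [fn_pt, hy]

end ell

section alg

variable {X : Type*} [AddCommMonoid X]

/-- translation by `y` -/
def tau (y : X) : L1 X →L[ℝ] L1 X := Phi (fun z => pt (y + z)) (fun _ => (norm_pt _).le)

theorem tau_norm (y : X) : ‖tau y‖ ≤ 1 := Phi_norm _ _

/-- convolution as a bilinear map -/
def TM : L1 X →L[ℝ] L1 X →L[ℝ] L1 X := Phi tau tau_norm

theorem TM_pt (x y : X) : TM (pt x) (pt y) = pt (x + y) := by
  unfold TM; rw [Phi_pt]; unfold tau; rw [Phi_pt]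

theorem TM_comm (f g : L1 X) : TM f g = TM g f := by
  have : (TM : L1 X →L[ℝ] L1 X →L[ℝ] L1 X) = TM.flip := by
    refine clm_ext fun x => clm_ext fun y => ?_
    rw [ContinuousLinearMap.flip_apply, TM_pt, TM_pt, add_comm]
  conv_lhs => rw [this]
  rfl

theorem TM_one (f : L1 X) : TM (pt 0) f = f := by
  have : TM (pt 0) = ContinuousLinearMap.id ℝ (L1 X) := by
    refine clm_ext fun x => ?_
    rw [TM_pt]; simp
  rw [this]; rfl

theorem TM_assoc (f g h : L1 X) : TM (TM f g) h = TM f (TM g h) := by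
  have h1 : ∀ x y : X, TM (TM (pt x) (pt y)) = (TM (pt x)).comp (TM (pt y)) := fun x y =>
    clm_ext fun z => by
      rw [ContinuousLinearMap.comp_apply, TM_pt, TM_pt, TM_pt, TM_pt, add_assoc]
  have h2 : ∀ x : X, ∀ h : L1 X, (TM.flip h).comp (TM (pt x)) = (TM (pt x)).comp (TM.flip h) := fun x h =>
    clm_ext (F := L1 X) fun y => by
      have := congrArg (fun S => S h) (h1 x y)
      simpa using this
  have h3 : (TM.flip h).comp (TM.flip g) = TM.flip (TM g h) :=
    clm_ext fun x => by
      have := congrArg (fun S => S g) (h2 x h)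
      simpa using this
  have := congrArg (fun S => S f) h3
  simpa using this

theorem TM_norm (f g : L1 X) : ‖TM f g‖ ≤ ‖f‖ * ‖g‖ := by
  have h1 : ‖(TM : L1 X →L[ℝ] L1 X →L[ℝ] L1 X)‖ ≤ 1 := Phi_norm _ _
  have h2 := ContinuousLinearMap.le_opNorm₂ TM f g
  refine h2.trans ?_
  have : ‖(TM : L1 X →L[ℝ] L1 X →L[ℝ] L1 X)‖ * ‖f‖ ≤ 1 * ‖f‖ := by gcongr
  rw [one_mul] at this
  gcongr

instance : CommRing (L1 X) where
  __ := (inferInstance : AddCommGroup (L1 X))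
  mul f g := TM f g
  one := pt 0
  left_distrib f g h := map_add (TM f) g h
  right_distrib f g h := by
    show TM (f + g) h = TM f h + TM g h
    rw [map_add]; rfl
  zero_mul f := by show TM 0 f = 0; rw [map_zero]; rfl
  mul_zero f := map_zero (TM f)
  mul_assoc := TM_assoc
  one_mul := TM_one
  mul_one f := (TM_comm _ _).trans (TM_one f)
  mul_comm := TM_comm

theorem mul_def (f g : L1 X) : f * g = TM f g := rfl
theorem one_def : (1 : L1 X) = pt 0 := rfl

instance : NormedCommRing (L1 X) where
  __ := (inferInstance : NormedAddCommGroup (L1 X))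
  __ := (inferInstance : CommRing (L1 X))
  norm_mul_le := TM_norm

instance : NormedAlgebra ℝ (L1 X) where
  toAlgebra := Algebra.ofModule
    (fun c f g => by rw [mul_def, mul_def, map_smul]; rfl)
    (fun c f g => by rw [mul_def, mul_def, map_smul])
  norm_smul_le := norm_smul_le

instance : NormOneClass (L1 X) := ⟨norm_pt 0⟩

end alg

end SmoothAux
namespace SmoothAux

section transfer

variable {X : Type*} [AddCommMonoid X]

theorem fn_add (f g : L1 X) : fn (f + g) = fn f + fn g := by
  funext x; exact map_add (ev x) f g

theorem fn_sub (f g : L1 X) : fn (f - g) = fn f - fn g := by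
  funext x; exact map_sub (ev x) f g

theorem fn_smul (c : ℝ) (f : L1 X) : fn (c • f) = c • fn f := by
  funext x; exact map_smul (ev x) c f

theorem fn_sum {ι : Type*} (s : Finset ι) (f : ι → L1 X) :
    fn (∑ i ∈ s, f i) = ∑ i ∈ s, fn (f i) := by
  funext x
  rw [Finset.sum_apply]
  exact map_sum (ev x) f s

theorem fn_one : fn (1 : L1 X) = PaperL1.delta 0 := by
  funext x; exact fn_pt 0 x

theorem fn_mul (f g : L1 X) : fn (f * g) = PaperL1.conv (fn f) (fn g) := by
  funext x
  have hs : Summable fun q : X × X => fn f q.1 * fn g q.2 :=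
    summable_mul_of_summable_norm (fn_summable f) (fn_summable g)
  have hs2 := hs.indicator {q : X × X | q.1 + q.2 = x}
  have e1 : fn (f * g) x = ∑' y, ∑' z, fn f y * (fn g z * (if x = y + z then 1 else 0)) := by
    have a : f * g = (∑' y, fn f y • tau y) g := rfl
    have h1 := (Phi_summable (tau : X → _) tau_norm f).of_norm.hasSum
    have h2 := h1.mapL ((ev x).comp (ContinuousLinearMap.apply ℝ (L1 X) g))
    have h3 : fn (f * g) x = ((ev x).comp (ContinuousLinearMap.apply ℝ (L1 X) g))
      (∑' y, fn f y • tau y) := rfl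
    rw [h3, ← h2.tsum_eq]
    refine tsum_congr fun y => ?_
    have h4 : ((ev x).comp (ContinuousLinearMap.apply ℝ (L1 X) g)) (fn f y • tau y) =
      fn f y * ev x (tau y g) := by simp
    rw [h4, tsum_mul_left]
    congr 1
    have h5 := (Phi_summable (fun z : X => pt (y + z)) (fun _ => (norm_pt _).le) g).of_norm.hasSum
    have h6 := h5.mapL (ev x)
    have h7 : ev x (tau y g) = ev x (∑' z, fn g z • pt (y + z)) := rfl
    rw [h7, ← h6.tsum_eq]
    refine tsum_congr fun z => ?_
    rw [map_smul, smul_eq_mul]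
    congr 1
    exact fn_pt _ _
  rw [e1]
  unfold PaperL1.conv
  have e2 := tsum_subtype {q : X × X | q.1 + q.2 = x} (fun q : X × X => fn f q.1 * fn g q.2)
  refine Eq.trans ?_ e2.symm
  rw [hs2.tsum_prod]
  refine tsum_congr fun y => tsum_congr fun z => ?_
  by_cases h : y + z = x
  · rw [Set.indicator_of_mem (by exact h), if_pos h.symm]; simp
  · rw [Set.indicator_of_notMem (by exact h), if_neg (fun h' => h h'.symm)]; simp

theorem fn_pow (f : L1 X) (n : ℕ) : fn (f ^ n) = PaperL1.convPow (fn f) n := by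
  induction n with
  | zero => rw [pow_zero, fn_one]; rfl
  | succ n ih => rw [pow_succ', fn_mul, ih]; rfl

theorem fn_exp (f : L1 X) : fn (NormedSpace.exp f) = PaperL1.convExp (fn f) := by
  funext x
  have h := (NormedSpace.exp_series_hasSum_exp' (𝕂 := ℝ) f).mapL (ev x)
  unfold PaperL1.convExp
  refine h.tsum_eq.symm.trans (tsum_congr fun n => ?_)
  rw [map_smul, smul_eq_mul, ← fn_pow]
  rfl

theorem fn_foldr {ι : Type*} (l : List ι) (f : ι → L1 X) :
    fn (l.map f).prod = l.foldr (fun i acc => PaperL1.conv (fn (f i)) acc) (PaperL1.delta 0) := by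
  induction l with
  | nil => exact fn_one
  | cons i l ih => rw [List.map_cons, List.prod_cons, fn_mul, ih]; rfl

theorem fn_norm (f : L1 X) : PaperL1.l1norm (fn f) = ‖f‖ := (norm_fn f).symm

end transfer

end SmoothAux

/-- Corollary 4.4 of Roos:
`‖(Π_j R_j²) G‖ ≤ D_k k! Π_j (Σ_r |p_{j,r}| min{|p_{j,r}|/λ_r, p_j})`. -/
theorem smoothness_estimate_squares_Dk
    {X : Type*} [AddCommMonoid X] [Countable X]
    (d k : ℕ) (hd : 1 ≤ d) (hk : 1 ≤ k)
    (p : Fin k → Fin d → ℝ) (lam : Fin d → ℝ) (hlam : ∀ r, 0 < lam r)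
    (U : Fin d → X → ℝ) (hU : ∀ r, IsPmf (U r))
    (W : Fin d → X → ℝ) (hW : ∀ r, W r = U r - delta 0)
    (R : Fin k → X → ℝ) (hR : ∀ j, R j = ∑ r, p j r • W r)
    (G : X → ℝ) (hG : G = convExp (∑ r, lam r • W r))
    (pa : Fin k → ℝ) (hpa : ∀ j, pa j = ∑ r, |p j r|) :
    l1norm (conv (convProd Finset.univ (fun j => conv (R j) (R j))) G) ≤
      Dconst k * (k.factorial : ℝ) *
        ∏ j, (∑ r, |p j r| * min (|p j r| / lam r) (pa j)) := by
  have hsum : ∀ r, Summable fun x => |U r x| := fun r => (hU r).2.summable.abs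
  set u : Fin d → SmoothAux.L1 X := fun r => SmoothAux.ofFn (U r) (hsum r) with hu
  have hfu : ∀ r, SmoothAux.fn (u r) = U r := fun r => rfl
  have hun : ∀ r, ‖u r‖ ≤ 1 := by
    intro r
    rw [SmoothAux.norm_fn, hfu]
    simp_rw [abs_of_nonneg ((hU r).1 _)]
    exact (hU r).2.tsum_eq.le
  have hfW : ∀ r, SmoothAux.fn (u r - 1) = W r := by
    intro r
    rw [SmoothAux.fn_sub, SmoothAux.fn_one, hfu, hW]
  have hlinW : ∀ q : Fin d → ℝ, SmoothAux.fn (∑ r, q r • (u r - 1)) = ∑ r, q r • W r := by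
    intro q
    rw [SmoothAux.fn_sum]
    exact Finset.sum_congr rfl fun r _ => by rw [SmoothAux.fn_smul, hfW]
  have hfR : ∀ j, SmoothAux.fn (SmoothAux.lin u (p j)) = R j := by
    intro j; rw [hR]; exact hlinW (p j)
  set js : List (Fin k) := (Finset.univ : Finset (Fin k)).sort (· ≤ ·) with hjs
  have hlen : (js.map p).length = k := by simp [hjs]
  have main := SmoothAux.all_cases lam hlam u hun (js.map p) k hk hlen
  have hprod : ((js.map p).map (SmoothAux.TT lam)).prod =
      ∏ j, (∑ r, |p j r| * min (|p j r| / lam r) (pa j)) := by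
    have h1 : ∏ j, (∑ r, |p j r| * min (|p j r| / lam r) (pa j)) = ∏ j, SmoothAux.TT lam (p j) := by
      refine Finset.prod_congr rfl fun j _ => ?_
      unfold SmoothAux.TT
      rw [hpa]
    rw [h1, List.map_map, ← Multiset.prod_coe, ← Multiset.map_coe, hjs, Finset.sort_eq]
    rfl
  rw [hprod, List.map_map] at main
  refine le_trans (le_of_eq ?_) main
  rw [← SmoothAux.fn_norm, SmoothAux.fn_mul, SmoothAux.fn_exp, hlinW, ← hG, SmoothAux.fn_foldr]
  have hf : ∀ j, SmoothAux.fn (((fun q => SmoothAux.lin u q * SmoothAux.lin u q) ∘ p) j) =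
      conv (R j) (R j) := by
    intro j
    rw [Function.comp_apply, SmoothAux.fn_mul, hfR]
  simp only [hf]
  rfl
end
end

section
/- Let X be a countable commutative additive monoid and d ≥ 1. For r ∈ {1,…,d}, let p_r ∈ [0,1] and λ_r ∈ (0,∞) with λ_r ≥ p_r, and let U_r be probability mass functions in ℓ¹(X). Assume p := Σ_{r=1}^d p_r ≤ 1. Let R = Σ_{r=1}^d p_r(U_r − δ₀) and G = exp(Σ_{r=1}^d λ_r(U_r − δ₀)). Let u ∈ [0,1/2], v, w ∈ (0,∞), and let w₀ ∈ (1,∞) be the unique solution of f(w₀) = 2/w, where f(x) = x·log(1 + 1/(x−1)) − 1 for x ∈ (1,∞). Set C = max{ (√2 + u/v)·(2/w), 4(1−u) + 2uv }. Then ‖ ((δ₀ + R) * exp(−R) − δ₀) * G ‖ ≤ C · Σ_{r=1}^d p_r · min{ w₀·p_r/λ_r, p }. -/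
open scoped Classical BigOperators

noncomputable section

namespace PaperL1

variable {X : Type*} [AddCommMonoid X]

lemma hs_congr {B Ω : Type*} [AddCommMonoid B] [TopologicalSpace B] {f g : Ω → B} {a b : B}
    (h : HasSum g b) (hf : ∀ x, f x = g x) (hab : a = b) : HasSum f a := by
  have : f = g := funext hf
  rw [this, hab]; exact h

section Banach
set_option linter.unusedSectionVars false
variable {A : Type*} [NormedCommRing A] [NormedAlgebra ℝ A] [CompleteSpace A]

lemma bexp_add (x y : A) : NormedSpace.exp (x + y) = NormedSpace.exp x * NormedSpace.exp y := by
  let _ := NormedAlgebra.restrictScalars ℚ ℝ A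
  exact NormedSpace.exp_add

lemma bexp_smul_one (c : ℝ) : NormedSpace.exp (c • (1 : A)) = Real.exp c • (1 : A) := by
  rw [← Algebra.algebraMap_eq_smul_one, ← Algebra.algebraMap_eq_smul_one, Real.exp_eq_exp_ℝ]
  exact (NormedSpace.algebraMap_exp_comm c).symm

/-- Poisson weights. -/
def poi (μ : ℝ) (n : ℕ) : ℝ := Real.exp (-μ) * (μ ^ n / (n.factorial : ℝ))

lemma poi_nonneg {μ : ℝ} (hμ : 0 ≤ μ) (n : ℕ) : 0 ≤ poi μ n := by
  unfold poi; positivity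

lemma poi_hasSum (μ : ℝ) (U : A) :
    HasSum (fun n => poi μ n • U ^ n) (NormedSpace.exp (μ • (U - 1))) := by
  have h1 : μ • (U - 1) = (-μ) • (1 : A) + μ • U := by rw [smul_sub, neg_smul]; abel
  rw [h1, bexp_add, bexp_smul_one, smul_one_mul]
  have h := (NormedSpace.exp_series_hasSum_exp' (𝕂 := ℝ) (μ • U)).const_smul (Real.exp (-μ))
  refine hs_congr h ?_ rfl
  intro n
  simp only [poi, smul_pow, smul_smul]
  congr 1
  ring

lemma poi_hasSum_desc (μ : ℝ) (U : A) (k : ℕ) :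
    HasSum (fun n => (poi μ n * (n.descFactorial k : ℝ)) • U ^ n)
      (μ ^ k • (U ^ k * NormedSpace.exp (μ • (U - 1)))) := by
  have h := ((poi_hasSum μ U).mul_left (U ^ k)).const_smul (μ ^ k)
  rw [← Function.Injective.hasSum_iff (g := fun n : ℕ => n + k) (fun a b h => by simpa using h)]
  · refine hs_congr h ?_ rfl
    intro n
    have h2 : (((n + k).factorial : ℕ) : ℝ) = n.factorial * ((n + k).descFactorial k : ℝ) := by
      have := Nat.factorial_mul_descFactorial (n := n + k) (k := k) (by omega)
      rw [Nat.add_sub_cancel] at this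
      exact_mod_cast this.symm
    have h3 : (((n + k).descFactorial k : ℕ) : ℝ) ≠ 0 := by
      have : (n + k).descFactorial k ≠ 0 := by
        rw [Ne, Nat.descFactorial_eq_zero_iff_lt]; omega
      exact_mod_cast this
    have h4 : ((n.factorial : ℕ) : ℝ) ≠ 0 := by exact_mod_cast n.factorial_ne_zero
    simp only [Function.comp, poi, h2, mul_smul_comm, smul_smul, ← pow_add, add_comm k n]
    congr 1
    field_simp
    ring
  · intro n hn
    have : n < k := by
      by_contra hh
      exact hn ⟨n - k, by simp; omega⟩
    simp [Nat.descFactorial_eq_zero_iff_lt.2 this]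

lemma poi_real (μ : ℝ) (k : ℕ) :
    HasSum (fun n => poi μ n * (n.descFactorial k : ℝ)) (μ ^ k) := by
  have := poi_hasSum_desc (A := ℝ) μ 1 k
  simpa [NormedSpace.exp_zero] using this

/-- A second-order representation. -/
def Rep (E R : A) (a : ℝ) : Prop :=
  ∃ (Ω : Type) (π ξ η : Ω → ℝ) (V : Ω → A),
    (∀ x, 0 ≤ π x) ∧ (∀ x, ‖V x‖ ≤ 1) ∧ HasSum π 1 ∧ HasSum (fun x => π x * ξ x) 0 ∧
    HasSum (fun x => π x * ξ x ^ 2) a ∧ HasSum (fun x => π x * η x) 0 ∧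
    HasSum (fun x => π x * η x ^ 2) (2 * a ^ 2) ∧ HasSum (fun x => π x • V x) E ∧
    HasSum (fun x => (π x * ξ x) • V x) (R * E) ∧
    HasSum (fun x => (π x * η x) • V x) (R ^ 2 * E)

lemma desc2 (n : ℕ) : ((n.descFactorial 2 : ℕ) : ℝ) = n * (n - 1) := by
  rcases n with _ | n <;> simp [Nat.descFactorial]; ring
lemma desc3 (n : ℕ) : ((n.descFactorial 3 : ℕ) : ℝ) = n * (n - 1) * (n - 2) := by
  rcases n with _ | _ | n <;> simp [Nat.descFactorial]; ring
lemma desc4 (n : ℕ) : ((n.descFactorial 4 : ℕ) : ℝ) = n * (n - 1) * (n - 2) * (n - 3) := by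
  rcases n with _ | _ | _ | n <;> simp [Nat.descFactorial]
  ring

lemma rep_single [NormOneClass A] (U : A) (hU : ‖U‖ ≤ 1) (c μ : ℝ) (hμ : 0 < μ) :
    Rep (NormedSpace.exp (μ • (U - 1))) (c • (U - 1)) (c ^ 2 / μ) := by
  have r0 : HasSum (fun n => poi μ n) 1 := by simpa using poi_real μ 0
  have r1 : HasSum (fun n => poi μ n * (n : ℝ)) μ := by simpa using poi_real μ 1
  have r2 := poi_real μ 2
  have r3 := poi_real μ 3
  have r4 := poi_real μ 4
  have v0 : HasSum (fun n => poi μ n • U ^ n) (NormedSpace.exp (μ • (U - 1))) := poi_hasSum μ U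
  have v1 := poi_hasSum_desc μ U 1
  have v2 := poi_hasSum_desc μ U 2
  simp only [desc2, desc3, desc4, Nat.descFactorial_one] at r2 r3 r4 v1 v2
  have hμ' := hμ.ne'
  refine ⟨ℕ, poi μ, fun n => c * (n / μ - 1), fun n => c ^ 2 * (n * (n - 1) / μ ^ 2 - 2 * n / μ + 1),
    fun n => U ^ n, poi_nonneg hμ.le, fun n => (norm_pow_le _ _).trans (pow_le_one₀ (norm_nonneg _) hU),
    r0, ?_, ?_, ?_, ?_, v0, ?_, ?_⟩
  · refine hs_congr (((r1.mul_left (c / μ)).sub (r0.mul_left c))) ?_ ?_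
    · intro n; field_simp
    · field_simp; ring
  · refine hs_congr (((r2.mul_left (c ^ 2 / μ ^ 2)).add (r1.mul_left (c ^ 2 / μ ^ 2 - 2 * c ^ 2 / μ))).add
      (r0.mul_left (c ^ 2))) ?_ ?_
    · intro n; field_simp; ring
    · field_simp; ring
  · refine hs_congr (((r2.mul_left (c ^ 2 / μ ^ 2)).add (r1.mul_left (- 2 * c ^ 2 / μ))).add
      (r0.mul_left (c ^ 2))) ?_ ?_
    · intro n; field_simp; ring
    · field_simp; ring
  · refine hs_congr (((((r4.mul_left (c ^ 4 / μ ^ 4)).add (r3.mul_left (4 * c ^ 4 / μ ^ 4 - 4 * c ^ 4 / μ ^ 3))).add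
      (r2.mul_left (2 * c ^ 4 / μ ^ 4 - 8 * c ^ 4 / μ ^ 3 + 6 * c ^ 4 / μ ^ 2))).add
      (r1.mul_left (4 * c ^ 4 / μ ^ 2 - 4 * c ^ 4 / μ))).add
      (r0.mul_left (c ^ 4))) ?_ ?_
    · intro n; field_simp; ring
    · field_simp; ring
  · refine hs_congr (((v1.const_smul (c / μ)).sub (v0.const_smul c))) ?_ ?_
    · intro n; simp only [smul_smul, ← sub_smul]; congr 1; field_simp
    · simp only [smul_smul]
      rw [show c / μ * μ ^ 1 = c by field_simp, ← smul_sub, smul_mul_assoc]; congr 1; ring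
  · refine hs_congr (((v2.const_smul (c ^ 2 / μ ^ 2)).add (v1.const_smul (- 2 * c ^ 2 / μ))).add
      (v0.const_smul (c ^ 2))) ?_ ?_
    · intro n; simp only [smul_smul, ← add_smul]; congr 1; field_simp; ring
    · simp only [smul_smul]
      rw [show c ^ 2 / μ ^ 2 * μ ^ 2 = c ^ 2 by field_simp,
        show -2 * c ^ 2 / μ * μ ^ 1 = c ^ 2 * (-2) by field_simp, mul_smul, ← smul_add, ← smul_add,
        smul_pow, smul_mul_assoc]
      congr 1
      rw [neg_smul, ofNat_smul_eq_nsmul ℝ 2, nsmul_eq_mul]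
      push_cast
      ring

lemma rep_zero [NormOneClass A] : Rep (1 : A) 0 0 := by
  refine ⟨Unit, fun _ => 1, fun _ => 0, fun _ => 0, fun _ => 1, ?_⟩
  refine ⟨fun _ => zero_le_one, fun _ => by simp, ?_, ?_, ?_, ?_, ?_, ?_, ?_, ?_⟩ <;> simp

lemma mulR {Ω Ω' : Type} {f : Ω → ℝ} {g : Ω' → ℝ} {a b : ℝ} (hf : HasSum f a) (hg : HasSum g b) :
    HasSum (fun p : Ω × Ω' => f p.1 * g p.2) (a * b) :=
  hf.mul hg (summable_mul_of_summable_norm hf.summable.norm hg.summable.norm)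

lemma key_summable {Ω : Type} {f : Ω → ℝ} {V : Ω → A} (hV : ∀ x, ‖V x‖ ≤ 1) (hf : Summable f) :
    Summable (fun x => ‖f x • V x‖) := by
  refine Summable.of_nonneg_of_le (fun _ => norm_nonneg _) (fun x => ?_) hf.norm
  rw [norm_smul]
  exact mul_le_of_le_one_right (norm_nonneg _) (hV x)

lemma mulA {Ω Ω' : Type} {f : Ω → ℝ} {g : Ω' → ℝ} {V : Ω → A} {V' : Ω' → A} {a b : A}
    (hV : ∀ x, ‖V x‖ ≤ 1) (hV' : ∀ x, ‖V' x‖ ≤ 1)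
    (hf' : Summable f) (hg' : Summable g)
    (hf : HasSum (fun x => f x • V x) a) (hg : HasSum (fun x => g x • V' x) b) :
    HasSum (fun p : Ω × Ω' => (f p.1 * g p.2) • (V p.1 * V' p.2)) (a * b) := by
  have h1 := key_summable hV hf'
  have h2 := key_summable hV' hg'
  have h3 := summable_mul_of_summable_norm h1 h2
  have h4 := HasSum.mul hf hg h3
  have h5 : ∀ p : Ω × Ω', (f p.1 * g p.2) • (V p.1 * V' p.2)
      = (f p.1 • V p.1) * (g p.2 • V' p.2) := fun p => by
    rw [smul_mul_assoc, mul_smul_comm, smul_smul]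
  exact hs_congr h4 h5 rfl

lemma Rep.mul {E R E' R' : A} {a a' : ℝ} (h : Rep E R a) (h' : Rep E' R' a') :
    Rep (E * E') (R + R') (a + a') := by
  obtain ⟨Ω, π, ξ, η, V, hπ, hV, s0, s1, s2, t1, t2, v0, v1, v2⟩ := h
  obtain ⟨Ω', π', ξ', η', V', hπ', hV', s0', s1', s2', t1', t2', v0', v1', v2'⟩ := h'
  -- the mixed moment of ξ and η is summable
  have mix : ∀ {Ω : Type} {π ξ η : Ω → ℝ}, (∀ x, 0 ≤ π x) → Summable (fun x => π x * ξ x ^ 2) →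
      Summable (fun x => π x * η x ^ 2) → Summable (fun x => π x * (ξ x * η x)) := by
    intro Ω π ξ η hπ h1 h2
    refine Summable.of_norm_bounded (h1.add h2) (fun x => ?_)
    rw [Real.norm_eq_abs, abs_mul, abs_of_nonneg (hπ x), ← mul_add]
    refine mul_le_mul_of_nonneg_left ?_ (hπ x)
    rw [abs_le]; constructor <;> nlinarith [sq_nonneg (ξ x + η x), sq_nonneg (ξ x - η x), sq_nonneg (ξ x), sq_nonneg (η x)]
  obtain ⟨m, hm⟩ := mix hπ s2.summable t2.summable
  obtain ⟨m', hm'⟩ := mix hπ' s2'.summable t2'.summable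
  refine ⟨Ω × Ω', fun p => π p.1 * π' p.2, fun p => ξ p.1 + ξ' p.2,
    fun p => η p.1 + 2 * ξ p.1 * ξ' p.2 + η' p.2, fun p => V p.1 * V' p.2,
    fun p => mul_nonneg (hπ _) (hπ' _), fun p => (norm_mul_le _ _).trans
      (mul_le_one₀ (hV _) (norm_nonneg _) (hV' _)), ?_, ?_, ?_, ?_, ?_, ?_, ?_, ?_⟩
  · simpa using mulR s0 s0'
  · refine hs_congr ((mulR s1 s0').add (mulR s0 s1')) ?_ ?_
    · intro p; ring
    · ring
  · refine hs_congr (((mulR s2 s0').add ((mulR s1 s1').mul_left 2)).add (mulR s0 s2')) ?_ ?_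
    · intro p; ring
    · ring
  · refine hs_congr (((mulR t1 s0').add ((mulR s1 s1').mul_left 2)).add (mulR s0 t1')) ?_ ?_
    · intro p; ring
    · ring
  · refine hs_congr ((((((mulR t2 s0').add ((mulR s2 s2').mul_left 4)).add (mulR s0 t2')).add
      ((mulR hm s1').mul_left 4)).add ((mulR t1 t1').mul_left 2)).add
      ((mulR s1 hm').mul_left 4)) ?_ ?_
    · intro p; ring
    · ring
  · exact mulA hV hV' s0.summable s0'.summable v0 v0'
  · refine hs_congr ((mulA hV hV' s1.summable s0'.summable v1 v0').add
      (mulA hV hV' s0.summable s1'.summable v0 v1')) ?_ ?_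
    · intro p; rw [← add_smul]; congr 1; ring
    · ring
  · refine hs_congr (((mulA hV hV' t1.summable s0'.summable v2 v0').add
      ((mulA hV hV' s1.summable s1'.summable v1 v1').const_smul (2:ℝ))).add
      (mulA hV hV' s0.summable t1'.summable v0 v2')) ?_ ?_
    · intro p; rw [smul_smul, ← add_smul, ← add_smul]; congr 1; ring
    · rw [ofNat_smul_eq_nsmul ℝ 2, nsmul_eq_mul]; push_cast; ring

lemma rep_finset [NormOneClass A] {ι : Type*} (s : Finset ι) (U : ι → A) (hU : ∀ i, ‖U i‖ ≤ 1)
    (c μ : ι → ℝ) (hμ : ∀ i ∈ s, 0 < μ i) :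
    Rep (NormedSpace.exp (∑ i ∈ s, μ i • (U i - 1))) (∑ i ∈ s, c i • (U i - 1))
      (∑ i ∈ s, c i ^ 2 / μ i) := by
  induction s using Finset.induction_on with
  | empty => simpa using rep_zero
  | insert i s hi ih =>
    rw [Finset.sum_insert hi, Finset.sum_insert hi, Finset.sum_insert hi, bexp_add]
    exact (rep_single _ (hU i) _ _ (hμ i (by simp))).mul
      (ih (fun j hj => hμ j (Finset.mem_insert_of_mem hj)))

lemma abs_bound {Ω : Type} {π ξ : Ω → ℝ} {V : Ω → A} {a : ℝ} {T : A} (hπ : ∀ x, 0 ≤ π x)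
    (hV : ∀ x, ‖V x‖ ≤ 1) (s0 : HasSum π 1) (s2 : HasSum (fun x => π x * ξ x ^ 2) a)
    (v : HasSum (fun x => (π x * ξ x) • V x) T) {s : ℝ} (hs : 0 < s) :
    ‖T‖ ≤ (a / s + s) / 2 := by
  have h := ((s2.mul_left (1 / s)).add (s0.mul_left s)).mul_left (1 / 2)
  have h2 := v.norm_le_of_bounded h (fun x => ?_)
  · refine h2.trans (le_of_eq ?_); ring
  · rw [norm_smul, Real.norm_eq_abs, abs_mul, abs_of_nonneg (hπ x)]
    have h3 : |ξ x| ≤ 1 / 2 * (1 / s * ξ x ^ 2 + s) := by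
      have : 1 / 2 * (1 / s * ξ x ^ 2 + s) - |ξ x| = (|ξ x| - s) ^ 2 / (2 * s) := by
        rw [← sq_abs (ξ x)]; field_simp; ring
      have h5 : 0 ≤ (|ξ x| - s) ^ 2 / (2 * s) := by positivity
      linarith
    calc π x * |ξ x| * ‖V x‖ ≤ π x * |ξ x| := mul_le_of_le_one_right
          (mul_nonneg (hπ x) (abs_nonneg _)) (hV x)
      _ ≤ π x * (1 / 2 * (1 / s * ξ x ^ 2 + s)) := mul_le_mul_of_nonneg_left h3 (hπ x)
      _ = _ := by ring

lemma Rep.bound1 {E R : A} {a : ℝ} (h : Rep E R a) {s : ℝ} (hs : 0 < s) :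
    ‖R * E‖ ≤ (a / s + s) / 2 := by
  obtain ⟨Ω, π, ξ, η, V, hπ, hV, s0, s1, s2, t1, t2, v0, v1, v2⟩ := h
  exact abs_bound hπ hV s0 s2 v1 hs

lemma Rep.bound2 {E R : A} {a : ℝ} (h : Rep E R a) :
    ‖R ^ 2 * E‖ ≤ √2 * a := by
  obtain ⟨Ω, π, ξ, η, V, hπ, hV, s0, s1, s2, t1, t2, v0, v1, v2⟩ := h
  have ha : 0 ≤ a := s2.nonneg (fun x => mul_nonneg (hπ x) (sq_nonneg _))
  rcases ha.eq_or_lt with rfl | ha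
  · refine le_of_forall_pos_le_add (fun e he => ?_)
    have := abs_bound hπ hV s0 t2 v2 he
    norm_num at this ⊢
    linarith
  · have := abs_bound hπ hV s0 t2 v2 (s := √2 * a) (by positivity)
    refine this.trans (le_of_eq ?_)
    have h2 : √2 * √2 = 2 := Real.mul_self_sqrt (by norm_num)
    have h3 : 2 * a ^ 2 / (√2 * a) = √2 * a := by
      rw [div_eq_iff (by positivity)]; linear_combination (-a^2) * h2
    rw [h3]; ring

lemma exp_contr [NormOneClass A] {ι : Type*} (s : Finset ι) (U : ι → A) (hU : ∀ i, ‖U i‖ ≤ 1)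
    (μ : ι → ℝ) (hμ : ∀ i ∈ s, 0 ≤ μ i) :
    ‖NormedSpace.exp (∑ i ∈ s, μ i • (U i - 1))‖ ≤ 1 := by
  induction s using Finset.induction_on with
  | empty => simp
  | insert i s hi ih =>
    rw [Finset.sum_insert hi, bexp_add]
    refine (norm_mul_le _ _).trans (mul_le_one₀ ?_ (norm_nonneg _)
      (ih (fun j hj => hμ j (Finset.mem_insert_of_mem hj))))
    have r0 : HasSum (fun n => poi (μ i) n) 1 := by simpa using poi_real (μ i) 0
    refine (poi_hasSum (μ i) (U i)).norm_le_of_bounded r0 (fun n => ?_)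
    have h0 := poi_nonneg (hμ i (by simp)) n
    rw [norm_smul, Real.norm_eq_abs, abs_of_nonneg h0]
    exact mul_le_of_le_one_right h0 ((norm_pow_le _ _).trans (pow_le_one₀ (norm_nonneg _) (hU i)))


lemma norm_lin [NormOneClass A] {ι : Type*} (s : Finset ι) (U : ι → A) (hU : ∀ i, ‖U i‖ ≤ 1)
    (c : ι → ℝ) (hc : ∀ i, 0 ≤ c i) : ‖∑ i ∈ s, c i • (U i - 1)‖ ≤ 2 * ∑ i ∈ s, c i := by
  rw [Finset.mul_sum]
  refine (norm_sum_le _ _).trans (Finset.sum_le_sum fun i _ => ?_)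
  rw [norm_smul, Real.norm_eq_abs, abs_of_nonneg (hc i), mul_comm]
  refine mul_le_mul_of_nonneg_right ?_ (hc i)
  refine (norm_sub_le _ _).trans ?_
  rw [norm_one]; linarith [hU i]

lemma deriv_bound [NormOneClass A] {ι : Type*} (sA sB : Finset ι) (U : ι → A) (hU : ∀ i, ‖U i‖ ≤ 1)
    (c μ : ι → ℝ) (hc : ∀ i, 0 ≤ c i) (hA : ∀ i ∈ sA, 0 < μ i) (hB : ∀ i ∈ sB, 0 ≤ μ i)
    (u v : ℝ) (hu0 : 0 ≤ u) (hu1 : u ≤ 1) (hv : 0 < v) (pA pB a : ℝ)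
    (hpA : pA = ∑ i ∈ sA, c i) (hpB : pB = ∑ i ∈ sB, c i) (ha : a = ∑ i ∈ sA, c i ^ 2 / μ i) :
    ‖(∑ i ∈ sA, c i • (U i - 1) + ∑ i ∈ sB, c i • (U i - 1)) ^ 2 *
      NormedSpace.exp (∑ i ∈ sA, μ i • (U i - 1) + ∑ i ∈ sB, μ i • (U i - 1))‖ ≤
      (√2 + u / v) * a + (4 * pB ^ 2 + 8 * (1 - u) * pA * pB + 4 * u * v * pB ^ 2) := by
  have hrep := rep_finset sA U hU c μ hA
  have nEA := exp_contr sA U hU μ (fun i hi => (hA i hi).le)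
  have nEB := exp_contr sB U hU μ hB
  have nRA := norm_lin sA U hU c hc
  have nRB := norm_lin sB U hU c hc
  rw [← ha] at hrep
  rw [← hpA] at nRA
  rw [← hpB] at nRB
  have a0 : 0 ≤ a := by
    rw [ha]; exact Finset.sum_nonneg fun i hi => div_nonneg (sq_nonneg _) (hA i hi).le
  have pB0 : 0 ≤ pB := by rw [hpB]; exact Finset.sum_nonneg fun i _ => hc i
  have pA0 : 0 ≤ pA := by rw [hpA]; exact Finset.sum_nonneg fun i _ => hc i
  rw [bexp_add]
  generalize (∑ i ∈ sA, c i • (U i - 1)) = RA at *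
  generalize (∑ i ∈ sB, c i • (U i - 1)) = RB at *
  generalize (NormedSpace.exp (∑ i ∈ sA, μ i • (U i - 1))) = EA at *
  generalize (NormedSpace.exp (∑ i ∈ sB, μ i • (U i - 1))) = EB at *
  have b2 := hrep.bound2
  have hE : ‖EA * EB‖ ≤ 1 := (norm_mul_le _ _).trans (mul_le_one₀ nEA (norm_nonneg _) nEB)
  have h1 : ‖RA ^ 2 * EA * EB‖ ≤ √2 * a := by
    refine (norm_mul_le _ _).trans ?_
    exact (mul_le_of_le_one_right (norm_nonneg _) nEB).trans b2
  have h2 : ‖RB ^ 2 * (EA * EB)‖ ≤ 4 * pB ^ 2 := by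
    refine (norm_mul_le _ _).trans ((mul_le_of_le_one_right (norm_nonneg _) hE).trans ?_)
    rw [pow_two]
    refine (norm_mul_le _ _).trans ?_
    nlinarith [norm_nonneg RB]
  have h3 : ‖RA * RB * (EA * EB)‖ ≤ 4 * pA * pB := by
    refine (norm_mul_le _ _).trans ((mul_le_of_le_one_right (norm_nonneg _) hE).trans ?_)
    refine (norm_mul_le _ _).trans ?_
    calc ‖RA‖ * ‖RB‖ ≤ (2 * pA) * (2 * pB) := mul_le_mul nRA nRB (norm_nonneg _) (by positivity)
      _ = _ := by ring
  have h4 : 2 * ‖RA * RB * (EA * EB)‖ ≤ a / v + 4 * v * pB ^ 2 := by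
    rcases pB0.eq_or_lt with h | h
    · rw [← h] at h3 ⊢
      have : 0 ≤ a / v := by positivity
      norm_num at h3 ⊢
      rw [h3]; simpa using this
    · have b1 := hrep.bound1 (s := 2 * v * pB) (by positivity)
      have : ‖RA * RB * (EA * EB)‖ ≤ ‖RA * EA‖ * (2 * pB) := by
        rw [show RA * RB * (EA * EB) = RA * EA * RB * EB by ring]
        refine (norm_mul_le _ _).trans ((mul_le_of_le_one_right (norm_nonneg _) nEB).trans ?_)
        exact (norm_mul_le _ _).trans (mul_le_mul_of_nonneg_left nRB (norm_nonneg _))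
      have h5 : ‖RA * EA‖ * (2 * pB) ≤ (a / (2 * v * pB) + 2 * v * pB) / 2 * (2 * pB) :=
        mul_le_mul_of_nonneg_right b1 (by positivity)
      have h6 : 2 * ((a / (2 * v * pB) + 2 * v * pB) / 2 * (2 * pB)) = a / v + 4 * v * pB ^ 2 := by
        field_simp
        ring
      linarith
  have h7 : ‖(RA + RB) ^ 2 * (EA * EB)‖ ≤
      ‖RA ^ 2 * EA * EB‖ + 2 * ‖RA * RB * (EA * EB)‖ + ‖RB ^ 2 * (EA * EB)‖ := by
    rw [show (RA + RB) ^ 2 * (EA * EB) = RA ^ 2 * EA * EB + (RA * RB * (EA * EB) +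
      RA * RB * (EA * EB)) + RB ^ 2 * (EA * EB) by ring]
    refine (norm_add_le _ _).trans ?_
    gcongr
    refine (norm_add_le _ _).trans ?_
    gcongr
    refine (norm_add_le _ _).trans ?_
    linarith
  have h8 := mul_le_mul_of_nonneg_left h4 hu0
  have h9 := mul_le_mul_of_nonneg_left h3 (sub_nonneg.2 hu1)
  have h10 : u * (a / v + 4 * v * pB ^ 2) = u / v * a + 4 * u * v * pB ^ 2 := by ring
  nlinarith

lemma main_banach [NormOneClass A] {ι : Type*} [Fintype ι]
    (p lam : ι → ℝ) (hp : ∀ r, 0 ≤ p r)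
    (hlam : ∀ r, 0 < lam r) (hplam : ∀ r, p r ≤ lam r)
    (U : ι → A) (hU : ∀ r, ‖U r‖ ≤ 1)
    (ptot : ℝ) (hptot : ptot = ∑ r, p r) (hptot1 : ptot ≤ 1)
    (R : A) (hR : R = ∑ r, p r • (U r - 1))
    (u v w : ℝ) (hu : u ∈ Set.Icc (0:ℝ) (1/2)) (hv : 0 < v) (hw : 0 < w)
    (w₀ : ℝ) (hw₀ : 1 < w₀)
    (hw₀eq : w₀ * Real.log (1 + 1 / (w₀ - 1)) - 1 = 2 / w)
    (C : ℝ)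
    (hC : C = max ((Real.sqrt 2 + u / v) * (2 / w)) (4 * (1 - u) + 2 * u * v)) :
    ‖((1 + R) * NormedSpace.exp (-R) - 1) * NormedSpace.exp (∑ r, lam r • (U r - 1))‖ ≤
      C * ∑ r, p r * min (w₀ * p r / lam r) ptot := by
  obtain ⟨hu0, hu1⟩ := hu
  set sA : Finset ι := Finset.univ.filter (fun r => w₀ * p r / lam r ≤ ptot) with hsA
  set sB : Finset ι := Finset.univ.filter (fun r => ¬ w₀ * p r / lam r ≤ ptot) with hsB
  have splitR : ∀ (f : ι → ℝ), ∑ r, f r = ∑ r ∈ sA, f r + ∑ r ∈ sB, f r := fun f =>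
    (Finset.sum_filter_add_sum_filter_not _ _ _).symm
  set pA := ∑ r ∈ sA, p r with hpA
  set pB := ∑ r ∈ sB, p r with hpB
  have hpt : ptot = pA + pB := by rw [hptot, splitR]
  set S := ∑ r ∈ sA, w₀ * p r ^ 2 / lam r with hS
  have S0 : 0 ≤ S := Finset.sum_nonneg fun i _ => by
    have := hlam i; positivity
  have pA0 : 0 ≤ pA := Finset.sum_nonneg fun i _ => hp i
  have pB0 : 0 ≤ pB := Finset.sum_nonneg fun i _ => hp i
  have hsum : ∑ r, p r * min (w₀ * p r / lam r) ptot = S + pB * ptot := by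
    rw [splitR, hS, hpB, Finset.sum_mul]
    congr 1
    · refine Finset.sum_congr rfl fun r hr => ?_
      rw [min_eq_left (Finset.mem_filter.1 hr).2]; ring
    · refine Finset.sum_congr rfl fun r hr => ?_
      rw [min_eq_right (not_le.1 (Finset.mem_filter.1 hr).2).le]
  set L := ∑ r, lam r • (U r - 1) with hL
  set K := √2 + u / v with hK
  set M := 4 * pB ^ 2 + 8 * (1 - u) * pA * pB + 4 * u * v * pB ^ 2 with hM
  have K0 : 0 ≤ K := by positivity
  -- derivative bound
  have key : ∀ t ∈ Set.Ico (0:ℝ) 1, ‖R ^ 2 * NormedSpace.exp (L + (t • (-R)))‖ ≤ K * (S / (w₀ - t)) + M := by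
    intro t ht
    have hA : ∀ i ∈ sA, 0 < lam i - t * p i := fun i _ => by
      nlinarith [hplam i, hlam i, hp i, ht.1, ht.2]
    have hB : ∀ i ∈ sB, 0 ≤ lam i - t * p i := fun i _ => by
      nlinarith [hplam i, hlam i, hp i, ht.1, ht.2]
    have h := deriv_bound sA sB U hU p (fun i => lam i - t * p i) hp hA hB u v hu0 (by linarith) hv
      pA pB _ hpA hpB rfl
    have e1 : R = ∑ i ∈ sA, p i • (U i - 1) + ∑ i ∈ sB, p i • (U i - 1) := by
      rw [hR, Finset.sum_filter_add_sum_filter_not]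
    have e2 : L + t • (-R) = ∑ i ∈ sA, (lam i - t * p i) • (U i - 1) +
        ∑ i ∈ sB, (lam i - t * p i) • (U i - 1) := by
      rw [Finset.sum_filter_add_sum_filter_not, hL, hR, smul_neg, ← sub_eq_add_neg, Finset.smul_sum,
        ← Finset.sum_sub_distrib]
      exact Finset.sum_congr rfl fun i _ => by rw [smul_smul, sub_smul]
    rw [e2, e1]
    refine h.trans ?_
    gcongr
    rw [hS, Finset.sum_div]
    refine Finset.sum_le_sum fun i hi => ?_
    have hi2 := (Finset.mem_filter.1 hi).2
    have h1 : w₀ * p i ≤ lam i := by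
      have := hi2.trans hptot1
      rwa [div_le_one (hlam i)] at this
    have h2 : 0 < w₀ - t := by linarith [ht.2]
    rw [div_div, div_le_div_iff₀ (hA i hi) (mul_pos (hlam i) h2)]
    have : t * (w₀ * p i) ≤ t * lam i := mul_le_mul_of_nonneg_left h1 ht.1
    have h3 := mul_le_mul_of_nonneg_left this (sq_nonneg (p i))
    nlinarith
  -- integrate
  let F : ℝ → A := fun t => (1 + t • R) * (NormedSpace.exp L * NormedSpace.exp (t • (-R))) - NormedSpace.exp L
  have hF : ∀ t, HasDerivAt F (-(t • (R ^ 2 * NormedSpace.exp (L + (t • (-R)))))) t := by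
    intro t
    have d1 : HasDerivAt (fun t : ℝ => 1 + t • R) R t := by
      simpa using ((hasDerivAt_id t).smul_const R).const_add 1
    have d2 := (hasDerivAt_exp_smul_const' (𝕂 := ℝ) (-R) t).const_mul (NormedSpace.exp L)
    have d3 := (d1.mul d2).sub_const (NormedSpace.exp L)
    refine d3.congr_deriv ?_
    rw [bexp_add]
    simp only [Algebra.smul_def]
    ring
  let Bf : ℝ → ℝ := fun t => K * S * (-t - w₀ * Real.log (1 - t / w₀)) + M * t ^ 2 / 2
  have hB : ∀ t ∈ Set.Icc (0:ℝ) 1, HasDerivAt Bf (t * (K * (S / (w₀ - t)) + M)) t := by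
    intro t ht
    have h0 : w₀ - t ≠ 0 := by linarith [ht.2]
    have hw : w₀ ≠ 0 := by linarith
    have h1 : (1:ℝ) - t / w₀ ≠ 0 := by
      have : 1 - t / w₀ = (w₀ - t) / w₀ := by field_simp
      rw [this]; exact div_ne_zero h0 hw
    have d1 : HasDerivAt (fun t : ℝ => 1 - t / w₀) (-(1 / w₀)) t := by
      simpa using ((hasDerivAt_id t).div_const w₀).const_sub 1
    have d2 := (((hasDerivAt_id t).neg.sub ((d1.log h1).const_mul w₀)).const_mul (K * S)).add
      (((hasDerivAt_pow 2 t).const_mul M).div_const 2)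
    refine d2.congr_deriv ?_
    have : 1 - t / w₀ = (w₀ - t) / w₀ := by field_simp
    rw [this]
    field_simp
    ring
  have fin := image_norm_le_of_norm_deriv_right_le_deriv_boundary' (f := F) (a := 0) (b := 1)
    (fun t _ => (hF t).continuousAt.continuousWithinAt)
    (fun t _ => (hF t).hasDerivWithinAt) (B := Bf) (by simp [F, Bf])
    (fun t ht => (hB t ht).continuousAt.continuousWithinAt)
    (fun t ht => (hB t (Set.Ico_subset_Icc_self ht)).hasDerivWithinAt)
    (fun t ht => by
      rw [norm_neg, norm_smul, Real.norm_eq_abs, abs_of_nonneg ht.1]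
      exact mul_le_mul_of_nonneg_left (key t ht) ht.1)
    (x := 1) (by simp)
  have hF1 : F 1 = ((1 + R) * NormedSpace.exp (-R) - 1) * NormedSpace.exp L := by
    simp only [F, one_smul]; ring
  have hB1 : Bf 1 = K * (2 / w) * S + M / 2 := by
    have e : Real.log (1 + 1 / (w₀ - 1)) = - Real.log (1 - 1 / w₀) := by
      rw [← Real.log_inv]; congr 1
      have : w₀ - 1 ≠ 0 := by linarith
      have : w₀ ≠ 0 := by linarith
      have : 1 - 1 / w₀ = (w₀ - 1) / w₀ := by field_simp
      rw [this, inv_div]; field_simp; ring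
    rw [e] at hw₀eq
    simp only [Bf]
    rw [← hw₀eq]; ring
  rw [hF1, hB1] at fin
  refine fin.trans ?_
  rw [hsum, hC, mul_add]
  have c1 : K * (2 / w) * S ≤ max (K * (2 / w)) (4 * (1 - u) + 2 * u * v) * S :=
    mul_le_mul_of_nonneg_right (le_max_left _ _) S0
  have c2 : (4 * (1 - u) + 2 * u * v) * (pB * ptot) ≤ max (K * (2 / w)) (4 * (1 - u) + 2 * u * v) * (pB * ptot) :=
    mul_le_mul_of_nonneg_right (le_max_right _ _) (by rw [hpt]; positivity)
  have c3 : M / 2 ≤ (4 * (1 - u) + 2 * u * v) * (pB * ptot) := by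
    rw [hM, hpt]
    have z1 : 0 ≤ u * v * (pB * pA) := by positivity
    have z2 : 0 ≤ (1 - 2 * u) * pB ^ 2 := mul_nonneg (by linarith) (sq_nonneg _)
    nlinarith
  linarith

end Banach

section L1alg

/-- The sequence space. -/
abbrev LL (X : Type*) := lp (fun _ : X => ℝ) 1

lemma LL.norm_eq (f : LL X) : ‖f‖ = ∑' x, |f x| := by
  have := lp.norm_eq_tsum_rpow (p := 1) (by simp) f
  simpa using this

lemma LL.summable (f : LL X) : Summable (fun x => |f x|) := by
  have := (lp.memℓp f).summable (by simp)
  simpa using this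

lemma mem_of_summable {f : X → ℝ} (h : Summable (fun x => |f x|)) : Memℓp (E := fun _ : X => ℝ) f 1 :=
  memℓp_gen (by simpa using h)

lemma summ_prod (f g : LL X) : Summable (fun q : X × X => |f q.1 * g q.2|) := by
  have := (LL.summable f).mul_of_nonneg (LL.summable g) (fun _ => abs_nonneg _) (fun _ => abs_nonneg _)
  refine this.congr (fun q => ?_)
  rw [abs_mul]

lemma summ_fib (f g : LL X) (x : X) :
    Summable (fun p : {p : X × X // p.1 + p.2 = x} => f p.1.1 * g p.1.2) :=
  (Summable.of_abs (summ_prod f g)).comp_injective Subtype.val_injective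

lemma conv_hasSum (f g : LL X) : Summable (fun x => |conv (⇑f) (⇑g) x|) ∧
    ∑' x, |conv (⇑f) (⇑g) x| ≤ ‖f‖ * ‖g‖ := by
  let e := Equiv.sigmaFiberEquiv (fun p : X × X => p.1 + p.2)
  have h1 : Summable (fun q : (Σ x, {p : X × X // p.1 + p.2 = x}) => |f q.2.1.1 * g q.2.1.2|) :=
    (e.summable_iff (f := fun q : X × X => |f q.1 * g q.2|)).2 (summ_prod f g)
  have h2 := h1.sigma
  have h3 : ∀ x, |conv (⇑f) (⇑g) x| ≤ ∑' p : {p : X × X // p.1 + p.2 = x}, |f p.1.1 * g p.1.2| := by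
    intro x
    exact norm_tsum_le_tsum_norm (f := fun p : {p : X × X // p.1 + p.2 = x} => f p.1.1 * g p.1.2)
      ((summ_prod f g).comp_injective Subtype.val_injective)
  have h4 : Summable (fun x => |conv (⇑f) (⇑g) x|) :=
    Summable.of_nonneg_of_le (fun _ => abs_nonneg _) h3 h2
  refine ⟨h4, (h4.tsum_le_tsum h3 h2).trans (le_of_eq ?_)⟩
  have h5 := h1.tsum_sigma
  rw [← h5]
  have h6 := e.tsum_eq (fun q : X × X => |f q.1 * g q.2|)
  refine Eq.trans h6 ?_
  rw [LL.norm_eq, LL.norm_eq, (LL.summable f).tsum_mul_tsum (LL.summable g)]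
  · simp only [abs_mul]
  · exact (summ_prod f g).congr (fun q => by rw [abs_mul])

/-- Convolution on the sequence space. -/
def cv (f g : LL X) : LL X := ⟨conv (⇑f) (⇑g), mem_of_summable (conv_hasSum f g).1⟩

lemma cv_coe (f g : LL X) : ⇑(cv f g) = conv (⇑f) (⇑g) := rfl

lemma cv_norm (f g : LL X) : ‖cv f g‖ ≤ ‖f‖ * ‖g‖ := by
  rw [LL.norm_eq (cv f g)]; exact (conv_hasSum f g).2

lemma cv_comm (f g : LL X) : cv f g = cv g f := by
  ext x
  rw [cv_coe, cv_coe]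
  let e : {p : X × X // p.1 + p.2 = x} ≃ {p : X × X // p.1 + p.2 = x} :=
    ⟨fun p => ⟨(p.1.2, p.1.1), by rw [add_comm]; exact p.2⟩,
     fun p => ⟨(p.1.2, p.1.1), by rw [add_comm]; exact p.2⟩, fun _ => rfl, fun _ => rfl⟩
  unfold conv
  rw [← e.tsum_eq]
  exact tsum_congr fun p => mul_comm _ _

lemma cv_add (f f' g : LL X) : cv (f + f') g = cv f g + cv f' g := by
  ext x
  rw [lp.coeFn_add, Pi.add_apply, cv_coe, cv_coe, cv_coe]
  unfold conv
  rw [← (summ_fib f g x).tsum_add (summ_fib f' g x)]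
  exact tsum_congr fun p => by rw [lp.coeFn_add, Pi.add_apply, add_mul]

lemma cv_smul (c : ℝ) (f g : LL X) : cv (c • f) g = c • cv f g := by
  ext x
  rw [lp.coeFn_smul, Pi.smul_apply, cv_coe, cv_coe]
  unfold conv
  rw [smul_eq_mul, ← tsum_mul_left]
  exact tsum_congr fun p => by rw [lp.coeFn_smul, Pi.smul_apply, smul_eq_mul, mul_assoc]

/-- Convolution as a continuous bilinear map. -/
def cvM : LL X →L[ℝ] LL X →L[ℝ] LL X :=
  LinearMap.mkContinuous₂ (LinearMap.mk₂ ℝ (cv (X := X)) cv_add cv_smul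
    (fun f g g' => by rw [cv_comm, cv_add, cv_comm f, cv_comm f])
    (fun c f g => by rw [cv_comm, cv_smul, cv_comm f])) 1
    (fun f g => by rw [one_mul]; exact cv_norm f g)

lemma cvM_apply (f g : LL X) : cvM f g = cv f g := rfl

/-- Point mass. -/
def pt (x : X) : LL X := lp.single 1 x (1 : ℝ)

lemma pt_coe (x : X) : ⇑(pt x) = delta x := by
  funext y
  simp [pt, delta, Pi.single_apply]

lemma pt_norm (x : X) : ‖pt x‖ = 1 := by
  simp [pt, lp.norm_single]

lemma ll_ext {f g : LL X →L[ℝ] LL X} (h : ∀ x, f (pt x) = g (pt x)) : f = g := by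
  refine lp.ext_continuousLinearMap (by simp) (fun i => ?_)
  ext : 1
  exact h i

lemma cv_pt (y z : X) : cv (pt y) (pt z) = pt (y + z) := by
  ext x
  rw [cv_coe, pt_coe, pt_coe, pt_coe]
  unfold conv delta
  by_cases h : x = y + z
  · rw [tsum_eq_single ⟨(y, z), h.symm⟩]
    · simp [h]
    · rintro ⟨⟨a, b⟩, hab⟩ hne
      by_cases ha : a = y
      · by_cases hb : b = z
        · subst ha; subst hb; exact absurd rfl hne
        · simp [hb]
      · simp [ha]
  · rw [if_neg h, ← tsum_zero (β := {p : X × X // p.1 + p.2 = x})]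
    refine tsum_congr ?_
    rintro ⟨⟨a, b⟩, hab⟩
    by_cases ha : a = y
    · by_cases hb : b = z
      · subst ha; subst hb; exact absurd hab.symm h
      · simp [hb]
    · simp [ha]

lemma cv_one (f : LL X) : cv (pt 0) f = f := by
  have : cvM (pt (0 : X)) = ContinuousLinearMap.id ℝ (LL X) :=
    ll_ext fun x => by simp [cvM_apply, cv_pt]
  exact congrArg (fun T : LL X →L[ℝ] LL X => T f) this

lemma cv_assoc (f g h : LL X) : cv (cv f g) h = cv f (cv g h) := by
  have h1 : ∀ (x y : X) (h : LL X), cv (cv (pt x) (pt y)) h = cv (pt x) (cv (pt y) h) := by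
    intro x y h
    have : cvM (cvM (pt x) (pt y)) = (cvM (pt x)).comp (cvM (pt y)) :=
      ll_ext fun z => by simp [cvM_apply, cv_pt, add_assoc]
    exact congrArg (fun T : LL X →L[ℝ] LL X => T h) this
  have h2 : ∀ (x : X) (g h : LL X), cv (cv (pt x) g) h = cv (pt x) (cv g h) := by
    intro x g h
    have : (cvM.flip h).comp (cvM (pt x)) = (cvM (pt x)).comp (cvM.flip h) :=
      ll_ext fun z => by simp [cvM_apply, h1]
    exact congrArg (fun T : LL X →L[ℝ] LL X => T g) this
  have : (cvM.flip h).comp (cvM.flip g) = cvM.flip (cv g h) :=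
    ll_ext fun z => by simp [cvM_apply, h2]
  exact congrArg (fun T : LL X →L[ℝ] LL X => T f) this

/-- The convolution algebra. -/
def L1 (X : Type*) := LL X

instance : NormedAddCommGroup (L1 X) := inferInstanceAs (NormedAddCommGroup (LL X))
instance : NormedSpace ℝ (L1 X) := inferInstanceAs (NormedSpace ℝ (LL X))
instance : CompleteSpace (L1 X) := inferInstanceAs (CompleteSpace (LL X))

instance : NormedCommRing (L1 X) :=
  { (inferInstance : NormedAddCommGroup (L1 X)) with
    mul := fun f g => cv (X := X) f g
    one := pt (X := X) 0
    mul_assoc := fun f g h => cv_assoc (X := X) f g h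
    mul_comm := fun f g => cv_comm (X := X) f g
    one_mul := fun f => cv_one (X := X) f
    mul_one := fun f => (cv_comm (X := X) f (pt 0)).trans (cv_one (X := X) f)
    left_distrib := fun f g h => (cvM (X := X) f).map_add g h
    right_distrib := fun f g h => cv_add (X := X) f g h
    zero_mul := fun f => by
      have := (cvM.flip (f : LL X)).map_zero
      exact this
    mul_zero := fun f => (cvM (X := X) f).map_zero
    norm_mul_le := fun f g => cv_norm (X := X) f g }

instance : NormedAlgebra ℝ (L1 X) :=
  { (Algebra.ofModule (fun c f g => cv_smul (X := X) c f g)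
      (fun c f g => (cvM (X := X) f).map_smul c g) : Algebra ℝ (L1 X)) with
    norm_smul_le := fun c f => norm_smul_le (β := LL X) c f }

instance : NormOneClass (L1 X) := ⟨pt_norm (X := X) 0⟩

/-- Underlying function. -/
def fn (f : L1 X) : X → ℝ := ⇑(show LL X from f)

lemma fn_add (f g : L1 X) : fn (f + g) = fn f + fn g := rfl
lemma fn_sub (f g : L1 X) : fn (f - g) = fn f - fn g := rfl
lemma fn_neg (f : L1 X) : fn (-f) = - fn f := rfl
lemma fn_smul (c : ℝ) (f : L1 X) : fn (c • f) = c • fn f := rfl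
lemma fn_mul (f g : L1 X) : fn (f * g) = conv (fn f) (fn g) := rfl
lemma fn_one : fn (1 : L1 X) = delta 0 := pt_coe (X := X) 0
lemma fn_sum {ι : Type*} (s : Finset ι) (f : ι → L1 X) : fn (∑ i ∈ s, f i) = ∑ i ∈ s, fn (f i) := by
  induction s using Finset.induction_on with
  | empty => rfl
  | insert i s hi ih => rw [Finset.sum_insert hi, Finset.sum_insert hi, fn_add, ih]
lemma fn_pow (f : L1 X) (n : ℕ) : fn (f ^ n) = convPow (fn f) n := by
  induction n with
  | zero => rw [pow_zero, fn_one, convPow]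
  | succ n ih => rw [pow_succ', fn_mul, ih, convPow]
lemma fn_norm (f : L1 X) : ‖f‖ = l1norm (fn f) := LL.norm_eq (X := X) f

lemma fn_exp (f : L1 X) : fn (NormedSpace.exp f) = convExp (fn f) := by
  funext x
  have h := NormedSpace.exp_series_hasSum_exp' (𝕂 := ℝ) f
  let ev : L1 X →+ ℝ := ⟨⟨fun g => fn g x, rfl⟩, fun _ _ => rfl⟩
  have hc : Continuous ev := (lp.lipschitzWith_one_eval (E := fun _ : X => ℝ) 1 x).continuous
  have h2 := h.map ev hc
  unfold convExp
  refine Eq.trans h2.tsum_eq.symm ?_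
  refine tsum_congr fun m => ?_
  show fn (((m.factorial : ℝ))⁻¹ • f ^ m) x = _
  rw [fn_smul, fn_pow]; rfl

lemma exists_fn {f : X → ℝ} (h : IsPmf f) : ∃ g : L1 X, fn g = f ∧ ‖g‖ ≤ 1 := by
  have habs : (fun x => |f x|) = f := funext fun x => abs_of_nonneg (h.1 x)
  have hs : Summable (fun x => |f x|) := by rw [habs]; exact h.2.summable
  let g : LL X := ⟨f, mem_of_summable hs⟩
  refine ⟨g, rfl, ?_⟩
  have : ‖g‖ = ∑' x, |f x| := LL.norm_eq g
  have h1 : ‖g‖ = 1 := by rw [this, habs, h.2.tsum_eq]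
  exact h1.le

end L1alg

end PaperL1

open PaperL1

/-- Lemma 4.5 of Roos (general form): with `w₀ ∈ (1,∞)` the unique solution of
`f(w₀) = 2/w`, where `f(x) = x log(1 + 1/(x-1)) - 1`, and
`C = max{(√2 + u/v)(2/w), 4(1-u) + 2uv}`, one has
`‖((δ₀+R)e^{-R} - δ₀) G‖ ≤ C Σ_r p_r min{w₀ p_r/λ_r, p}`. -/
theorem smoothness_estimate_exp_general
    {X : Type*} [AddCommMonoid X] [Countable X]
    (d : ℕ) (hd : 1 ≤ d)
    (p : Fin d → ℝ) (lam : Fin d → ℝ)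
    (hp : ∀ r, p r ∈ Set.Icc (0:ℝ) 1)
    (hlam : ∀ r, 0 < lam r) (hplam : ∀ r, p r ≤ lam r)
    (U : Fin d → X → ℝ) (hU : ∀ r, IsPmf (U r))
    (ptot : ℝ) (hptot : ptot = ∑ r, p r) (hptot1 : ptot ≤ 1)
    (R : X → ℝ) (hR : R = ∑ r, p r • (U r - delta 0))
    (G : X → ℝ) (hG : G = convExp (∑ r, lam r • (U r - delta 0)))
    (u v w : ℝ) (hu : u ∈ Set.Icc (0:ℝ) (1/2)) (hv : 0 < v) (hw : 0 < w)
    (w₀ : ℝ) (hw₀ : 1 < w₀)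
    (hw₀eq : w₀ * Real.log (1 + 1 / (w₀ - 1)) - 1 = 2 / w)
    (C : ℝ)
    (hC : C = max ((Real.sqrt 2 + u / v) * (2 / w)) (4 * (1 - u) + 2 * u * v)) :
    l1norm (conv (conv (delta 0 + R) (convExp (-R)) - delta 0) G) ≤
      C * ∑ r, p r * min (w₀ * p r / lam r) ptot := by
  choose V hV hVn using fun r => exists_fn (hU r)
  have hmain := main_banach p lam (fun r => (hp r).1) hlam hplam V hVn ptot hptot hptot1 _ rfl u v w
    hu hv hw w₀ hw₀ hw₀eq C hC
  have e : ∀ c : Fin d → ℝ, fn (∑ r, c r • (V r - 1)) = ∑ r, c r • (U r - delta 0) := by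
    intro c
    rw [fn_sum]
    exact Finset.sum_congr rfl fun r _ => by rw [fn_smul, fn_sub, fn_one, hV]
  rw [fn_norm, fn_mul, fn_sub, fn_mul, fn_add, fn_one, fn_exp, fn_exp, fn_neg, e, e, ← hR, ← hG] at hmain
  exact hmain
end
end

section
/- Let X be a countable commutative additive monoid and d ≥ 1. For r ∈ {1,…,d}, let p_r ∈ [0,1] and λ_r ∈ (0,∞) with λ_r ≥ p_r, and let U_r be probability mass functions in ℓ¹(X). Assume p := Σ_{r=1}^d p_r ≤ 1. Let R = Σ_{r=1}^d p_r(U_r − δ₀) and G = exp(Σ_{r=1}^d λ_r(U_r − δ₀)). Then ‖ ((δ₀ + R) * exp(−R) − δ₀) * G ‖ ≤ 3.11 · Σ_{r=1}^d p_r · min{ p_r/λ_r, p }. -/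
open scoped Classical BigOperators

noncomputable section

open PaperL1

namespace AbsL1
open NormedSpace Filter Topology

variable {A : Type*} [NormedCommRing A] [NormedAlgebra ℝ A] [CompleteSpace A]

lemma eadd (x y : A) : exp (x + y) = exp x * exp y := by
  let _ : NormedAlgebra ℚ A := NormedAlgebra.restrictScalars ℚ ℝ A
  exact exp_add

lemma ealg (c : ℝ) : exp (c • (1 : A)) = Real.exp c • (1 : A) := by
  have := algebraMap_exp_comm (𝕂 := ℝ) (𝔸 := A) c
  rw [Algebra.algebraMap_eq_smul_one, Algebra.algebraMap_eq_smul_one] at this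
  rw [← this, Real.exp_eq_exp_ℝ]

lemma enorm [NormOneClass A] (x : A) : ‖exp x‖ ≤ Real.exp ‖x‖ := by
  have h := exp_series_hasSum_exp' (𝕂 := ℝ) x
  have h2 := exp_series_hasSum_exp' (𝕂 := ℝ) ‖x‖
  rw [← Real.exp_eq_exp_ℝ] at h2
  rw [← h.tsum_eq, ← h2.tsum_eq]
  refine tsum_of_norm_bounded h2.summable.hasSum fun n => ?_
  rw [norm_smul, smul_eq_mul, Real.norm_of_nonneg (by positivity)]
  gcongr
  exact norm_pow_le x n

lemma enorm2 [NormOneClass A] (x : A) : ‖exp x - 1 - x‖ ≤ Real.exp ‖x‖ - 1 - ‖x‖ := by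
  have h := exp_series_hasSum_exp' (𝕂 := ℝ) x
  have h2 := exp_series_hasSum_exp' (𝕂 := ℝ) ‖x‖
  rw [← Real.exp_eq_exp_ℝ] at h2
  have h' := (hasSum_nat_add_iff' 2).2 h
  have h2' := (hasSum_nat_add_iff' 2).2 h2
  simp [Finset.sum_range_succ] at h' h2'
  rw [sub_sub, sub_sub, ← h'.tsum_eq]
  refine tsum_of_norm_bounded h2' fun n => ?_
  rw [norm_smul, Real.norm_of_nonneg (by positivity)]
  gcongr
  exact norm_pow_le x _

/-- the word estimate -/
lemma word {ι J : Type*} [Fintype ι] [Fintype J] [NormOneClass A] (u : ι → A) (hu : ∀ r, ‖u r‖ ≤ 1)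
    (lam : ι → ℝ) (hlam : ∀ r, 0 < lam r) (C : J → ℝ) (μ : J → ι → ℝ) (t : ℝ) (ht : 0 < t) (n : ℕ) :
    ‖∑ j, C j • (∑ r, μ j r • u r) ^ n‖ ≤
      (t * (∑ r, lam r) ^ n + t⁻¹ * ∑ i, ∑ j, C i * C j * (∑ r, μ i r * μ j r / lam r) ^ n) / 2 := by
  have e1 : ∑ j, C j • (∑ r, μ j r • u r) ^ n =
      ∑ f : Fin n → ι, (∑ j, C j * ∏ i, μ j (f i)) • ∏ i, u (f i) := by
    simp_rw [Fintype.sum_pow, Finset.smul_sum, Finset.sum_smul]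
    rw [Finset.sum_comm]
    refine Finset.sum_congr rfl fun f _ => Finset.sum_congr rfl fun j _ => ?_
    rw [Finset.prod_smul, smul_smul]
  have e2 : (t * (∑ r, lam r) ^ n + t⁻¹ * ∑ i, ∑ j, C i * C j * (∑ r, μ i r * μ j r / lam r) ^ n) / 2
      = ∑ f : Fin n → ι, (t * ∏ i, lam (f i) +
          t⁻¹ * ((∑ j, C j * ∏ i, μ j (f i)) ^ 2 / ∏ i, lam (f i))) / 2 := by
    rw [← Finset.sum_div, Finset.sum_add_distrib, ← Finset.mul_sum, ← Finset.mul_sum,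
      Fintype.sum_pow]
    have : ∀ f : Fin n → ι, (∑ j, C j * ∏ i, μ j (f i)) ^ 2 / ∏ i, lam (f i)
        = ∑ i, ∑ j, C i * C j * ∏ k, (μ i (f k) * μ j (f k) / lam (f k)) := by
      intro f
      rw [sq, Finset.sum_mul_sum, Finset.sum_div]
      refine Finset.sum_congr rfl fun i _ => ?_
      rw [Finset.sum_div]
      refine Finset.sum_congr rfl fun j _ => ?_
      rw [Finset.prod_div_distrib, Finset.prod_mul_distrib]
      ring
    have h2 : ∑ i, ∑ j, C i * C j * (∑ r, μ i r * μ j r / lam r) ^ n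
        = ∑ f : Fin n → ι, (∑ j, C j * ∏ i, μ j (f i)) ^ 2 / ∏ i, lam (f i) := by
      simp_rw [this]
      rw [Finset.sum_comm]
      conv_rhs => rw [Finset.sum_comm]
      conv_lhs => rw [Finset.sum_comm]
      refine Finset.sum_congr rfl fun i _ => ?_
      rw [Finset.sum_comm]
      refine Finset.sum_congr rfl fun j _ => ?_
      rw [Fintype.sum_pow, Finset.mul_sum]
    rw [h2]
  rw [e1, e2]
  refine (norm_sum_le _ _).trans (Finset.sum_le_sum fun f _ => ?_)
  rw [norm_smul]
  have hL : 0 < ∏ i, lam (f i) := Finset.prod_pos fun i _ => hlam _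
  have hU : ‖∏ i, u (f i)‖ ≤ 1 :=
    (Finset.norm_prod_le _ _).trans (Finset.prod_le_one (fun _ _ => norm_nonneg _) fun _ _ => hu _)
  set v := ∑ j, C j * ∏ i, μ j (f i)
  set w := ∏ i, lam (f i)
  have : ‖v‖ ≤ (t * w + t⁻¹ * (v ^ 2 / w)) / 2 := by
    have hw : 0 < t * w := by positivity
    have : t⁻¹ * (v ^ 2 / w) = |v| ^ 2 / (t * w) := by rw [sq_abs]; field_simp
    rw [this, Real.norm_eq_abs]
    have h3 : |v| * (t*w) * 2 ≤ (t*w)^2 + |v|^2 := by nlinarith [sq_nonneg (|v| - t * w)]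
    rw [le_div_iff₀ (by norm_num), ← sub_nonneg]
    have : t * w + |v| ^ 2 / (t * w) - |v| * 2 = (t*w - |v|)^2 / (t*w) := by field_simp; ring
    rw [this]; positivity
  calc ‖v‖ * _ ≤ ‖v‖ * 1 := by gcongr
    _ ≤ _ := by simpa using this

lemma expo {ι : Type*} [Fintype ι] (u : ι → A) (μ : ι → ℝ) :
    exp (∑ r, μ r • (u r - 1)) = Real.exp (- ∑ r, μ r) • exp (∑ r, μ r • u r) := by
  have : ∑ r, μ r • (u r - 1) = (- ∑ r, μ r) • (1 : A) + ∑ r, μ r • u r := by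
    simp [smul_sub, Finset.sum_smul]; abel
  rw [this, eadd, ealg, smul_mul_assoc, one_mul]

lemma l2 {ι J : Type*} [Fintype ι] [Fintype J] [NormOneClass A] (u : ι → A) (hu : ∀ r, ‖u r‖ ≤ 1)
    (lam : ι → ℝ) (hlam : ∀ r, 0 < lam r) (p : ι → ℝ) (c s : J → ℝ) (t : ℝ) (ht : 0 < t) :
    ‖∑ j, c j • exp (∑ r, (lam r - s j * p r) • (u r - 1))‖ ≤
      (t + t⁻¹ * ∑ i, ∑ j, c i * c j * Real.exp (s i * s j * ∑ r, p r ^ 2 / lam r)) / 2 := by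
  set μ : J → ι → ℝ := fun j r => lam r - s j * p r with hμ
  set C : J → ℝ := fun j => c j * Real.exp (- ∑ r, μ j r) with hC
  set L := ∑ r, lam r with hL
  have hF : HasSum (fun n : ℕ => ((n.factorial : ℝ)⁻¹) • ∑ j, C j • (∑ r, μ j r • u r) ^ n)
      (∑ j, c j • exp (∑ r, μ j r • (u r - 1))) := by
    have : ∀ j, HasSum (fun n : ℕ => C j • ((n.factorial : ℝ)⁻¹) • (∑ r, μ j r • u r) ^ n)
      (c j • exp (∑ r, μ j r • (u r - 1))) := by
      intro j
      rw [expo, smul_smul]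
      exact (exp_series_hasSum_exp' (𝕂 := ℝ) _).const_smul _
    convert hasSum_sum fun j (_ : j ∈ Finset.univ) => this j using 2 with n
    rw [Finset.smul_sum]
    exact Finset.sum_congr rfl fun j _ => smul_comm _ _ _
  set t' := t * Real.exp (-L) with ht'
  have ht'0 : 0 < t' := by positivity
  have rexp : ∀ x : ℝ, HasSum (fun n : ℕ => ((n.factorial : ℝ)⁻¹) * x ^ n) (Real.exp x) := by
    intro x
    have := exp_series_hasSum_exp' (𝕂 := ℝ) x
    rw [← Real.exp_eq_exp_ℝ] at this
    exact this
  have hB : HasSum (fun n : ℕ => ((n.factorial : ℝ)⁻¹) *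
      ((t' * L ^ n + t'⁻¹ * ∑ i, ∑ j, C i * C j * (∑ r, μ i r * μ j r / lam r) ^ n) / 2))
      ((t' * Real.exp L + t'⁻¹ * ∑ i, ∑ j, C i * C j * Real.exp (∑ r, μ i r * μ j r / lam r)) / 2) := by
    have h2 : HasSum (fun n : ℕ => ∑ i, ∑ j, C i * C j * (((n.factorial : ℝ)⁻¹) * (∑ r, μ i r * μ j r / lam r) ^ n))
        (∑ i, ∑ j, C i * C j * Real.exp (∑ r, μ i r * μ j r / lam r)) :=
      hasSum_sum fun i _ => hasSum_sum fun j _ => (rexp _).mul_left _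
    have h3 := (((rexp L).mul_left t').add (h2.mul_left t'⁻¹)).div_const 2
    refine Eq.mp (congrArg (fun F => HasSum F _) (funext fun n => ?_)) h3
    symm
    have : ∑ i, ∑ j, C i * C j * (((n.factorial : ℝ)⁻¹) * (∑ r, μ i r * μ j r / lam r) ^ n)
        = ((n.factorial : ℝ)⁻¹) * ∑ i, ∑ j, C i * C j * (∑ r, μ i r * μ j r / lam r) ^ n := by
      simp_rw [Finset.mul_sum]
      refine Finset.sum_congr rfl fun i _ => Finset.sum_congr rfl fun j _ => by ring
    rw [this]; ring
  have main : ‖∑ j, c j • exp (∑ r, μ j r • (u r - 1))‖ ≤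
      ((t' * Real.exp L + t'⁻¹ * ∑ i, ∑ j, C i * C j * Real.exp (∑ r, μ i r * μ j r / lam r)) / 2) := by
    rw [← hF.tsum_eq]
    refine tsum_of_norm_bounded hB fun n => ?_
    rw [norm_smul, Real.norm_of_nonneg (by positivity)]
    gcongr
    exact word u hu lam hlam C μ t' ht'0 n
  refine main.trans (le_of_eq ?_)
  congr 2
  · rw [ht', mul_assoc, ← Real.exp_add]; simp
  · rw [ht', mul_inv, mul_assoc, ← Real.exp_neg, neg_neg, Finset.mul_sum]
    congr 1
    refine Finset.sum_congr rfl fun i _ => ?_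
    rw [Finset.mul_sum]
    refine Finset.sum_congr rfl fun j _ => ?_
    have key : ∑ r, μ i r * μ j r / lam r = L - s i * ∑ r, p r - s j * ∑ r, p r
        + s i * s j * ∑ r, p r ^ 2 / lam r := by
      rw [hL, Finset.mul_sum, Finset.mul_sum, Finset.mul_sum, ← Finset.sum_sub_distrib,
        ← Finset.sum_sub_distrib, ← Finset.sum_add_distrib]
      refine Finset.sum_congr rfl fun r _ => ?_
      have := (hlam r).ne'
      simp only [hμ]; field_simp; ring
    have hM : ∀ j, ∑ r, μ j r = L - s j * ∑ r, p r := by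
      intro j; simp only [hμ, hL, Finset.sum_sub_distrib, Finset.mul_sum]
    rw [key, hC]
    simp only [hM]
    have : Real.exp L * (c i * Real.exp (-(L - s i * ∑ r, p r)) * (c j * Real.exp (-(L - s j * ∑ r, p r)))
       * Real.exp (L - s i * ∑ r, p r - s j * ∑ r, p r + s i * s j * ∑ r, p r ^ 2 / lam r))
       = c i * c j * (Real.exp L * (Real.exp (-(L - s i * ∑ r, p r)) * (Real.exp (-(L - s j * ∑ r, p r))
       * Real.exp (L - s i * ∑ r, p r - s j * ∑ r, p r + s i * s j * ∑ r, p r ^ 2 / lam r)))) := by ring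
    rw [this, ← Real.exp_add, ← Real.exp_add, ← Real.exp_add]
    congr 2; ring

lemma amgm {x Q K : ℝ} (h : ∀ t : ℝ, 0 < t → x ≤ (t + t⁻¹ * Q) / 2) (hK : 0 ≤ K) (hQ : Q ≤ K ^ 2) :
    x ≤ K := by
  refine le_of_forall_pos_le_add fun ε hε => ?_
  have ht : 0 < K + ε := by positivity
  refine (h _ ht).trans ?_
  have : (K + ε)⁻¹ * Q ≤ K + ε := by
    rw [inv_mul_le_iff₀ ht]; nlinarith
  linarith

lemma exp_quad {a : ℝ} (h0 : 0 ≤ a) (h1 : a ≤ 1) : Real.exp a ≤ 1 + a + 3 / 4 * a ^ 2 := by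
  have := Real.exp_bound' h0 h1 (n := 2) (by norm_num)
  norm_num [Finset.sum_range_succ] at this
  linarith

/-- `x = Σ p_r (u_r - 1)`, `g = exp (Σ lam_r (u_r - 1))`. -/
lemma bound1 {ι : Type*} [Fintype ι] [NormOneClass A] (u : ι → A) (hu : ∀ r, ‖u r‖ ≤ 1)
    (lam : ι → ℝ) (hlam : ∀ r, 0 < lam r) (p : ι → ℝ) (x g : A) (hx : x = ∑ r, p r • (u r - 1))
    (hg : g = exp (∑ r, lam r • (u r - 1))) (a k : ℝ) (ha : a = ∑ r, p r ^ 2 / lam r) (ha1 : a ≤ 1)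
    (hk : 0 ≤ k) (hk2 : k ^ 2 = 7 / 4) : ‖(exp (-x) - 1) * g‖ ≤ k * √ a := by
  have ha0 : 0 ≤ a := by
    rw [ha]; exact Finset.sum_nonneg fun r _ => div_nonneg (sq_nonneg _) (hlam r).le
  have key : ∀ s : ℝ, exp (∑ r, (lam r - s * p r) • (u r - 1)) = exp ((-s) • x) * g := by
    intro s
    rw [hg, ← eadd, hx, Finset.smul_sum, ← Finset.sum_add_distrib]
    congr 1
    refine Finset.sum_congr rfl fun r _ => ?_
    rw [smul_smul, ← add_smul]; congr 1; ring
  have h := fun t ht => l2 u hu lam hlam p ![1, -1] ![1, 0] t ht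
  simp only [key, Fin.sum_univ_two, ← ha] at h
  simp at h
  refine amgm (Q := Real.exp a - 1) ?_ (by positivity) ?_
  · intro t ht
    convert h t ht using 2
    · ring
    · ring
  · rw [mul_pow, Real.sq_sqrt ha0, hk2]
    nlinarith [exp_quad ha0 ha1]

lemma bound2 {ι : Type*} [Fintype ι] [NormOneClass A] (u : ι → A) (hu : ∀ r, ‖u r‖ ≤ 1)
    (lam : ι → ℝ) (hlam : ∀ r, 0 < lam r) (p : ι → ℝ) (x g : A) (hx : x = ∑ r, p r • (u r - 1))
    (hg : g = exp (∑ r, lam r • (u r - 1))) (a k : ℝ) (ha : a = ∑ r, p r ^ 2 / lam r) (ha1 : a ≤ 1)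
    (hk : 0 ≤ k) (hk2 : k ^ 2 = 7 / 4) : ‖((1 + x) * exp (-x) - 1) * g‖ ≤ k * a := by
  have ha0 : 0 ≤ a := by
    rw [ha]; exact Finset.sum_nonneg fun r _ => div_nonneg (sq_nonneg _) (hlam r).le
  have key : ∀ s : ℝ, exp (∑ r, (lam r - s * p r) • (u r - 1)) = exp ((-s) • x) * g := by
    intro s
    rw [hg, ← eadd, hx, Finset.smul_sum, ← Finset.sum_add_distrib]
    congr 1
    refine Finset.sum_congr rfl fun r _ => ?_
    rw [smul_smul, ← add_smul]; congr 1; ring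
  refine amgm (Q := Real.exp a * (1 - a + a ^ 2) - 1) ?_ (by positivity) ?_
  · intro t ht
    have h : ∀ h : ℝ, h ≠ 0 →
        ‖(exp ((-1 : ℝ) • x) + h⁻¹ • (exp ((-1 + h) • x) - exp ((-1 : ℝ) • x)) - 1) * g‖ ≤
        (t + t⁻¹ * (Real.exp a * ((h⁻¹ * (Real.exp (-a * h) - 1)) ^ 2 +
          Real.exp (-a * h) ^ 2 * ((h⁻¹) ^ 2 * (Real.exp (a * h ^ 2) - 1))
          + 2 * (h⁻¹ * (Real.exp (-a * h) - 1)) + 1) - 1)) / 2 := by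
      intro h hh
      have := l2 u hu lam hlam p ![h⁻¹, 1 - h⁻¹, -1] ![1 - h, 1, 0] t ht
      simp only [key, Fin.sum_univ_three, ← ha] at this
      simp at this
      convert this using 2
      · rw [show (-1 + h) = h - 1 by ring]
        simp only [smul_sub, sub_mul, add_mul, smul_mul_assoc, one_smul, one_mul, neg_smul, sub_smul (1 : ℝ)]
        abel
      · congr 2
        have e1 : Real.exp ((1 - h) * a) = Real.exp a * Real.exp (-a * h) := by
          rw [← Real.exp_add]; congr 1; ring
        have e2 : Real.exp ((1 - h) * (1 - h) * a) =
            Real.exp a * Real.exp (-a * h) ^ 2 * Real.exp (a * h ^ 2) := by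
          rw [sq (Real.exp _), ← Real.exp_add, ← Real.exp_add, ← Real.exp_add]; congr 1; ring
        rw [e1, e2]; ring
    have d1 : Tendsto (fun h : ℝ => h⁻¹ * (Real.exp (-a * h) - 1)) (𝓝[≠] 0) (𝓝 (-a)) := by
      have : HasDerivAt (fun h : ℝ => Real.exp (-a * h)) (-a) 0 := by
        have := ((hasDerivAt_id (0 : ℝ)).const_mul (-a)).exp
        simpa using this
      have := this.tendsto_slope_zero
      simpa using this
    have d2 : Tendsto (fun h : ℝ => (h⁻¹) ^ 2 * (Real.exp (a * h ^ 2) - 1)) (𝓝[≠] 0) (𝓝 a) := by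
      have h0 : HasDerivAt (fun h : ℝ => Real.exp (a * h)) a 0 := by
        have := ((hasDerivAt_id (0 : ℝ)).const_mul a).exp
        simpa using this
      have h1 := h0.tendsto_slope_zero
      have h2 : Tendsto (fun h : ℝ => h ^ 2) (𝓝[≠] 0) (𝓝[≠] 0) := by
        refine tendsto_nhdsWithin_iff.2 ⟨?_, ?_⟩
        · have : Tendsto (fun h : ℝ => h ^ 2) (𝓝 0) (𝓝 (0 ^ 2)) := (continuous_pow 2).tendsto 0
          simp only [ne_eq, OfNat.ofNat_ne_zero, not_false_eq_true, zero_pow] at this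
          exact this.mono_left nhdsWithin_le_nhds
        · filter_upwards [self_mem_nhdsWithin] with h hh
          exact pow_ne_zero 2 hh
      have := h1.comp h2
      simpa [Function.comp_def] using this
    have d3 : Tendsto (fun h : ℝ => Real.exp (-a * h)) (𝓝[≠] 0) (𝓝 1) := by
      have : Continuous (fun h : ℝ => Real.exp (-a * h)) := by fun_prop
      have := this.tendsto 0
      simp only [mul_zero, Real.exp_zero] at this
      exact this.mono_left nhdsWithin_le_nhds
    have d4 : Tendsto (fun h : ℝ => h⁻¹ • (exp ((-1 + h) • x) - exp ((-1 : ℝ) • x))) (𝓝[≠] 0)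
        (𝓝 (x * exp ((-1 : ℝ) • x))) :=
      (hasDerivAt_exp_smul_const' (𝕂 := ℝ) x (-1 : ℝ)).tendsto_slope_zero
    have L1 : Tendsto (fun h : ℝ =>
        ‖(exp ((-1 : ℝ) • x) + h⁻¹ • (exp ((-1 + h) • x) - exp ((-1 : ℝ) • x)) - 1) * g‖) (𝓝[≠] 0)
        (𝓝 ‖(exp ((-1 : ℝ) • x) + x * exp ((-1 : ℝ) • x) - 1) * g‖) :=
      (((d4.const_add _).sub_const 1).mul_const g).norm
    have L2 := ((((((((d1.pow 2).add ((d3.pow 2).mul d2)).add (d1.const_mul 2)).add_const 1).const_mul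
      (Real.exp a)).sub_const 1).const_mul t⁻¹).const_add t).div_const 2
    have := le_of_tendsto_of_tendsto L1 L2
      (by filter_upwards [self_mem_nhdsWithin] with h' hh; exact h h' hh)
    rw [neg_one_smul] at this
    calc _ = ‖(exp (-x) + x * exp (-x) - 1) * g‖ := by congr 1; ring
      _ ≤ _ := this
      _ = _ := by ring
  · rw [mul_pow, hk2]
    have h1 := exp_quad ha0 ha1
    have h2 : 0 ≤ 1 - a + a ^ 2 := by nlinarith [sq_nonneg a]
    have h3 := mul_le_mul_of_nonneg_right h1 h2
    nlinarith [mul_nonneg (sq_nonneg a) (sub_nonneg.2 ha1), mul_nonneg (sq_nonneg a) (mul_nonneg ha0 (sub_nonneg.2 ha1))]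

/-- compound Poisson elements are contractions -/
lemma cp {ι : Type*} [Fintype ι] [NormOneClass A] (u : ι → A) (hu : ∀ r, ‖u r‖ ≤ 1)
    (μ : ι → ℝ) (hμ : ∀ r, 0 ≤ μ r) : ‖exp (∑ r, μ r • (u r - 1))‖ ≤ 1 := by
  rw [expo, norm_smul, Real.norm_of_nonneg (Real.exp_nonneg _)]
  have h : ‖∑ r, μ r • u r‖ ≤ ∑ r, μ r := by
    refine (norm_sum_le _ _).trans (Finset.sum_le_sum fun r _ => ?_)
    rw [norm_smul, Real.norm_of_nonneg (hμ r)]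
    exact mul_le_of_le_one_right (hμ r) (hu r)
  calc _ ≤ Real.exp (-∑ r, μ r) * Real.exp (∑ r, μ r) := by
        gcongr
        exact (enorm _).trans (Real.exp_le_exp.2 h)
    _ = 1 := by rw [← Real.exp_add]; simp

lemma ynorm {ι : Type*} [Fintype ι] [NormOneClass A] (u : ι → A) (hu : ∀ r, ‖u r‖ ≤ 1)
    (p : ι → ℝ) (hp : ∀ r, 0 ≤ p r) : ‖∑ r, p r • (u r - 1)‖ ≤ 2 * ∑ r, p r := by
  rw [Finset.mul_sum]
  refine (norm_sum_le _ _).trans (Finset.sum_le_sum fun r _ => ?_)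
  rw [norm_smul, Real.norm_of_nonneg (hp r), mul_comm]
  refine mul_le_mul_of_nonneg_right ?_ (hp r)
  refine (norm_sub_le _ _).trans ?_
  rw [norm_one]; linarith [hu r]

lemma ybound {ι : Type*} [Fintype ι] [NormOneClass A] (u : ι → A) (hu : ∀ r, ‖u r‖ ≤ 1)
    (p : ι → ℝ) (hp : ∀ r, 0 ≤ p r) (y : A) (hy : y = ∑ r, p r • (u r - 1)) (b : ℝ)
    (hb : b = ∑ r, p r) : ‖exp y - 1 - y‖ ≤ 2 * b ^ 2 := by
  have hb0 : 0 ≤ b := by rw [hb]; exact Finset.sum_nonneg fun r _ => hp r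
  set B := ∑ r, p r • u r with hB
  have hBn : ‖B‖ ≤ b := by
    rw [hb]
    refine (norm_sum_le _ _).trans (Finset.sum_le_sum fun r _ => ?_)
    rw [norm_smul, Real.norm_of_nonneg (hp r)]
    exact mul_le_of_le_one_right (hp r) (hu r)
  have e1 : exp y = Real.exp (-b) • exp B := by rw [hy, expo, hb]
  have e2 : y = B - b • (1 : A) := by
    rw [hy, hB, hb, Finset.sum_smul, ← Finset.sum_sub_distrib]
    simp [smul_sub]
  have e3 : exp y - 1 - y = (Real.exp (-b) - 1 + b) • (1 : A) - (1 - Real.exp (-b)) • B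
      + Real.exp (-b) • (exp B - 1 - B) := by
    rw [e1, e2]; module
  have h1 : 0 ≤ Real.exp (-b) - 1 + b := by linarith [Real.add_one_le_exp (-b)]
  have h2 : 0 ≤ 1 - Real.exp (-b) := by
    have := Real.exp_le_one_iff.2 (neg_nonpos.2 hb0); linarith
  have h3 : ‖exp B - 1 - B‖ ≤ Real.exp b - 1 - b := by
    have h := exp_series_hasSum_exp' (𝕂 := ℝ) B
    have h2 := exp_series_hasSum_exp' (𝕂 := ℝ) b
    rw [← Real.exp_eq_exp_ℝ] at h2
    have h' := (hasSum_nat_add_iff' 2).2 h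
    have h2' := (hasSum_nat_add_iff' 2).2 h2
    simp [Finset.sum_range_succ] at h' h2'
    rw [sub_sub, sub_sub, ← h'.tsum_eq]
    refine tsum_of_norm_bounded h2' fun n => ?_
    rw [norm_smul, Real.norm_of_nonneg (by positivity)]
    gcongr
    exact (norm_pow_le B _).trans (by gcongr)
  rw [e3]
  have h4 : ‖(Real.exp (-b) - 1 + b) • (1 : A)‖ = Real.exp (-b) - 1 + b := by
    rw [norm_smul, norm_one, mul_one, Real.norm_of_nonneg h1]
  have h5 : ‖(1 - Real.exp (-b)) • B‖ ≤ (1 - Real.exp (-b)) * b := by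
    rw [norm_smul, Real.norm_of_nonneg h2]; gcongr
  have h6 : ‖Real.exp (-b) • (exp B - 1 - B)‖ ≤ Real.exp (-b) * (Real.exp b - 1 - b) := by
    rw [norm_smul, Real.norm_of_nonneg (Real.exp_nonneg _)]; gcongr
  have h7 : Real.exp (-b) * Real.exp b = 1 := by rw [← Real.exp_add]; simp
  have h8 := norm_add_le ((Real.exp (-b) - 1 + b) • (1 : A) - (1 - Real.exp (-b)) • B)
    (Real.exp (-b) • (exp B - 1 - B))
  have h9 := norm_sub_le ((Real.exp (-b) - 1 + b) • (1 : A)) ((1 - Real.exp (-b)) • B)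
  nlinarith [mul_nonneg hb0 h1]

theorem absMain {ι : Type*} [Fintype ι] [NormOneClass A] (u : ι → A) (hu : ∀ r, ‖u r‖ ≤ 1)
    (p lam : ι → ℝ) (hp : ∀ r, 0 ≤ p r) (hlam : ∀ r, 0 < lam r) (hplam : ∀ r, p r ≤ lam r)
    (P : ℝ) (hP : P = ∑ r, p r) (hP1 : P ≤ 1) (R G : A) (hR : R = ∑ r, p r • (u r - 1))
    (hG : G = exp (∑ r, lam r • (u r - 1))) :
    ‖((1 + R) * exp (-R) - 1) * G‖ ≤ 3.11 * ∑ r, p r * min (p r / lam r) P := by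
  set s := Finset.univ.filter (fun r => p r / lam r ≤ P) with hs
  set s' := Finset.univ.filter (fun r => ¬ p r / lam r ≤ P) with hs'
  have split : ∀ {M : Type _} [AddCommMonoid M] (f : ι → M), ∑ r, f r = ∑ r ∈ s, f r + ∑ r ∈ s', f r :=
    fun f => (Finset.sum_filter_add_sum_filter_not _ _ _).symm
  have split' : ∀ (f : ι → ℝ), ∑ r, f r = ∑ r ∈ s, f r + ∑ r ∈ s', f r :=
    fun f => (Finset.sum_filter_add_sum_filter_not _ _ _).symm
  set x := ∑ r ∈ s, p r • (u r - 1) with hx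
  set y := ∑ r ∈ s', p r • (u r - 1) with hy
  set g := exp (∑ r ∈ s, lam r • (u r - 1)) with hg
  set g' := exp (∑ r ∈ s', (lam r - p r) • (u r - 1)) with hg'
  set a := ∑ r ∈ s, p r ^ 2 / lam r with ha
  set b := ∑ r ∈ s', p r with hb
  have hb0 : 0 ≤ b := Finset.sum_nonneg fun r _ => hp r
  have ha0 : 0 ≤ a := Finset.sum_nonneg fun r _ => div_nonneg (sq_nonneg _) (hlam r).le
  have hsP : ∑ r ∈ s, p r + b = P := by rw [hP, split']
  have hs0 : 0 ≤ ∑ r ∈ s, p r := Finset.sum_nonneg fun r _ => hp r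
  have haP : a ≤ 1 := by
    have : a ≤ ∑ r ∈ s, p r := by
      refine Finset.sum_le_sum fun r _ => ?_
      rw [div_le_iff₀ (hlam r), sq]
      exact mul_le_mul_of_nonneg_left (hplam r) (hp r)
    linarith
  have hbP : b ≤ P := by linarith
  have hRs : R = x + y := by rw [hR, split]
  have hGs : G = g * (exp y * g') := by
    rw [hG, split, eadd, hg, hg', ← eadd y, hy, ← Finset.sum_add_distrib]
    congr 2
    refine Finset.sum_congr rfl fun r _ => ?_
    rw [← add_smul]; congr 1; ring
  have hxy : exp (-R) * exp y = exp (-x) := by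
    rw [← eadd, hRs]; congr 1; ring
  have hdec : ((1 + R) * exp (-R) - 1) * G = (((1 + x) * exp (-x) - 1) * g + y * ((exp (-x) - 1) * g)
      - (exp y - 1 - y) * g) * g' := by
    have : ((1 + R) * exp (-R) - 1) * G = ((1 + R) * (exp (-R) * exp y) - exp y) * g * g' := by
      rw [hGs]; ring
    rw [this, hxy, hRs]; ring
  have hus : ∀ r : s, ‖u r‖ ≤ 1 := fun r => hu r
  have hus' : ∀ r : s', ‖u r‖ ≤ 1 := fun r => hu r
  have hxs : x = ∑ r : s, p r • (u r - 1) := by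
    rw [hx]; exact (Finset.sum_coe_sort s (fun r => p r • (u r - 1))).symm
  have hys : y = ∑ r : s', p r • (u r - 1) := by
    rw [hy]; exact (Finset.sum_coe_sort s' (fun r => p r • (u r - 1))).symm
  have hgs : g = exp (∑ r : s, lam r • (u r - 1)) := by
    rw [hg]; exact congrArg _ (Finset.sum_coe_sort s (fun r => lam r • (u r - 1))).symm
  have hgs' : g' = exp (∑ r : s', (lam r - p r) • (u r - 1)) := by
    rw [hg']; exact congrArg _ (Finset.sum_coe_sort s' (fun r => (lam r - p r) • (u r - 1))).symm
  have has : a = ∑ r : s, p r ^ 2 / lam r := by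
    rw [ha]; exact (Finset.sum_coe_sort s (fun r => p r ^ 2 / lam r)).symm
  have hbs : b = ∑ r : s', p r := by
    rw [hb]; exact (Finset.sum_coe_sort s' (fun r => p r)).symm
  have hk2 : √(7 / 4 : ℝ) ^ 2 = 7 / 4 := Real.sq_sqrt (by norm_num)
  set k := √(7 / 4 : ℝ) with hk
  have hk0 : 0 ≤ k := Real.sqrt_nonneg _
  have hk1 : k ≤ 1.33 := by nlinarith
  have B1 := bound2 (fun r : s => u r) hus (fun r : s => lam r) (fun r => hlam r) (fun r : s => p r)
    x g hxs hgs a k has haP hk0 hk2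
  have B2 := bound1 (fun r : s => u r) hus (fun r : s => lam r) (fun r => hlam r) (fun r : s => p r)
    x g hxs hgs a k has haP hk0 hk2
  have B3 := ybound (fun r : s' => u r) hus' (fun r : s' => p r) (fun r => hp r) y hys b hbs
  have B4 : ‖y‖ ≤ 2 * b := by
    rw [hys, hbs]; exact ynorm (fun r : s' => u r) hus' (fun r : s' => p r) (fun r => hp r)
  have B5 : ‖g‖ ≤ 1 := by
    rw [hgs]; exact cp (fun r : s => u r) hus (fun r : s => lam r) (fun r => (hlam r).le)
  have B6 : ‖g'‖ ≤ 1 := by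
    rw [hgs']
    exact cp (fun r : s' => u r) hus' (fun r : s' => lam r - p r) (fun r => sub_nonneg.2 (hplam r))
  have T2 : ‖y * ((exp (-x) - 1) * g)‖ ≤ 2 * b * (k * √ a) :=
    (norm_mul_le _ _).trans (mul_le_mul B4 B2 (norm_nonneg _) (by positivity))
  have T3 : ‖(exp y - 1 - y) * g‖ ≤ 2 * b ^ 2 := by
    calc _ ≤ _ := norm_mul_le _ _
      _ ≤ 2 * b ^ 2 * 1 := mul_le_mul B3 B5 (norm_nonneg _) (by positivity)
      _ = _ := mul_one _
  have T : ‖((1 + R) * exp (-R) - 1) * G‖ ≤ k * a + 2 * b * (k * √ a) + 2 * b ^ 2 := by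
    rw [hdec]
    refine (norm_mul_le _ _).trans ((mul_le_of_le_one_right (norm_nonneg _) B6).trans ?_)
    refine (norm_sub_le _ _).trans (add_le_add ((norm_add_le _ _).trans (add_le_add B1 T2)) T3)
  have hrhs : ∑ r, p r * min (p r / lam r) P = a + P * b := by
    rw [split']
    congr 1
    · refine Finset.sum_congr rfl fun r hr => ?_
      rw [min_eq_left (Finset.mem_filter.1 hr).2]; ring
    · rw [hb, Finset.mul_sum]
      refine Finset.sum_congr rfl fun r hr => ?_
      rw [min_eq_right (not_le.1 (Finset.mem_filter.1 hr).2).le]; ring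
  rw [hrhs]
  refine T.trans ?_
  have hPb : b ^ 2 ≤ P * b := by nlinarith
  set q := √ a with hq
  have hq0 : 0 ≤ q := Real.sqrt_nonneg _
  have hqa : q ^ 2 = a := Real.sq_sqrt ha0
  rw [← hqa]
  have c1 : k * q ^ 2 ≤ 1.33 * q ^ 2 := by gcongr
  have c2 : 2 * b * (k * q) ≤ 2 * b * (1.33 * q) := by gcongr
  nlinarith [sq_nonneg (1.78 * q - 1.33 * b), sq_nonneg (q - b), sq_nonneg (1.33 * q - b)]

end AbsL1

namespace RealL1
open PaperL1 NormedSpace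

variable {X : Type*} [AddCommMonoid X]
variable {A : Type*} [NormedCommRing A] [NormedAlgebra ℝ A] [CompleteSpace A]

/-- a faithful isometric representation of `ℓ¹(X)` -/
structure Rep (X : Type*) [AddCommMonoid X] (A : Type*) [NormedCommRing A] [NormedAlgebra ℝ A] where
  S : X → A
  zero : S 0 = 1
  add : ∀ x y, S (x + y) = S x * S y
  nrm : ∀ x, ‖S x‖ ≤ 1
  lower : ∀ f : X → ℝ, Summable f → ∑' x, |f x| ≤ ‖∑' x, f x • S x‖

def T (ρ : Rep X A) (f : X → ℝ) : A := ∑' x, f x • ρ.S x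

lemma sumn (ρ : Rep X A) {f : X → ℝ} (hf : Summable f) : Summable fun x => ‖f x • ρ.S x‖ := by
  refine Summable.of_nonneg_of_le (fun _ => norm_nonneg _) (fun x => ?_) hf.abs
  rw [norm_smul, Real.norm_eq_abs]
  exact mul_le_of_le_one_right (abs_nonneg _) (ρ.nrm x)

lemma sums (ρ : Rep X A) {f : X → ℝ} (hf : Summable f) : Summable fun x => f x • ρ.S x :=
  (sumn ρ hf).of_norm

lemma Tadd (ρ : Rep X A) {f g : X → ℝ} (hf : Summable f) (hg : Summable g) :
    T ρ (f + g) = T ρ f + T ρ g := by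
  unfold T
  rw [← (sums ρ hf).tsum_add (sums ρ hg)]
  simp [add_smul]

lemma Tsmul (ρ : Rep X A) (c : ℝ) {f : X → ℝ} (hf : Summable f) :
    T ρ (c • f) = c • T ρ f := by
  unfold T
  rw [← (sums ρ hf).tsum_const_smul c]
  simp [smul_smul]

lemma Tneg (ρ : Rep X A) {f : X → ℝ} (hf : Summable f) :
    T ρ (-f) = - T ρ f := by
  have := Tsmul ρ (-1) hf
  simpa using this

lemma Tsub (ρ : Rep X A) {f g : X → ℝ} (hf : Summable f) (hg : Summable g) :
    T ρ (f - g) = T ρ f - T ρ g := by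
  have hn : Summable (-g) := hg.neg
  rw [sub_eq_add_neg, Tadd ρ hf hn, Tneg ρ hg, sub_eq_add_neg]

lemma sdelta : Summable (delta (0 : X)) := by
  refine summable_of_ne_finset_zero (s := {0}) fun x hx => ?_
  simp at hx
  simp [delta, hx]

lemma Tdelta (ρ : Rep X A) : T ρ (delta (0 : X)) = 1 := by
  unfold T
  rw [tsum_eq_single 0]
  · simp [delta, ρ.zero]
  · intro x hx; simp [delta, hx]

lemma ssum {ι : Type*} (s : Finset ι) (f : ι → X → ℝ) (hf : ∀ i, Summable (f i)) :
    Summable (∑ i ∈ s, f i) := by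
  have := summable_sum (s := s) fun i _ => hf i
  convert this using 1
  ext x; simp

lemma Tsum (ρ : Rep X A) {ι : Type*} (s : Finset ι) (f : ι → X → ℝ) (hf : ∀ i, Summable (f i)) :
    T ρ (∑ i ∈ s, f i) = ∑ i ∈ s, T ρ (f i) := by
  induction s using Finset.induction_on with
  | empty => simp [T]
  | insert i s hi ih =>
    rw [Finset.sum_insert hi, Finset.sum_insert hi, Tadd ρ (hf i) (ssum s f hf), ih]

lemma sconv {f g : X → ℝ} (hf : Summable f) (hg : Summable g) : Summable (conv f g) := by
  have h : Summable fun p : X × X => f p.1 * g p.2 :=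
    summable_mul_of_summable_norm hf.norm hg.norm
  have h2 := (Equiv.sigmaFiberEquiv (fun p : X × X => p.1 + p.2)).summable_iff.2 h
  exact h2.sigma

lemma Tconv (ρ : Rep X A) {f g : X → ℝ} (hf : Summable f) (hg : Summable g) :
    T ρ (conv f g) = T ρ f * T ρ g := by
  unfold T
  rw [tsum_mul_tsum_of_summable_norm (sumn ρ hf) (sumn ρ hg)]
  have h : Summable fun p : X × X => (f p.1 • ρ.S p.1) * (g p.2 • ρ.S p.2) :=
    summable_mul_of_summable_norm (f := fun x => f x • ρ.S x) (g := fun x => g x • ρ.S x)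
      (sumn ρ hf) (sumn ρ hg)
  have h0 : Summable fun p : X × X => f p.1 * g p.2 :=
    summable_mul_of_summable_norm hf.norm hg.norm
  have h2 := (Equiv.sigmaFiberEquiv (fun p : X × X => p.1 + p.2)).summable_iff.2 h
  rw [← (Equiv.sigmaFiberEquiv (fun p : X × X => p.1 + p.2)).tsum_eq]
  have h3 := h2.tsum_sigma
  refine Eq.trans ?_ h3.symm
  refine tsum_congr fun x => ?_
  have h4 : Summable fun p : {p : X × X // p.1 + p.2 = x} => f p.1.1 * g p.1.2 :=
    h0.comp_injective Subtype.val_injective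
  unfold conv
  rw [← h4.tsum_smul_const]
  refine tsum_congr fun c => ?_
  have : ρ.S x = ρ.S c.1.1 * ρ.S c.1.2 := by rw [← ρ.add, c.2]
  rw [this]
  simp only [Function.comp, Equiv.sigmaFiberEquiv, Equiv.coe_fn_mk]
  rw [smul_mul_smul_comm]

lemma spow {f : X → ℝ} (hf : Summable f) (n : ℕ) : Summable (convPow f n) := by
  induction n with
  | zero => exact sdelta
  | succ n ih => exact sconv hf ih

lemma Tpow (ρ : Rep X A) {f : X → ℝ} (hf : Summable f) (n : ℕ) : T ρ (convPow f n) = T ρ f ^ n := by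
  induction n with
  | zero => simpa [convPow] using Tdelta ρ
  | succ n ih => rw [convPow, Tconv ρ hf (spow hf n), ih, pow_succ']

lemma sdouble [NormOneClass A] (ρ : Rep X A) {f : X → ℝ} (hf : Summable f) :
    Summable fun q : ℕ × X => ((q.1.factorial : ℝ))⁻¹ * convPow f q.1 q.2 := by
  rw [← summable_abs_iff]
  refine (summable_prod_of_nonneg fun _ => abs_nonneg _).2 ⟨fun n => ?_, ?_⟩
  · have h := Summable.mul_left ((n.factorial : ℝ)⁻¹) (spow hf n)
    exact h.abs
  · have h : Summable fun n : ℕ => ((n.factorial : ℝ))⁻¹ * ‖T ρ f‖ ^ n := by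
      exact expSeries_summable' (𝕂 := ℝ) ‖T ρ f‖
    refine Summable.of_nonneg_of_le (fun n => tsum_nonneg fun _ => abs_nonneg _) (fun n => ?_) h
    simp only [abs_mul, tsum_mul_left]
    rw [abs_of_nonneg (by positivity)]
    gcongr
    refine (ρ.lower _ (spow hf n)).trans ?_
    change ‖T ρ (convPow f n)‖ ≤ _
    rw [Tpow ρ hf]
    exact norm_pow_le _ _

lemma sexp [NormOneClass A] (ρ : Rep X A) {f : X → ℝ} (hf : Summable f) :
    Summable (convExp f) := by
  have := (Equiv.prodComm X ℕ).summable_iff.2 (sdouble ρ hf)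
  exact this.prod

lemma Texp [NormOneClass A] (ρ : Rep X A) {f : X → ℝ} (hf : Summable f) :
    T ρ (convExp f) = exp (T ρ f) := by
  have hd := sdouble ρ hf
  have h1 : Summable fun q : ℕ × X => (((q.1.factorial : ℝ))⁻¹ * convPow f q.1 q.2) • ρ.S q.2 := by
    refine Summable.of_norm (Summable.of_nonneg_of_le (fun _ => norm_nonneg _) (fun q => ?_) hd.abs)
    rw [norm_smul, Real.norm_eq_abs]
    exact mul_le_of_le_one_right (abs_nonneg _) (ρ.nrm _)
  rw [exp_eq_tsum ℝ]
  simp only [← Tpow ρ hf]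
  have e1 : ∀ n : ℕ, ((n.factorial : ℝ)⁻¹) • T ρ (convPow f n)
      = ∑' x, (((n.factorial : ℝ))⁻¹ * convPow f n x) • ρ.S x := by
    intro n
    rw [← Tsmul ρ _ (spow hf n)]
    rfl
  simp only [e1]
  have h2 := Summable.tsum_comm (f := fun (n : ℕ) (x : X) =>
    (((n.factorial : ℝ))⁻¹ * convPow f n x) • ρ.S x) h1
  rw [← h2]
  unfold T
  refine tsum_congr fun x => ?_
  unfold convExp
  have h3 : Summable fun n : ℕ => ((n.factorial : ℝ))⁻¹ * convPow f n x :=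
    ((Equiv.prodComm X ℕ).summable_iff.2 hd).prod_factor x
  rw [h3.tsum_smul_const]

/-! The concrete representation on bounded functions. -/

open BoundedContinuousFunction

def Op (X : Type*) [TopologicalSpace X] : Type _ := (X →ᵇ ℝ) →L[ℝ] (X →ᵇ ℝ)

/-- the underlying operator -/
def opFun {X : Type*} [TopologicalSpace X] (a : Op X) : (X →ᵇ ℝ) →L[ℝ] (X →ᵇ ℝ) := a

instance opRing (X : Type*) [TopologicalSpace X] : NormedRing (Op X) :=
  inferInstanceAs (NormedRing ((X →ᵇ ℝ) →L[ℝ] (X →ᵇ ℝ)))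

instance opAlg (X : Type*) [TopologicalSpace X] : NormedAlgebra ℝ (Op X) :=
  inferInstanceAs (NormedAlgebra ℝ ((X →ᵇ ℝ) →L[ℝ] (X →ᵇ ℝ)))

instance opComplete (X : Type*) [TopologicalSpace X] : CompleteSpace (Op X) :=
  inferInstanceAs (CompleteSpace ((X →ᵇ ℝ) →L[ℝ] (X →ᵇ ℝ)))

lemma op_norm_one (X : Type*) [TopologicalSpace X] [Nonempty X] : ‖(1 : Op X)‖ = 1 := by
  have : Nontrivial (X →ᵇ ℝ) := by
    refine ⟨⟨0, BoundedContinuousFunction.const X 1, fun h => ?_⟩⟩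
    obtain ⟨x⟩ := ‹Nonempty X›
    have := congrArg (fun φ : X →ᵇ ℝ => φ x) h
    simp at this
  exact ContinuousLinearMap.norm_id (𝕜 := ℝ) (E := X →ᵇ ℝ)

def shift (X : Type*) [AddCommMonoid X] [TopologicalSpace X] [DiscreteTopology X] (x : X) :
    Op X :=
  LinearMap.mkContinuous
    { toFun := fun φ => φ.compContinuous ⟨fun y => x + y, continuous_of_discreteTopology⟩
      map_add' := fun _ _ => rfl
      map_smul' := fun _ _ => rfl } 1
    (fun φ => by
      rw [one_mul]
      exact norm_compContinuous_le _ _)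

lemma shift_apply [TopologicalSpace X] [DiscreteTopology X] (x y : X) (φ : X →ᵇ ℝ) :
    opFun (shift X x) φ y = φ (x + y) := rfl

lemma shift_norm [TopologicalSpace X] [DiscreteTopology X] (x : X) : ‖shift X x‖ ≤ 1 :=
  LinearMap.mkContinuous_norm_le _ zero_le_one _

lemma shift_zero [TopologicalSpace X] [DiscreteTopology X] : shift X 0 = 1 := by
  refine ContinuousLinearMap.ext fun φ => BoundedContinuousFunction.ext fun y => ?_
  change φ (0 + y) = φ y
  rw [zero_add]

lemma shift_add [TopologicalSpace X] [DiscreteTopology X] (x y : X) :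
    shift X (x + y) = shift X x * shift X y := by
  refine ContinuousLinearMap.ext fun φ => BoundedContinuousFunction.ext fun z => ?_
  change φ (x + y + z) = φ (y + (x + z))
  congr 1; abel

def Alg (X : Type*) [AddCommMonoid X] [TopologicalSpace X] [DiscreteTopology X] :
    Subalgebra ℝ (Op X) :=
  (Algebra.adjoin ℝ (Set.range (shift X))).topologicalClosure

lemma alg_comm [TopologicalSpace X] [DiscreteTopology X] (a b : Alg X) : a * b = b * a := by
  have h : ∀ a b : Algebra.adjoin ℝ (Set.range (shift X)), a * b = b * a := by
    have hc : ∀ a ∈ Set.range (shift X), ∀ b ∈ Set.range (shift X), a * b = b * a := by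
      rintro _ ⟨x, rfl⟩ _ ⟨y, rfl⟩
      rw [← shift_add, ← shift_add, add_comm]
    have := Algebra.isMulCommutative_adjoin ℝ hc
    exact fun a b => mul_comm' a b
  exact (Subalgebra.commRingTopologicalClosure _ h).mul_comm a b

instance algRing [TopologicalSpace X] [DiscreteTopology X] : NormedCommRing (Alg X) :=
  { (inferInstance : NormedRing (Alg X)) with mul_comm := alg_comm }

instance algComplete [TopologicalSpace X] [DiscreteTopology X] : CompleteSpace (Alg X) := by
  have : IsClosed ((Alg X : Subalgebra ℝ _) : Set (Op X)) :=
    Subalgebra.isClosed_topologicalClosure _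
  exact this.completeSpace_coe

instance algNormed [TopologicalSpace X] [DiscreteTopology X] : NormedAlgebra ℝ (Alg X) :=
  Subalgebra.toNormedAlgebra (Alg X)

instance algOne [TopologicalSpace X] [DiscreteTopology X] : NormOneClass (Alg X) :=
  ⟨by
    change ‖(1 : Op X)‖ = 1
    exact op_norm_one X⟩

def shiftA [TopologicalSpace X] [DiscreteTopology X] (x : X) : Alg X :=
  ⟨shift X x, Subalgebra.le_topologicalClosure _ (Algebra.subset_adjoin ⟨x, rfl⟩)⟩

lemma shiftA_norm [TopologicalSpace X] [DiscreteTopology X] (x : X) : ‖shiftA x‖ ≤ 1 :=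
  shift_norm x

def ev [TopologicalSpace X] [DiscreteTopology X] (φ : X →ᵇ ℝ) : Alg X →L[ℝ] ℝ :=
  LinearMap.mkContinuous
    { toFun := fun a => (opFun a.1) φ 0
      map_add' := fun _ _ => rfl
      map_smul' := fun _ _ => rfl } ‖φ‖
    (fun a => by
      rw [mul_comm]
      refine (BoundedContinuousFunction.norm_coe_le_norm _ _).trans ?_
      exact ContinuousLinearMap.le_opNorm (opFun a.1) φ)

lemma ev_shift [TopologicalSpace X] [DiscreteTopology X] (φ : X →ᵇ ℝ) (x : X) :
    ev φ (shiftA x) = φ x := by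
  change φ (x + 0) = φ x
  rw [add_zero]

lemma ev_norm [TopologicalSpace X] [DiscreteTopology X] (φ : X →ᵇ ℝ) (hφ : ‖φ‖ ≤ 1) :
    ‖ev φ‖ ≤ 1 := (LinearMap.mkContinuous_norm_le _ (norm_nonneg _) _).trans hφ

def signB [TopologicalSpace X] [DiscreteTopology X] (f : X → ℝ) : X →ᵇ ℝ :=
  BoundedContinuousFunction.ofNormedAddCommGroup (fun x => if 0 ≤ f x then (1 : ℝ) else -1)
    continuous_of_discreteTopology 1 (fun x => by split_ifs <;> simp)

lemma signB_norm [TopologicalSpace X] [DiscreteTopology X] (f : X → ℝ) : ‖signB f‖ ≤ 1 :=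
  BoundedContinuousFunction.norm_ofNormedAddCommGroup_le _ zero_le_one _

def rep [TopologicalSpace X] [DiscreteTopology X] : Rep X (Alg X) where
  S := shiftA
  zero := Subtype.ext shift_zero
  add x y := Subtype.ext (shift_add x y)
  nrm := shiftA_norm
  lower f hf := by
    have hs : Summable fun x => f x • (shiftA x : Alg X) := by
      refine Summable.of_norm ?_
      refine Summable.of_nonneg_of_le (fun _ => norm_nonneg _) (fun x => ?_) hf.abs
      rw [norm_smul, Real.norm_eq_abs]
      exact mul_le_of_le_one_right (abs_nonneg _) (shiftA_norm x)
    have h1 : ev (signB f) (∑' x, f x • (shiftA x : Alg X)) = ∑' x, |f x| := by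
      rw [(ev (signB f)).map_tsum hs]
      refine tsum_congr fun x => ?_
      rw [map_smul, ev_shift, smul_eq_mul]
      change f x * (if 0 ≤ f x then (1 : ℝ) else -1) = |f x|
      split_ifs with h
      · rw [abs_of_nonneg h, mul_one]
      · rw [abs_of_neg (not_le.1 h)]; ring
    rw [← h1]
    refine (le_abs_self _).trans ?_
    refine ((ev (signB f)).le_opNorm _).trans ?_
    exact mul_le_of_le_one_left (norm_nonneg _) (ev_norm _ (signB_norm f))

end RealL1

/-- Lemma 4.5 of Roos (explicit constants):
`‖((δ₀+R)e^{-R} - δ₀) G‖ ≤ 3.11 Σ_r p_r min{p_r/λ_r, p}`. -/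
theorem smoothness_estimate_exp_explicit
    {X : Type*} [AddCommMonoid X] [Countable X]
    (d : ℕ) (hd : 1 ≤ d)
    (p : Fin d → ℝ) (lam : Fin d → ℝ)
    (hp : ∀ r, p r ∈ Set.Icc (0:ℝ) 1)
    (hlam : ∀ r, 0 < lam r) (hplam : ∀ r, p r ≤ lam r)
    (U : Fin d → X → ℝ) (hU : ∀ r, IsPmf (U r))
    (ptot : ℝ) (hptot : ptot = ∑ r, p r) (hptot1 : ptot ≤ 1)
    (R : X → ℝ) (hR : R = ∑ r, p r • (U r - delta 0))
    (G : X → ℝ) (hG : G = convExp (∑ r, lam r • (U r - delta 0))) :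
    l1norm (conv (conv (delta 0 + R) (convExp (-R)) - delta 0) G) ≤
      3.11 * ∑ r, p r * min (p r / lam r) ptot := by
  let _ : TopologicalSpace X := ⊥
  have _ : DiscreteTopology X := ⟨rfl⟩
  set ρ : RealL1.Rep X (RealL1.Alg X) := RealL1.rep with hρ
  have hUs : ∀ r, Summable (U r) := fun r => (hU r).2.summable
  have hUd : ∀ r, Summable (U r - delta 0) := fun r => (hUs r).sub RealL1.sdelta
  have hc : ∀ c : Fin d → ℝ, Summable (∑ r, c r • (U r - delta 0)) := fun c =>
    RealL1.ssum _ _ fun r => (hUd r).const_smul (c r)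
  have hT : ∀ c : Fin d → ℝ, RealL1.T ρ (∑ r, c r • (U r - delta 0)) =
      ∑ r, c r • (RealL1.T ρ (U r) - 1) := by
    intro c
    have hcs : ∀ r, Summable (c r • (U r - delta 0)) := fun r => (hUd r).const_smul (c r)
    rw [RealL1.Tsum ρ Finset.univ (fun r => c r • (U r - delta 0)) hcs]
    refine Finset.sum_congr rfl fun r _ => ?_
    rw [RealL1.Tsmul ρ _ (hUd r), RealL1.Tsub ρ (hUs r) RealL1.sdelta, RealL1.Tdelta]
  have hRs : Summable R := by rw [hR]; exact hc p
  have hGs : Summable G := by rw [hG]; exact RealL1.sexp ρ (hc lam)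
  have hnR : Summable (-R) := hRs.neg
  have hEs : Summable (convExp (-R)) := RealL1.sexp ρ hnR
  have hdR : Summable (delta 0 + R) := RealL1.sdelta.add hRs
  have h1 := RealL1.sconv hdR hEs
  have h2 : Summable (conv (delta 0 + R) (convExp (-R)) - delta 0) := h1.sub RealL1.sdelta
  have h3 := RealL1.sconv h2 hGs
  have hu : ∀ r, ‖RealL1.T ρ (U r)‖ ≤ 1 := by
    intro r
    refine tsum_of_norm_bounded (hU r).2 fun x => ?_
    rw [norm_smul, Real.norm_of_nonneg ((hU r).1 x)]
    exact mul_le_of_le_one_right ((hU r).1 x) (ρ.nrm x)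
  refine (ρ.lower _ h3).trans ?_
  change ‖RealL1.T ρ _‖ ≤ _
  rw [RealL1.Tconv ρ h2 hGs, RealL1.Tsub ρ h1 RealL1.sdelta, RealL1.Tconv ρ hdR hEs,
    RealL1.Tadd ρ RealL1.sdelta hRs, RealL1.Tdelta, RealL1.Texp ρ hnR, RealL1.Tneg ρ hRs]
  refine AbsL1.absMain (fun r => RealL1.T ρ (U r)) hu p lam (fun r => (hp r).1) hlam hplam ptot hptot
    hptot1 (RealL1.T ρ R) (RealL1.T ρ G) ?_ ?_
  · rw [hR, hT]
  · rw [hG, RealL1.Texp ρ (hc lam), hT]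
end
end
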